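/- Let η_+(t) = h_H(t) · t e^{−t²/2} with H ≥ 50, and let x ≥ 10^8. Assume all nontrivial zeros ρ of the Riemann zeta function ζ(s) with |Im(ρ)| ≤ T₀ lie on the critical line, where T₀ ≥ 2H + max(H/4, 50). Then ∑_{n=1}^∞ Λ(n) (log n) η_+²(n/x) = x · ∫_0^∞ η_+²(t) log(xt) dt + O*(err) · x log x, where err = (0.607 (log T₀)²/log x + 1.21 log T₀) √T₀ e^{−π(T₀ − 2H)/4} + (2.06 √T₀ log T₀ + 43.87) x^{−1/2}. -/

import Mathlib

open MeasureTheory Set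

/-- `h(t) = t²(2-t)³ e^{t-1/2}` on `[0,2]`, and `0` elsewhere. -/
noncomputable def hcut (t : ℝ) : ℝ :=
  if t ∈ Set.Icc (0:ℝ) 2 then t^2 * (2 - t)^3 * Real.exp (t - 1/2) else 0

/-- The kernel `F_H(y) = sin(H log y)/(π log y)`. -/
noncomputable def FH (H y : ℝ) : ℝ := Real.sin (H * Real.log y) / (Real.pi * Real.log y)

/-- `h_H = h ∗_M F_H`, the band-limited approximation to `h`. -/
noncomputable def hH (H t : ℝ) : ℝ := ∫ y in Set.Ioi (0:ℝ), hcut (t / y) * FH H y / y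

/-- `η₊(t) = h_H(t) · t e^{-t²/2}`. -/
noncomputable def etaPlus (H t : ℝ) : ℝ := hH H t * (t * Real.exp (-t^2 / 2))


open MeasureTheory Set

namespace EP
open Complex Metric Filter Topology

lemma factor1 {g : ℂ → ℂ} (hg : Differentiable ℂ g) (a : ℂ) (ht : analyticOrderAt g a ≠ ⊤) :
    ∃ k : ℂ → ℂ, Differentiable ℂ k ∧ k a ≠ 0 ∧
      ∀ z, g z = (z - a) ^ (analyticOrderNatAt g a) * k z := by
  have hga : AnalyticAt ℂ g a := (hg.analyticAt a)
  obtain ⟨k2, h2a, h2n, h2e⟩ := (hga.analyticOrderNatAt_eq_iff ht).1 rfl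
  set m := analyticOrderNatAt g a
  set k : ℂ → ℂ := Function.update (fun z => g z / (z - a) ^ m) a (k2 a) with hk
  have hka : k a = k2 a := by simp [hk]
  have hkne : ∀ z, z ≠ a → k z = g z / (z - a) ^ m := fun z hz => by simp [hk, hz]
  have hloc : k =ᶠ[𝓝 a] k2 := by
    filter_upwards [h2e] with z hz
    by_cases h : z = a
    · rw [h, hka]
    · rw [hkne z h, hz, smul_eq_mul]
      have : (z - a) ^ m ≠ 0 := pow_ne_zero _ (sub_ne_zero.2 h)
      field_simp
  refine ⟨k, ?_, by rw [hka]; exact h2n, ?_⟩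
  · intro z
    by_cases h : z = a
    · rw [h]; exact (hloc.differentiableAt_iff).2 h2a.differentiableAt
    · have : k =ᶠ[𝓝 z] (fun z => g z / (z - a) ^ m) := by
        filter_upwards [isOpen_ne.mem_nhds h] with w hw using hkne w hw
      refine this.differentiableAt_iff.2 ?_
      refine (hg z).div (by fun_prop) (pow_ne_zero _ (sub_ne_zero.2 h))
  · intro z
    by_cases h : z = a
    · have := h2e.self_of_nhds
      rw [h, this, hka, smul_eq_mul]
    · rw [hkne z h]
      have : (z - a) ^ m ≠ 0 := pow_ne_zero _ (sub_ne_zero.2 h)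
      field_simp

lemma order_ne_top {f : ℂ → ℂ} (hf : Differentiable ℂ f) {w₀ : ℂ} (h0 : f w₀ ≠ 0) (a : ℂ) :
    analyticOrderAt f a ≠ ⊤ := by
  intro h
  rw [analyticOrderAt_eq_top] at h
  have hA : AnalyticOnNhd ℂ f univ := fun z _ => hf.analyticAt z
  have := hA.eqOn_zero_of_preconnected_of_eventuallyEq_zero isPreconnected_univ (mem_univ a) h
  exact h0 (this (mem_univ _))

lemma factorS {f : ℂ → ℂ} (hf : Differentiable ℂ f) {w₀ : ℂ} (h0 : f w₀ ≠ 0) (S : Finset ℂ) :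
    ∃ g : ℂ → ℂ, Differentiable ℂ g ∧ (∀ a ∈ S, g a ≠ 0) ∧
      ∀ z, f z = (∏ a ∈ S, (z - a) ^ (analyticOrderNatAt f a)) * g z := by
  classical
  induction S using Finset.induction_on with
  | empty => exact ⟨f, hf, by simp, by simp⟩
  | insert a S ha ih =>
    obtain ⟨g, hg, hgS, hfg⟩ := ih
    have hP : AnalyticAt ℂ (fun z : ℂ => ∏ b ∈ S, (z - b) ^ (analyticOrderNatAt f b)) a := by
      have : Differentiable ℂ (fun z : ℂ => ∏ b ∈ S, (z - b) ^ (analyticOrderNatAt f b)) := by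
        fun_prop
      exact this.analyticAt a
    have hP0 : analyticOrderAt (fun z : ℂ => ∏ b ∈ S, (z - b) ^ (analyticOrderNatAt f b)) a = 0 := by
      rw [hP.analyticOrderAt_eq_zero]
      refine Finset.prod_ne_zero_iff.2 fun b hb => pow_ne_zero _ (sub_ne_zero.2 ?_)
      rintro rfl; exact ha hb
    have hord : analyticOrderAt f a = analyticOrderAt g a := by
      have h1 := analyticOrderAt_mul hP (hg.analyticAt a)
      rw [hP0, zero_add] at h1
      rw [← h1]; congr 1; ext z; exact hfg z
    have hnat : analyticOrderNatAt f a = analyticOrderNatAt g a := by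
      simp [analyticOrderNatAt, hord]
    obtain ⟨k, hk, hka, hgk⟩ := factor1 hg a (hord ▸ order_ne_top hf h0 a)
    refine ⟨k, hk, ?_, ?_⟩
    · intro b hb
      rcases Finset.mem_insert.1 hb with rfl | hb
      · exact hka
      · intro h; apply hgS b hb; rw [hgk, h, mul_zero]
    · intro z
      rw [Finset.prod_insert ha, hfg z, hgk z, hnat]; ring

lemma zeros_finite {f : ℂ → ℂ} (hf : Differentiable ℂ f) {w₀ : ℂ} (h0 : f w₀ ≠ 0) (R : ℝ) :
    {z : ℂ | f z = 0 ∧ ‖z‖ ≤ R}.Finite := by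
  by_contra hinf
  have hinf : {z : ℂ | f z = 0 ∧ ‖z‖ ≤ R}.Infinite := hinf
  obtain ⟨a, -, ha⟩ := hinf.exists_accPt_of_subset_isCompact (isCompact_closedBall (0:ℂ) R)
    (fun z hz => by simpa using hz.2)
  have hfr : ∃ᶠ z in 𝓝[≠] a, f z = 0 := by
    rw [accPt_iff_frequently_nhdsNE] at ha
    exact ha.mono fun z hz => hz.1
  have hA : AnalyticOnNhd ℂ f univ := fun z _ => hf.analyticAt z
  have := hA.eqOn_zero_of_preconnected_of_frequently_eq_zero isPreconnected_univ (mem_univ a) hfr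
  exact h0 (this (mem_univ _))

/-- key estimate for nonvanishing even functions -/
lemma logDeriv_small {G : ℂ → ℂ} (hG : Differentiable ℂ G) (hev : ∀ z, G (-z) = G z) {R B : ℝ}
    (hR : 0 < R) (hB : 0 < B) (hne : ∀ z, ‖z‖ ≤ R → G z ≠ 0) (h0 : G 0 = 1)
    (hb : ∀ z, ‖z‖ ≤ R → ‖G z‖ ≤ Real.exp B) {z : ℂ} (hz : ‖z‖ < R / 8) :
    ‖logDeriv G z‖ ≤ 64 * B * ‖z‖ / R ^ 2 := by
  have hd : DifferentiableOn ℂ (logDeriv G) (ball 0 R) := by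
    intro w hw
    have hw' : ‖w‖ < R := by simpa using hw
    refine DifferentiableAt.differentiableWithinAt ?_
    have h1 : DifferentiableAt ℂ (deriv G) w := (hG.analyticAt w).deriv.differentiableAt
    exact h1.div (hG w) (hne w hw'.le)
  obtain ⟨L, hL0, hL⟩ := hd.isExactOn_ball.with_val_at 0 0
  have hexp : ∀ w ∈ ball (0:ℂ) R, Complex.exp (L w) = G w := by
    have hc : ∀ w ∈ ball (0:ℂ) R, HasDerivAt (fun w => G w * Complex.exp (- L w)) 0 w := by
      intro w hw
      have hw' : ‖w‖ < R := by simpa using hw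
      have h1 := (hG w).hasDerivAt.mul ((hL w hw).neg.cexp)
      refine h1.congr_deriv ?_
      simp only [logDeriv_apply]
      have := hne w hw'.le
      field_simp
      ring
    intro w hw
    have h2 : G w * Complex.exp (- L w) = G 0 * Complex.exp (- L 0) := by
      refine (convex_ball (0:ℂ) R).is_const_of_fderivWithin_eq_zero (𝕜 := ℂ)
        (f := fun w => G w * Complex.exp (- L w)) (fun y hy => (hc y hy).differentiableAt.differentiableWithinAt) ?_ hw (by simpa using hR)
      intro y hy
      rw [fderivWithin_of_isOpen isOpen_ball hy]
      have := (hc y hy).hasFDerivAt.fderiv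
      rw [this]; ext; simp
    rw [h0, hL0, neg_zero, Complex.exp_zero, mul_one, Complex.exp_neg] at h2
    have := Complex.exp_ne_zero (L w)
    field_simp at h2
    exact h2.symm
  have hLd : DifferentiableOn ℂ L (ball 0 R) := fun w hw => (hL w hw).differentiableAt.differentiableWithinAt
  have hLre : MapsTo L (ball 0 R) {z | z.re ≤ B} := by
    intro w hw
    have hw' : ‖w‖ < R := by simpa using hw
    have h1 := hb w hw'.le
    rw [← hexp w hw, Complex.norm_exp] at h1
    exact Real.exp_le_exp.1 h1
  have hLb : ∀ w, ‖w‖ ≤ R / 2 → ‖L w‖ ≤ 2 * B := by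
    intro w hw
    have := borelCaratheodory_zero hB hLd hLre hR (z := w) (by simp; linarith) hL0
    refine this.trans ?_
    rw [div_le_iff₀ (by linarith)]
    nlinarith
  have hderiv : ∀ w, ‖w‖ < R → deriv L w = logDeriv G w := fun w hw =>
    (hL w (by simpa using hw)).deriv
  have hb1 : ∀ w, ‖w‖ ≤ R / 4 → ‖logDeriv G w‖ ≤ 8 * B / R := by
    intro w hw
    rw [← hderiv w (by linarith)]
    have : ‖deriv L w‖ ≤ 2 * B / (R / 4) := by
      refine norm_deriv_le_of_forall_mem_sphere_norm_le (by positivity) ?_ ?_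
      · refine (hLd.mono ?_).diffContOnCl
        refine closure_ball_subset_closedBall.trans ?_
        intro y hy
        simp only [mem_closedBall, mem_ball, dist_zero_right] at hy ⊢
        have := norm_sub_norm_le y w
        rw [dist_eq_norm] at hy; linarith
      · intro y hy
        apply hLb
        simp only [mem_sphere] at hy
        have := norm_sub_norm_le y w
        rw [dist_eq_norm] at hy; linarith
    refine this.trans (le_of_eq ?_)
    field_simp; ring
  have hb2 : ∀ w, ‖w‖ ≤ R / 8 → ‖deriv (logDeriv G) w‖ ≤ 64 * B / R ^ 2 := by
    intro w hw
    have : ‖deriv (logDeriv G) w‖ ≤ (8 * B / R) / (R / 8) := by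
      refine norm_deriv_le_of_forall_mem_sphere_norm_le (by positivity) ?_ ?_
      · refine (hd.mono ?_).diffContOnCl
        refine closure_ball_subset_closedBall.trans ?_
        intro y hy
        simp only [mem_closedBall, mem_ball, dist_zero_right] at hy ⊢
        have := norm_sub_norm_le y w
        rw [dist_eq_norm] at hy; linarith
      · intro y hy
        apply hb1
        simp only [mem_sphere] at hy
        have := norm_sub_norm_le y w
        rw [dist_eq_norm] at hy; linarith
    refine this.trans (le_of_eq ?_)
    field_simp; ring
  have hzero : logDeriv G 0 = 0 := by
    have h1 : deriv (fun w => G (-w)) 0 = - deriv G (-0) := deriv_comp_neg G 0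
    have h2 : (fun w => G (-w)) = G := funext hev
    rw [h2, neg_zero] at h1
    have h3 : deriv G 0 = 0 := by linear_combination (1/2 : ℂ) * h1
    simp [logDeriv_apply, h3]
  have := (convex_ball (0:ℂ) (R/8)).norm_image_sub_le_of_norm_deriv_le (f := logDeriv G)
    (C := 64 * B / R^2) (x := 0) (y := z)
    (fun y hy => (hd y (by simp at hy ⊢; linarith)).differentiableAt (isOpen_ball.mem_nhds (by simp at hy ⊢; linarith)))
    (fun y hy => hb2 y (by simp at hy; linarith)) (by simp; linarith) (by simpa using hz)
  rw [hzero, sub_zero, sub_zero] at this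
  refine this.trans (le_of_eq (by ring))

end EP

open MeasureTheory Set

namespace EP
open Complex Metric Filter Topology

noncomputable def zeros {f : ℂ → ℂ} (hf : Differentiable ℂ f) {w₀ : ℂ} (h0 : f w₀ ≠ 0) (R : ℝ) : Finset ℂ :=
  (zeros_finite hf h0 R).toFinset

lemma mem_zeros {f : ℂ → ℂ} (hf : Differentiable ℂ f) {w₀ : ℂ} (h0 : f w₀ ≠ 0) (R : ℝ) (z : ℂ) :
    z ∈ zeros hf h0 R ↔ f z = 0 ∧ ‖z‖ ≤ R := by simp [zeros]

lemma hadamard_est {f : ℂ → ℂ} (hf : Differentiable ℂ f) (h0 : f 0 ≠ 0) (hev : ∀ z, f (-z) = f z)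
    {R B : ℝ} (hR : 0 < R) (hB : 0 < B) (hb : ∀ z, ‖z‖ = 2 * R → ‖f z‖ ≤ Real.exp B * ‖f 0‖)
    {z : ℂ} (hz : ‖z‖ < R / 8) (hfz : f z ≠ 0) :
    ‖logDeriv f z - ∑ a ∈ zeros hf h0 R, (analyticOrderNatAt f a : ℂ) * ((1 / (z - a) + 1 / (z + a)) / 2)‖
      ≤ 64 * B * ‖z‖ / R ^ 2 := by
  set S := zeros hf h0 R with hS
  obtain ⟨g, hg, hgS, hfg⟩ := factorS hf h0 S
  set P : ℂ → ℂ := fun z => ∏ a ∈ S, (z - a) ^ (analyticOrderNatAt f a) with hP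
  have hSn : ∀ a ∈ S, a ≠ 0 := by
    rintro a ha rfl
    exact h0 ((mem_zeros hf h0 R 0).1 ha).1
  have hP0 : P 0 ≠ 0 := by
    refine Finset.prod_ne_zero_iff.2 fun b hb => pow_ne_zero _ ?_
    simpa using hSn b hb
  have hgne : ∀ w, ‖w‖ ≤ R → g w ≠ 0 := by
    intro w hw h
    by_cases hwS : w ∈ S
    · exact hgS w hwS h
    · apply hwS; rw [hS, mem_zeros]; exact ⟨by rw [hfg, h, mul_zero], hw⟩
  have hg0 : g 0 ≠ 0 := hgne 0 (by simpa using hR.le)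
  set G : ℂ → ℂ := fun w => g w * g (-w) / (g 0 * g 0) with hGdef
  have hG : Differentiable ℂ G := by
    have : Differentiable ℂ fun w => g (-w) := hg.comp differentiable_neg
    exact (hg.mul this).div_const _
  have hGev : ∀ w, G (-w) = G w := fun w => by simp [hGdef, mul_comm]
  have hfw : ∀ w, f w * f w = P w * P (-w) * (G w * (g 0 * g 0)) := by
    intro w
    have h1 := hfg w
    have h2 := hfg (-w)
    rw [hev] at h2
    calc f w * f w = (P w * g w) * (P (-w) * g (-w)) := by
          conv_lhs => rw [h2]
          rw [← h2]; nth_rw 1 [h1]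
      _ = _ := by simp only [hGdef]; field_simp
  have hPlow : ∀ w, ‖w‖ = 2 * R → ‖P 0‖ ≤ ‖P w‖ := by
    intro w hw
    simp only [hP, norm_prod, norm_pow]
    refine Finset.prod_le_prod (fun _ _ => by positivity) fun a ha => ?_
    refine pow_le_pow_left₀ (norm_nonneg _) ?_ _
    have h1 := ((mem_zeros hf h0 R a).1 ha).2
    have h2 := norm_sub_norm_le w a
    rw [zero_sub, norm_neg]; linarith
  have hGb : ∀ w, ‖w‖ ≤ R → ‖G w‖ ≤ Real.exp (2 * B) := by
    intro w hw
    refine norm_le_of_forall_mem_frontier_norm_le (U := ball (0:ℂ) (2 * R)) isBounded_ball hG.diffContOnCl ?_ (subset_closure (by simp; linarith))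
    intro y hy
    rw [frontier_ball _ (by positivity)] at hy
    have hy : ‖y‖ = 2 * R := by simpa using hy
    have e1 := congrArg norm (hfw y)
    have e0 : ‖f 0‖ = ‖P 0‖ * ‖g 0‖ := by rw [hfg 0, norm_mul]
    simp only [norm_mul] at e1
    have l1 := hPlow y hy
    have l2 := hPlow (-y) (by simpa using hy)
    have l3 := hb y hy
    have p0 : 0 < ‖P 0‖ := norm_pos_iff.2 hP0
    have q0 : 0 < ‖g 0‖ := norm_pos_iff.2 hg0
    have e2 : ‖P 0‖ * ‖P 0‖ * (‖G y‖ * (‖g 0‖ * ‖g 0‖)) ≤ (Real.exp B * ‖f 0‖) * (Real.exp B * ‖f 0‖) := by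
      calc _ ≤ ‖P y‖ * ‖P (-y)‖ * (‖G y‖ * (‖g 0‖ * ‖g 0‖)) := by gcongr
        _ = ‖f y‖ * ‖f y‖ := e1.symm
        _ ≤ _ := by gcongr
    rw [e0] at e2
    have e3 : Real.exp (2 * B) = Real.exp B * Real.exp B := by rw [← Real.exp_add]; ring_nf
    rw [e3]
    have : (‖P 0‖ * ‖P 0‖ * (‖g 0‖ * ‖g 0‖)) * ‖G y‖ ≤ (‖P 0‖ * ‖P 0‖ * (‖g 0‖ * ‖g 0‖)) * (Real.exp B * Real.exp B) := by
      linarith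
    exact le_of_mul_le_mul_left this (by positivity)
  have key := logDeriv_small hG hGev hR (B := 2 * B) (by positivity)
    (fun w hw => div_ne_zero (mul_ne_zero (hgne w hw) (hgne _ (by simpa using hw))) (mul_ne_zero hg0 hg0))
    (by simp [hGdef, hg0]) hGb hz
  have hgz : g z ≠ 0 := hgne z (by linarith)
  have hgz' : g (-z) ≠ 0 := hgne _ (by simp; linarith)
  have hlP : ∀ w, f w ≠ 0 → logDeriv f w = (∑ a ∈ S, (analyticOrderNatAt f a : ℂ) * (1 / (w - a))) + logDeriv g w := by
    intro w hw
    have hPw : P w ≠ 0 := fun h => hw (by rw [hfg, show ∏ a ∈ S, (w - a) ^ (analyticOrderNatAt f a) = P w from rfl, h, zero_mul])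
    have hgw : g w ≠ 0 := fun h => hw (by rw [hfg, h, mul_zero])
    have hff : f = fun z => P z * g z := funext hfg
    have hPd : Differentiable ℂ P := by simp only [hP]; fun_prop
    have e1 : logDeriv f w = logDeriv P w + logDeriv g w := by
      conv_lhs => rw [hff]
      exact logDeriv_mul w hPw hgw (hPd w) (hg w)
    rw [e1]
    congr 1
    have hne : ∀ a ∈ S, w - a ≠ 0 := by
      intro a ha h
      rw [sub_eq_zero] at h
      subst h
      exact hw ((mem_zeros hf h0 R w).1 ha).1
    have e2 : logDeriv P w = ∑ a ∈ S, logDeriv (fun z => (z - a) ^ (analyticOrderNatAt f a)) w :=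
      logDeriv_prod (fun a ha => pow_ne_zero _ (hne a ha)) (fun a ha => by fun_prop)
    rw [e2]
    refine Finset.sum_congr rfl fun a ha => ?_
    rw [logDeriv_fun_pow (by fun_prop)]
    congr 1
    simp [logDeriv_apply]
  have hfm : f (-z) ≠ 0 := by rwa [hev]
  have hneg : logDeriv f (-z) = - logDeriv f z := by
    have h1 : deriv (fun w => f (-w)) z = - deriv f (-z) := deriv_comp_neg f z
    rw [show (fun w => f (-w)) = f from funext hev] at h1
    simp only [logDeriv_apply, hev, h1]; ring
  have hlG : logDeriv G z = logDeriv g z - logDeriv g (-z) := by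
    have h1 : deriv (fun w => g (-w)) z = - deriv g (-z) := deriv_comp_neg g z
    have hgn : Differentiable ℂ fun w => g (-w) := hg.comp differentiable_neg
    have e : G = fun w => (g 0 * g 0)⁻¹ * (g w * g (-w)) := by ext w; simp only [hGdef]; field_simp
    rw [e, logDeriv_const_mul _ _ (by simp [hg0]), logDeriv_mul z hgz hgz' (hg z) (hgn z)]
    simp only [logDeriv_apply, h1]; ring
  have e1 := hlP z hfz
  have e2 := hlP (-z) hfm
  rw [hneg] at e2
  have e3 : logDeriv f z - ∑ a ∈ S, (analyticOrderNatAt f a : ℂ) * ((1 / (z - a) + 1 / (z + a)) / 2) = logDeriv G z / 2 := by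
    have e4 : ∑ a ∈ S, (analyticOrderNatAt f a : ℂ) * ((1 / (z - a) + 1 / (z + a)) / 2) =
       (∑ a ∈ S, (analyticOrderNatAt f a : ℂ) * (1 / (z - a)) - ∑ a ∈ S, (analyticOrderNatAt f a : ℂ) * (1 / (-z - a))) / 2 := by
      rw [← Finset.sum_sub_distrib, Finset.sum_div]
      refine Finset.sum_congr rfl fun a ha => ?_
      rw [show -z - a = -(z + a) by ring, one_div_neg_eq_neg_one_div]; ring
    rw [e4, hlG]
    linear_combination (1/2:ℂ) * e1 - (1/2:ℂ) * e2
  rw [e3, norm_div]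
  have : ‖(2:ℂ)‖ = 2 := by simp
  rw [this, div_le_iff₀ (by norm_num)]
  refine key.trans (le_of_eq (by ring))

lemma hadamard0 {f : ℂ → ℂ} (hf : Differentiable ℂ f) (h0 : f 0 ≠ 0) (hev : ∀ z, f (-z) = f z)
    {C : ℝ} (hC : ∀ z, 1 ≤ ‖z‖ → ‖f z‖ ≤ Real.exp (C * ‖z‖ ^ (3/2 : ℝ))) {z : ℂ} (hfz : f z ≠ 0) :
    Tendsto (fun n : ℕ => ∑ a ∈ zeros hf h0 n, (analyticOrderNatAt f a : ℂ) * ((1 / (z - a) + 1 / (z + a)) / 2))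
      atTop (𝓝 (logDeriv f z)) := by
  rw [tendsto_iff_norm_sub_tendsto_zero]
  set D := |Real.log ‖f 0‖| + 1
  have hlim : Tendsto (fun n : ℕ => 64 * (|C| * (2 * (n:ℝ)) ^ (3/2:ℝ) + D) * ‖z‖ / (n:ℝ) ^ 2) atTop (𝓝 0) := by
    have l1 : Tendsto (fun n : ℕ => (n:ℝ) ^ (-(1/2):ℝ)) atTop (𝓝 0) :=
      (tendsto_rpow_neg_atTop (by norm_num : (0:ℝ) < 1/2)).comp tendsto_natCast_atTop_atTop
    have l2 : Tendsto (fun n : ℕ => (n:ℝ) ^ (-(2):ℝ)) atTop (𝓝 0) :=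
      (tendsto_rpow_neg_atTop (by norm_num : (0:ℝ) < 2)).comp tendsto_natCast_atTop_atTop
    have l3 := (l1.const_mul (64 * |C| * 2 ^ (3/2:ℝ) * ‖z‖)).add (l2.const_mul (64 * D * ‖z‖))
    simp only [mul_zero, add_zero] at l3
    refine l3.congr' ?_
    filter_upwards [eventually_gt_atTop 0] with n hn
    have hn' : (0:ℝ) < n := by exact_mod_cast hn
    rw [Real.mul_rpow (by norm_num) hn'.le, Real.rpow_neg hn'.le 2,
      show (-(1/2):ℝ) = 3/2 - 2 by norm_num, Real.rpow_sub hn', show (2:ℝ) = ((2:ℕ):ℝ) by norm_num,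
      Real.rpow_natCast]
    push_cast
    field_simp
  refine squeeze_zero' (Eventually.of_forall fun n => norm_nonneg _) ?_ hlim
  filter_upwards [eventually_gt_atTop 0, tendsto_natCast_atTop_atTop.eventually_gt_atTop (8 * ‖z‖)] with n hn hn2
  have hn' : (1:ℝ) ≤ n := by exact_mod_cast hn
  rw [norm_sub_rev]
  refine hadamard_est hf h0 hev (by linarith) (by positivity) ?_ (by linarith) hfz
  intro w hw
  refine (hC w (by rw [hw]; linarith)).trans ?_
  rw [hw]
  have hf0 : 0 < ‖f 0‖ := norm_pos_iff.2 h0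
  rw [← Real.exp_log hf0, ← Real.exp_add, Real.exp_le_exp]
  have h1 : C * (2 * (n:ℝ)) ^ (3/2:ℝ) ≤ |C| * (2 * (n:ℝ)) ^ (3/2:ℝ) := by
    gcongr; exact le_abs_self C
  have := neg_abs_le (Real.log ‖f 0‖)
  linarith

lemma hadamard {f : ℂ → ℂ} (hf : Differentiable ℂ f) {w₀ : ℂ} (h0 : f w₀ ≠ 0) (hev : ∀ z, f (-z) = f z)
    {C : ℝ} (hC : ∀ z, 1 ≤ ‖z‖ → ‖f z‖ ≤ Real.exp (C * ‖z‖ ^ (3/2 : ℝ))) {z : ℂ} (hz0 : z ≠ 0) (hfz : f z ≠ 0) :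
    Tendsto (fun n : ℕ => ∑ a ∈ zeros hf h0 n, (analyticOrderNatAt f a : ℂ) * ((1 / (z - a) + 1 / (z + a)) / 2))
      atTop (𝓝 (logDeriv f z)) := by
  classical
  obtain ⟨k, hk, hk0, hfk⟩ := factor1 hf 0 (order_ne_top hf h0 0)
  set m := analyticOrderNatAt f 0 with hm
  simp only [sub_zero] at hfk
  have hk1 : ∀ w, w ≠ 0 → k (-w) * (-1) ^ m = k w := by
    intro w hw
    have h1 := hev w
    rw [hfk, hfk w, neg_pow] at h1
    have : w ^ m ≠ 0 := pow_ne_zero _ hw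
    apply mul_left_cancel₀ this
    linear_combination h1
  have hk2 : ∀ w, k (-w) * (-1) ^ m = k w := by
    have hc1 : Continuous fun w => k (-w) * (-1) ^ m := by
      have := hk.continuous
      fun_prop
    have : (fun w => k (-w) * (-1) ^ m) = k := by
      refine Continuous.ext_on (dense_compl_singleton (0:ℂ)) hc1 hk.continuous ?_
      intro w hw; exact hk1 w hw
    exact fun w => congrFun this w
  have hm1 : (-1:ℂ) ^ m = 1 := by
    have := hk2 0
    rw [neg_zero] at this
    exact mul_left_cancel₀ hk0 (by rw [this, mul_one])
  have hkev : ∀ w, k (-w) = k w := fun w => by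
    have := hk2 w
    rwa [hm1, mul_one] at this
  have hkC : ∀ w, 1 ≤ ‖w‖ → ‖k w‖ ≤ Real.exp (C * ‖w‖ ^ (3/2 : ℝ)) := by
    intro w hw
    refine le_trans ?_ (hC w hw)
    rw [hfk, norm_mul, norm_pow]
    exact le_mul_of_one_le_left (norm_nonneg _) (one_le_pow₀ hw)
  have hkz : k z ≠ 0 := fun h => hfz (by rw [hfk, h, mul_zero])
  have key := hadamard0 hk hk0 hkev hkC hkz
  have hord : ∀ a, a ≠ 0 → analyticOrderNatAt f a = analyticOrderNatAt k a := by
    intro a ha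
    have hP : AnalyticAt ℂ (fun z : ℂ => z ^ m) a := by fun_prop
    have hP0 : analyticOrderAt (fun z : ℂ => z ^ m) a = 0 := by
      rw [hP.analyticOrderAt_eq_zero]; exact pow_ne_zero _ ha
    have h1 := analyticOrderAt_mul hP (hk.analyticAt a)
    rw [hP0, zero_add] at h1
    rw [analyticOrderNatAt, analyticOrderNatAt, ← h1]; congr 2; ext z; exact hfk z
  have hlog : logDeriv f z = m / z + logDeriv k z := by
    have hff : f = fun z => z ^ m * k z := funext hfk
    conv_lhs => rw [hff]
    rw [logDeriv_mul (f := fun z : ℂ => z ^ m) z (pow_ne_zero _ hz0) hkz (by fun_prop) (hk z)]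
    simp
  rw [hlog]
  refine (key.const_add ((m:ℂ) / z)).congr fun n => ?_
  have hk0n : (0:ℂ) ∉ zeros hk hk0 n := by simp [mem_zeros, hk0]
  have hsum : ∑ a ∈ zeros hk hk0 n, (analyticOrderNatAt k a : ℂ) * ((1 / (z - a) + 1 / (z + a)) / 2) =
     ∑ a ∈ zeros hk hk0 n, (analyticOrderNatAt f a : ℂ) * ((1 / (z - a) + 1 / (z + a)) / 2) := by
    refine Finset.sum_congr rfl fun a ha => ?_
    rw [hord a (fun h => hk0n (h ▸ ha))]
  rw [hsum]
  by_cases hm0 : m = 0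
  · have : zeros hf h0 n = zeros hk hk0 n := by
      ext a; simp only [mem_zeros, hfk, hm0, pow_zero, one_mul]
    rw [this, hm0]; simp
  · have : zeros hf h0 n = insert 0 (zeros hk hk0 n) := by
      ext a; simp only [mem_zeros, Finset.mem_insert, hfk, mul_eq_zero, pow_eq_zero_iff hm0]
      constructor
      · rintro ⟨h | h, h'⟩
        · exact Or.inl h
        · exact Or.inr ⟨h, h'⟩
      · rintro (h | h)
        · exact ⟨Or.inl h, by simp [h]⟩
        · exact ⟨Or.inr h.1, h.2⟩
    rw [this, Finset.sum_insert hk0n]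
    congr 1
    simp only [sub_zero, add_zero, ← hm]
    ring
end EP

open MeasureTheory Set

namespace EP
open Complex Metric Filter Topology

noncomputable def xi (s : ℂ) : ℂ := s * (s - 1) * completedRiemannZeta₀ s + 1

noncomputable def Xi (z : ℂ) : ℂ := xi (1/2 + z)

lemma xi_diff : Differentiable ℂ xi := by
  have := differentiable_completedZeta₀
  unfold xi; fun_prop

lemma Xi_diff : Differentiable ℂ Xi := by
  have := xi_diff
  unfold Xi; fun_prop

lemma xi_one_sub (s : ℂ) : xi (1 - s) = xi s := by
  unfold xi; rw [completedRiemannZeta₀_one_sub]; ring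

lemma Xi_even (z : ℂ) : Xi (-z) = Xi z := by
  unfold Xi; rw [← xi_one_sub]; congr 1; ring

lemma xi_eq {s : ℂ} (h0 : s ≠ 0) (h1 : s ≠ 1) : xi s = s * (s - 1) * completedRiemannZeta s := by
  have : 1 - s ≠ 0 := sub_ne_zero.2 (Ne.symm h1)
  rw [completedRiemannZeta_eq, xi]; field_simp; ring

lemma xi_eq' {s : ℂ} (h0 : 0 < s.re) (h1 : s ≠ 1) : xi s = s * (s - 1) * (Gammaℝ s * riemannZeta s) := by
  have hs : s ≠ 0 := by rintro rfl; simp at h0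
  rw [xi_eq hs h1, riemannZeta_def_of_ne_zero hs]
  have := Gammaℝ_ne_zero_of_re_pos h0
  field_simp

lemma xi_ne_zero {s : ℂ} (h : 1 ≤ s.re) : xi s ≠ 0 := by
  by_cases h1 : s = 1
  · rw [h1]; simp [xi]
  · have hs : s ≠ 0 := by rintro rfl; norm_num at h
    rw [xi_eq' (by linarith) h1]
    exact mul_ne_zero (mul_ne_zero hs (sub_ne_zero.2 h1))
      (mul_ne_zero (Gammaℝ_ne_zero_of_re_pos (by linarith)) (riemannZeta_ne_zero_of_one_le_re h))

lemma xi_zero {s : ℂ} (h : xi s = 0) : riemannZeta s = 0 ∧ 0 < s.re ∧ s.re < 1 := by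
  have h2 : s.re < 1 := by by_contra h'; exact xi_ne_zero (not_lt.1 h') h
  have h3 : 0 < s.re := by
    by_contra h'
    refine xi_ne_zero (s := 1 - s) ?_ (by rw [xi_one_sub, h])
    simp; linarith
  refine ⟨?_, h3, h2⟩
  have hs : s ≠ 0 := by rintro rfl; simp at h3
  have hs1 : s ≠ 1 := by rintro rfl; simp at h2
  rw [xi_eq' h3 hs1] at h
  simpa [hs, sub_ne_zero.2 hs1, Gammaℝ_ne_zero_of_re_pos h3] using h

lemma strip_bound : ∃ C : ℝ, 0 ≤ C ∧ ∀ s : ℂ, -1 ≤ s.re → s.re ≤ 2 → ‖completedRiemannZeta₀ s‖ ≤ C := by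
  set P := (HurwitzZeta.hurwitzEvenFEPair 0) with hP
  have hconv : ∀ s : ℂ, MellinConvergent P.f_modif s := fun s => (P.isStrongFEPair_toStrongFEPair.hasMellin s).1
  have hint : ∀ σ : ℝ, IntegrableOn (fun t : ℝ => t ^ (σ - 1) * ‖P.f_modif t‖) (Ioi 0) := by
    intro σ
    have h := (hconv σ).norm
    refine IntegrableOn.congr_fun (h : IntegrableOn _ _ _) ?_ measurableSet_Ioi
    intro t ht
    simp only [norm_smul]
    rw [norm_cpow_eq_rpow_re_of_pos ht]; simp
  have hnn : ∀ σ : ℝ, 0 ≤ ∫ t in Ioi (0:ℝ), t ^ (σ - 1) * ‖P.f_modif t‖ := fun σ =>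
    setIntegral_nonneg measurableSet_Ioi fun t ht => mul_nonneg (Real.rpow_nonneg (le_of_lt ht) _) (norm_nonneg _)
  refine ⟨∫ t in Ioi (0:ℝ), (t ^ ((-1/2:ℝ) - 1) * ‖P.f_modif t‖ + t ^ ((1:ℝ) - 1) * ‖P.f_modif t‖), ?_, ?_⟩
  · rw [integral_add (hint _) (hint _)]
    exact add_nonneg (hnn _) (hnn _)
  intro s h1 h2
  have e : completedRiemannZeta₀ s = mellin P.f_modif (s / 2) / 2 := rfl
  rw [e, norm_div]
  have hb : ‖mellin P.f_modif (s / 2)‖ ≤ ∫ t in Ioi (0:ℝ), (t ^ ((-1/2:ℝ) - 1) * ‖P.f_modif t‖ + t ^ ((1:ℝ) - 1) * ‖P.f_modif t‖) := by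
    rw [mellin]
    refine norm_integral_le_of_norm_le ((hint _).add (hint _)) ?_
    refine (ae_restrict_iff' measurableSet_Ioi).2 (Eventually.of_forall fun t ht => ?_)
    have ht : 0 < t := ht
    rw [norm_smul, norm_cpow_eq_rpow_re_of_pos ht, ← add_mul]
    refine mul_le_mul_of_nonneg_right ?_ (norm_nonneg _)
    have hre : (s / 2 - 1).re = s.re / 2 - 1 := by simp
    rw [hre]
    rcases le_total t 1 with h | h
    · have := Real.rpow_le_rpow_of_exponent_ge ht h (show (-1/2:ℝ) - 1 ≤ s.re / 2 - 1 by linarith)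
      exact le_add_of_le_of_nonneg this (Real.rpow_nonneg ht.le _)
    · have := Real.rpow_le_rpow_of_exponent_le h (show s.re / 2 - 1 ≤ (1:ℝ) - 1 by linarith)
      exact le_add_of_nonneg_of_le (Real.rpow_nonneg ht.le _) this
  have : ‖(2:ℂ)‖ = 2 := by simp
  rw [this]
  have := norm_nonneg (mellin P.f_modif (s / 2))
  linarith

lemma norm_Gamma_le {s : ℂ} (h : 0 < s.re) : ‖Complex.Gamma s‖ ≤ Real.Gamma s.re := by
  rw [Complex.Gamma_eq_integral h, Complex.GammaIntegral, Real.Gamma_eq_integral h]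
  refine norm_integral_le_of_norm_le (Real.GammaIntegral_convergent h) ?_
  refine (ae_restrict_iff' measurableSet_Ioi).2 (Eventually.of_forall fun t ht => ?_)
  rw [norm_mul, norm_cpow_eq_rpow_re_of_pos ht, Complex.norm_of_nonneg (Real.exp_nonneg _)]
  simp

lemma Gamma_growth {y : ℝ} (hy : 1 ≤ y) : Real.Gamma y ≤ Real.exp (2 * (2 * y) ^ (3/2:ℝ)) := by
  have h1 : Real.Gamma y ≤ Real.Gamma (y + 1) := by
    rw [Real.Gamma_add_one (by linarith)]
    exact le_mul_of_one_le_left (Real.Gamma_pos_of_pos (by linarith)).le hy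
  have hc := Nat.le_ceil y
  have hc2 := (Nat.ceil_lt_add_one (by linarith : 0 ≤ y)).le
  have h2 : Real.Gamma (y + 1) ≤ Real.Gamma ((⌈y⌉₊ : ℝ) + 1) := by
    exact Real.Gamma_strictMonoOn_Ici.monotoneOn (by simp; linarith) (by simp; linarith) (by linarith)
  rw [Real.Gamma_nat_eq_factorial] at h2
  have h3 : ((⌈y⌉₊).factorial : ℝ) ≤ (⌈y⌉₊ : ℝ) ^ ⌈y⌉₊ := by exact_mod_cast Nat.factorial_le_pow _
  have h4 : (⌈y⌉₊ : ℝ) ^ ⌈y⌉₊ ≤ (2 * y) ^ (2 * y) := by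
    rw [← Real.rpow_natCast]
    calc (⌈y⌉₊ : ℝ) ^ (⌈y⌉₊ : ℝ) ≤ (2 * y) ^ (⌈y⌉₊ : ℝ) := by
          apply Real.rpow_le_rpow (by positivity) (by linarith) (by positivity)
      _ ≤ _ := Real.rpow_le_rpow_of_exponent_le (by linarith) (by linarith)
  have h5 : (2 * y) ^ (2 * y) ≤ Real.exp (2 * (2 * y) ^ (3/2:ℝ)) := by
    rw [Real.rpow_def_of_pos (by linarith), Real.exp_le_exp]
    have := Real.log_le_rpow_div (x := 2 * y) (ε := 1/2) (by linarith) (by norm_num)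
    have e : (2 * y) ^ (3/2:ℝ) = (2 * y) * (2 * y) ^ (1/2:ℝ) := by
      rw [show (3/2:ℝ) = 1 + 1/2 by norm_num, Real.rpow_add (by linarith), Real.rpow_one]
    rw [e]
    have : Real.log (2 * y) ≤ 2 * (2 * y) ^ (1/2:ℝ) := by linarith
    nlinarith
  linarith

lemma zeta_bound {s : ℂ} {σ : ℝ} (hσ : 1 < σ) (h : σ ≤ s.re) : ‖riemannZeta s‖ ≤ ∑' n : ℕ, 1 / (n:ℝ) ^ σ := by
  rw [zeta_eq_tsum_one_div_nat_cpow (by linarith)]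
  refine tsum_of_norm_bounded (Real.summable_one_div_nat_rpow.2 hσ).hasSum fun n => ?_
  rcases Nat.eq_zero_or_pos n with rfl | hn
  · have : s ≠ 0 := by rintro rfl; norm_num at h; linarith
    simp only [Nat.cast_zero, zero_cpow this, div_zero, norm_zero]; positivity
  · rw [norm_div, norm_one, norm_natCast_cpow_of_pos hn]
    have : (1:ℝ) ≤ n := by exact_mod_cast hn
    gcongr

lemma Xi_growth : ∃ C : ℝ, ∀ z, 1 ≤ ‖z‖ → ‖Xi z‖ ≤ Real.exp (C * ‖z‖ ^ (3/2 : ℝ)) := by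
  obtain ⟨C, hC0, hC⟩ := strip_bound
  set K := ∑' n : ℕ, 1 / (n:ℝ) ^ (2:ℝ)
  have hK0 : 0 ≤ K := tsum_nonneg fun n => by positivity
  have main : ∀ z, 1 ≤ ‖z‖ → 0 ≤ z.re → ‖Xi z‖ ≤ Real.exp ((4 * C + 4 * K + 8) * ‖z‖ ^ (3/2 : ℝ)) := by
    intro z hz hre
    have hpz : ‖z‖ ≤ ‖z‖ ^ (3/2:ℝ) := by
      conv_lhs => rw [← Real.rpow_one ‖z‖]
      exact Real.rpow_le_rpow_of_exponent_le hz (by norm_num)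
    set p := ‖z‖ ^ (3/2:ℝ)
    have hs1 : ‖(1/2 + z : ℂ)‖ ≤ 2 * ‖z‖ := by
      refine (norm_add_le _ _).trans ?_
      have : ‖(1/2:ℂ)‖ = 1/2 := by norm_num
      linarith
    have hs2 : ‖(1/2 + z - 1 : ℂ)‖ ≤ 2 * ‖z‖ := by
      rw [show (1/2 + z - 1 : ℂ) = -(1/2) + z by ring]
      refine (norm_add_le _ _).trans ?_
      have : ‖(-(1/2):ℂ)‖ = 1/2 := by norm_num
      linarith
    have hsq : ‖z‖ ^ 2 ≤ Real.exp (2 * ‖z‖) := by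
      have := Real.add_one_le_exp ‖z‖
      rw [show 2 * ‖z‖ = ‖z‖ + ‖z‖ by ring, Real.exp_add]
      nlinarith
    have hre' : (1/2 + z : ℂ).re = 1/2 + z.re := by simp
    rcases le_total (1/2 + z : ℂ).re 2 with h | h
    · have h1 := hC (1/2 + z) (by rw [hre']; linarith) h
      have h2 : ‖Xi z‖ ≤ (2 * ‖z‖) * (2 * ‖z‖) * C + 1 := by
        rw [Xi, xi]
        refine (norm_add_le _ _).trans ?_
        rw [norm_mul, norm_mul, norm_one]
        gcongr
      have h3 : (2 * ‖z‖) * (2 * ‖z‖) * C + 1 ≤ (4 * C + 1) * ‖z‖ ^ 2 := by nlinarith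
      have h4 : 4 * C + 1 ≤ Real.exp (4 * C) := Real.add_one_le_exp _
      have h5 : (4 * C + 1) * ‖z‖ ^ 2 ≤ Real.exp (4 * C) * Real.exp (2 * ‖z‖) := by gcongr
      rw [← Real.exp_add] at h5
      refine (h2.trans (h3.trans h5)).trans (Real.exp_le_exp.2 ?_)
      nlinarith
    · have hn1 : (1/2 + z : ℂ) ≠ 1 := by
        intro h'; rw [h'] at h; norm_num at h
      have hG : ‖Gammaℝ (1/2 + z)‖ ≤ Real.exp (2 * (1/2 + z.re) ^ (3/2:ℝ)) := by
        rw [Gammaℝ_def, norm_mul]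
        have a1 : ‖(Real.pi : ℂ) ^ (-(1/2 + z) / 2)‖ ≤ 1 := by
          rw [norm_cpow_eq_rpow_re_of_pos Real.pi_pos]
          refine Real.rpow_le_one_of_one_le_of_nonpos (by linarith [Real.pi_gt_three]) ?_
          simp; linarith
        have a2 : ((1/2 + z) / 2 : ℂ).re = (1/2 + z.re) / 2 := by simp
        have a3 := norm_Gamma_le (s := (1/2 + z) / 2) (by rw [a2]; linarith)
        rw [a2] at a3
        have a4 := Gamma_growth (y := (1/2 + z.re) / 2) (by rw [hre'] at h; linarith)
        rw [show 2 * ((1/2 + z.re)/2) = 1/2 + z.re by ring] at a4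
        calc _ ≤ 1 * ‖Complex.Gamma ((1/2 + z) / 2)‖ := by gcongr
          _ ≤ _ := by linarith
      have hzr : 1/2 + z.re ≤ 2 * ‖z‖ := by
        have := Complex.re_le_norm z; linarith
      have hp2 : (1/2 + z.re) ^ (3/2:ℝ) ≤ 3 * p := by
        calc (1/2 + z.re) ^ (3/2:ℝ) ≤ (2 * ‖z‖) ^ (3/2:ℝ) := by
              apply Real.rpow_le_rpow (by linarith) hzr (by norm_num)
          _ = 2 ^ (3/2:ℝ) * p := Real.mul_rpow (by norm_num) (norm_nonneg _)
          _ ≤ 3 * p := by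
            gcongr
            rw [show (3/2:ℝ) = (3:ℕ) * (1/2:ℝ) by norm_num, Real.rpow_natCast_mul (by norm_num), ← Real.sqrt_eq_rpow]
            rw [Real.sqrt_le_left (by norm_num)]; norm_num
      have hZ := zeta_bound (s := 1/2 + z) (σ := 2) (by norm_num) h
      rw [Xi, xi_eq' (by linarith) hn1, norm_mul, norm_mul, norm_mul]
      calc _ ≤ (2 * ‖z‖) * (2 * ‖z‖) * (Real.exp (2 * (1/2 + z.re) ^ (3/2:ℝ)) * K) := by gcongr
        _ = 4 * K * ‖z‖ ^ 2 * Real.exp (2 * (1/2 + z.re) ^ (3/2:ℝ)) := by ring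
        _ ≤ Real.exp (4 * K) * Real.exp (2 * ‖z‖) * Real.exp (6 * p) := by
            have : 4 * K + 1 ≤ Real.exp (4 * K) := Real.add_one_le_exp _
            have h6 : 2 * (1/2 + z.re) ^ (3/2:ℝ) ≤ 6 * p := by linarith
            have h7 : 4 * K ≤ Real.exp (4 * K) := by linarith
            exact mul_le_mul (mul_le_mul h7 hsq (by positivity) (by positivity)) (Real.exp_le_exp.2 h6) (by positivity) (by positivity)
        _ ≤ _ := by
            rw [← Real.exp_add, ← Real.exp_add, Real.exp_le_exp]
            nlinarith
  refine ⟨4 * C + 4 * K + 8, fun z hz => ?_⟩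
  rcases le_total 0 z.re with h | h
  · exact main z hz h
  · have := main (-z) (by simpa using hz) (by simpa using h)
    rwa [Xi_even, norm_neg] at this

lemma Xi_half : Xi (1/2) ≠ 0 := by
  rw [Xi]; exact xi_ne_zero (by norm_num)

noncomputable def Z (n : ℕ) : Finset ℂ := zeros Xi_diff Xi_half n
noncomputable def mult (a : ℂ) : ℝ := (analyticOrderNatAt Xi a : ℝ)

lemma mult_nonneg (a : ℂ) : 0 ≤ mult a := by unfold mult; positivity

lemma mem_Z {n : ℕ} {a : ℂ} : a ∈ Z n ↔ Xi a = 0 ∧ ‖a‖ ≤ n := mem_zeros _ _ _ _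

lemma Xi_zero {a : ℂ} (h : Xi a = 0) : riemannZeta (1/2 + a) = 0 ∧ |a.re| < 1/2 := by
  obtain ⟨h1, h2, h3⟩ := xi_zero h
  refine ⟨h1, ?_⟩
  simp at h2 h3
  rw [abs_lt]; constructor <;> linarith

lemma Xi_hadamard {z : ℂ} (hz : 1/2 ≤ |z.re|) :
    Tendsto (fun n : ℕ => ∑ a ∈ Z n, (mult a : ℂ) * ((1 / (z - a) + 1 / (z + a)) / 2))
      atTop (𝓝 (logDeriv Xi z)) := by
  obtain ⟨C, hC⟩ := Xi_growth
  have := hadamard Xi_diff Xi_half Xi_even hC (z := z) (by rintro rfl; norm_num at hz)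
    (fun h => by have := (Xi_zero h).2; linarith)
  refine this.congr fun n => ?_
  unfold Z mult; push_cast; rfl

/-- positivity of real parts -/
lemma re_term_nonneg {z a : ℂ} (hz : 1/2 ≤ z.re) (ha : Xi a = 0) :
    0 ≤ (1 / (z - a)).re ∧ 0 ≤ (1 / (z + a)).re := by
  have h := (abs_lt.1 (Xi_zero ha).2)
  constructor <;> rw [one_div, Complex.inv_re] <;> refine div_nonneg ?_ (Complex.normSq_nonneg _) <;> simp <;> linarith

lemma sum_le {z : ℂ} (hz : 1/2 ≤ z.re) (n : ℕ) :
    ∑ a ∈ Z n, mult a * (((1 / (z - a)).re + (1 / (z + a)).re) / 2) ≤ (logDeriv Xi z).re := by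
  have hl := (continuous_re.tendsto _).comp (Xi_hadamard (z := z) (by rw [abs_of_nonneg] <;> linarith))
  have e : ∀ n : ℕ, (re ∘ fun n : ℕ => ∑ a ∈ Z n, (mult a : ℂ) * ((1 / (z - a) + 1 / (z + a)) / 2)) n
      = ∑ a ∈ Z n, mult a * (((1 / (z - a)).re + (1 / (z + a)).re) / 2) := by
    intro n
    simp only [Function.comp, re_sum]
    refine Finset.sum_congr rfl fun a _ => ?_
    rw [re_ofReal_mul, show (2:ℂ) = ((2:ℝ):ℂ) by norm_num, div_ofReal_re, add_re]
  have hmono : Monotone fun n : ℕ => ∑ a ∈ Z n, mult a * (((1 / (z - a)).re + (1 / (z + a)).re) / 2) := by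
    intro i j hij
    refine Finset.sum_le_sum_of_subset_of_nonneg ?_ ?_
    · intro a ha
      rw [mem_Z] at ha ⊢
      exact ⟨ha.1, ha.2.trans (by exact_mod_cast hij)⟩
    · intro a ha _
      have := re_term_nonneg hz (mem_Z.1 ha).1
      have := mult_nonneg a
      refine mul_nonneg this ?_
      linarith
  exact hmono.ge_of_tendsto (hl.congr e) n
end EP

open MeasureTheory Set

namespace EP
open Complex Metric Filter Topology

lemma gammaSeq_le {σ : ℝ} (hσ : 0 < σ) {n : ℕ} (hn : 1 ≤ n) : Real.GammaSeq σ n ≤ Real.Gamma σ := by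
  have h := Real.BohrMollerup.f_add_nat_ge (f := Real.log ∘ Real.Gamma) Real.convexOn_log_Gamma
    (fun {y} hy => by
      simp only [Function.comp]
      rw [Real.Gamma_add_one hy.ne', Real.log_mul hy.ne' (Real.Gamma_pos_of_pos hy).ne', add_comm]) (n := n + 1) (by omega) hσ
  have hprod : ∀ m : ℕ, Real.Gamma (σ + m) = (∏ j ∈ Finset.range m, (σ + j)) * Real.Gamma σ := by
    intro m
    induction m with
    | zero => simp
    | succ k ih =>
      rw [Finset.prod_range_succ, Nat.cast_succ, ← add_assoc, Real.Gamma_add_one (by positivity), ih]; ring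
  simp only [Function.comp] at h
  push_cast at h
  rw [add_sub_cancel_right, Real.Gamma_nat_eq_factorial] at h
  have hn0 : (0:ℝ) < n := by exact_mod_cast hn
  have hP : 0 < ∏ j ∈ Finset.range (n+1), (σ + j) := Finset.prod_pos fun j _ => by positivity
  have hG := Real.Gamma_pos_of_pos hσ
  have h1 := hprod (n + 1)
  rw [show ((n:ℝ) + 1 + σ) = σ + ((n+1 : ℕ):ℝ) by push_cast; ring, h1, ← Real.log_rpow hn0, ← Real.log_mul (by positivity) (by positivity)] at h
  have h2 := (Real.log_le_log_iff (by positivity) (by positivity)).1 h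
  rw [Real.GammaSeq, div_le_iff₀ hP]
  linarith

lemma norm_gammaSeq_le {s : ℂ} (hs : 0 < s.re) {n : ℕ} (hn : 1 ≤ n) : ‖GammaSeq s n‖ ≤ Real.Gamma s.re := by
  refine le_trans ?_ (gammaSeq_le hs hn)
  rw [GammaSeq, Real.GammaSeq, norm_div, norm_mul, norm_natCast_cpow_of_pos hn, norm_prod, norm_natCast]
  have : 0 < ∏ j ∈ Finset.range (n+1), (s.re + j) := Finset.prod_pos fun j _ => by positivity
  gcongr with j hj
  calc s.re + j = (s + j).re := by simp
    _ ≤ _ := re_le_norm _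

lemma add_ne {z : ℂ} (hz : 0 < z.re) (j : ℕ) : z + j ≠ 0 := by
  intro h
  have := congrArg re h
  simp at this
  have : (0:ℝ) ≤ j := by positivity
  linarith

lemma gammaSeq_diff {s : ℂ} (hs : 0 < s.re) {n : ℕ} (hn : 1 ≤ n) : DifferentiableAt ℂ (fun s => GammaSeq s n) s := by
  unfold GammaSeq
  have h0 : (n:ℂ) ≠ 0 := by exact_mod_cast (by omega : n ≠ 0)
  refine DifferentiableAt.div ?_ (by fun_prop) (Finset.prod_ne_zero_iff.2 fun j _ => add_ne hs j)
  exact (DifferentiableAt.const_cpow (by fun_prop) (Or.inl h0)).mul_const _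

lemma gammaSeq_logDeriv {s : ℂ} (hs : 0 < s.re) {n : ℕ} (hn : 1 ≤ n) :
    logDeriv (fun s => GammaSeq s n) s = Real.log n - ∑ j ∈ Finset.range (n+1), 1 / (s + j) := by
  unfold GammaSeq
  have h0 : (n:ℂ) ≠ 0 := by exact_mod_cast (by omega : n ≠ 0)
  have hd : DifferentiableAt ℂ (fun s : ℂ => (n:ℂ) ^ s) s := DifferentiableAt.const_cpow (by fun_prop) (Or.inl h0)
  have hne : ∀ j ∈ Finset.range (n+1), s + (j:ℂ) ≠ 0 := fun j _ => add_ne hs j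
  have hc : (n:ℂ) ^ s ≠ 0 := by simp [cpow_eq_zero_iff, h0]
  have hf : ((n.factorial : ℕ) : ℂ) ≠ 0 := by exact_mod_cast n.factorial_ne_zero
  rw [logDeriv_div (f := fun s : ℂ => (n:ℂ) ^ s * (n.factorial : ℂ)) s (mul_ne_zero hc hf) (Finset.prod_ne_zero_iff.2 hne) (hd.mul_const _) (by fun_prop),
    logDeriv_mul_const _ _ hf, logDeriv_prod hne (fun j _ => by fun_prop)]
  congr 1
  · rw [logDeriv_apply]
    have hh := ((hasDerivAt_id s).const_cpow (Or.inl h0) : HasDerivAt (fun s : ℂ => (n:ℂ) ^ s) _ s).deriv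
    rw [show deriv (fun s : ℂ => (n:ℂ) ^ s) s = _ from hh]
    simp only [id]
    rw [mul_one, mul_comm, mul_div_assoc, div_self hc, mul_one, ofReal_log (by positivity)]
    simp
  · refine Finset.sum_congr rfl fun j _ => ?_
    simp [logDeriv_apply]

lemma deriv_lim {z : ℂ} (hz : 0 < z.re) :
    Tendsto (fun n : ℕ => deriv (fun s => GammaSeq s n) z) atTop (𝓝 (deriv Complex.Gamma z)) := by
  set r := z.re / 2 with hr
  have hr0 : 0 < r := by positivity
  have hre : ∀ w ∈ closedBall z r, r ≤ w.re := by
    intro w hw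
    have h1 : ‖w - z‖ ≤ r := by simpa [dist_eq_norm] using hw
    have h2 := (abs_le.1 ((abs_re_le_norm (w - z)).trans h1)).1
    simp at h2; linarith
  have hGd : ∀ w ∈ closedBall z r, DifferentiableAt ℂ Complex.Gamma w := fun w hw =>
    differentiableAt_Gamma w fun m h => by
      have := hre w hw
      rw [h] at this; simp at this
      have : (0:ℝ) ≤ m := by positivity
      linarith
  obtain ⟨M, hM⟩ : ∃ M : ℝ, ∀ w ∈ closedBall z r, ‖Real.Gamma w.re‖ ≤ M := by
    refine (isCompact_closedBall z r).exists_bound_of_continuousOn ?_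
    intro w hw
    refine ContinuousAt.continuousWithinAt ?_
    refine ContinuousAt.comp (f := re) (g := Real.Gamma) ?_ continuous_re.continuousAt
    refine (Real.differentiableAt_Gamma fun m h => ?_).continuousAt
    have := hre w hw
    rw [h] at this
    have : (0:ℝ) ≤ m := by positivity
    linarith
  have key : ∀ f : ℂ → ℂ, DiffContOnCl ℂ f (ball z r) → (2 * Real.pi * I : ℂ)⁻¹ • (∮ w in C(z, r), (w - z)⁻¹ ^ 2 • f w) = deriv f z := by
    intro f hf
    have h := hf.deriv_eq_smul_circleIntegral hr0
    rw [inv_smul_eq_iff₀ (by simp [Real.pi_ne_zero])]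
    rw [← h]
    congr 1; ext w; simp
  have e1 : ∀ n : ℕ, 1 ≤ n → deriv (fun s => GammaSeq s n) z = (2 * Real.pi * I : ℂ)⁻¹ • ∮ w in C(z, r), (w - z)⁻¹ ^ 2 • GammaSeq w n := by
    intro n hn
    rw [← key]
    refine DifferentiableOn.diffContOnCl fun w hw => ?_
    exact (gammaSeq_diff (by have := hre w (closure_ball_subset_closedBall hw); linarith) hn).differentiableWithinAt
  have e2 : deriv Complex.Gamma z = (2 * Real.pi * I : ℂ)⁻¹ • ∮ w in C(z, r), (w - z)⁻¹ ^ 2 • Complex.Gamma w := by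
    rw [← key]
    refine DifferentiableOn.diffContOnCl fun w hw => ?_
    exact (hGd w (closure_ball_subset_closedBall hw)).differentiableWithinAt
  rw [e2]
  refine Tendsto.congr' (f₁ := fun n : ℕ => (2 * Real.pi * I : ℂ)⁻¹ • ∮ w in C(z, r), (w - z)⁻¹ ^ 2 • GammaSeq w n) ?_ ?_
  · filter_upwards [eventually_ge_atTop 1] with n hn using (e1 n hn).symm
  refine Tendsto.const_smul ?_ _
  unfold circleIntegral
  have hcm : ∀ θ, circleMap z r θ ∈ closedBall z r := fun θ => circleMap_mem_closedBall z hr0.le θ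
  refine intervalIntegral.tendsto_integral_filter_of_dominated_convergence (fun _ => r * (r⁻¹ ^ 2 * M)) ?_ ?_ ?_ ?_
  · filter_upwards [eventually_ge_atTop 1] with n hn
    refine Continuous.aestronglyMeasurable ?_
    have hc1 : Continuous fun θ => GammaSeq (circleMap z r θ) n := by
      rw [continuous_iff_continuousAt]
      intro θ
      exact ContinuousAt.comp (f := circleMap z r) (g := fun s => GammaSeq s n)
        (gammaSeq_diff (by have := hre _ (hcm θ); linarith) hn).continuousAt (continuous_circleMap z r).continuousAt
    have hc2 : Continuous fun θ => (circleMap z r θ - z)⁻¹ := by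
      refine Continuous.inv₀ (by fun_prop) fun θ => ?_
      simp [circleMap, hr0.ne']
    simp only [deriv_circleMap, smul_eq_mul]
    exact (((continuous_circleMap 0 r).mul continuous_const)).mul ((hc2.pow 2).mul hc1)
  · filter_upwards [eventually_ge_atTop 1] with n hn
    refine Eventually.of_forall fun θ _ => ?_
    have h1 := norm_gammaSeq_le (s := circleMap z r θ) (by have := hre _ (hcm θ); linarith) hn
    have h2 := (le_abs_self _).trans (hM _ (hcm θ))
    rw [norm_smul, norm_smul, norm_pow, norm_inv]
    have h3 : ‖circleMap z r θ - z‖ = r := by simp [abs_of_pos hr0]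
    have h4 : ‖deriv (circleMap z r) θ‖ = r := by simp [deriv_circleMap, abs_of_pos hr0]
    rw [h3, h4]
    gcongr
    linarith
  · exact intervalIntegrable_const
  · refine Eventually.of_forall fun θ _ => ?_
    exact ((GammaSeq_tendsto_Gamma _).const_smul _).const_smul _

lemma digamma_lim {z : ℂ} (hz : 0 < z.re) :
    Tendsto (fun n : ℕ => (Real.log n : ℂ) - ∑ j ∈ Finset.range (n+1), 1 / (z + j)) atTop (𝓝 (digamma z)) := by
  have h := (deriv_lim hz).div (GammaSeq_tendsto_Gamma z) (Complex.Gamma_ne_zero_of_re_pos hz)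
  refine h.congr' ?_
  filter_upwards [eventually_ge_atTop 1] with n hn
  rw [← gammaSeq_logDeriv hz hn]; rfl

lemma digamma_lim' {z : ℂ} (hz : 0 < z.re) :
    Tendsto (fun n : ℕ => (-Real.eulerMascheroniConstant : ℂ) + ∑ j ∈ Finset.range (n+1), (1 / ((1:ℂ) + j) - 1 / (z + j))) atTop (𝓝 (digamma z)) := by
  have h := ((digamma_lim hz).sub (digamma_lim (z := 1) (by simp))).const_add (digamma 1)
  rw [add_sub_cancel] at h
  refine h.congr fun n => ?_
  rw [digamma_one, Finset.sum_sub_distrib]; ring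

/-- real part upper bound -/
lemma digamma_re_le {z : ℂ} (hz : 1/2 < z.re) :
    (digamma z).re ≤ Real.log (z.re ^ 2 + z.im ^ 2) / 2 + 1 / (2 * z.re - 1) := by
  set x := z.re with hx
  set y := z.im with hy
  have hl := (continuous_re.tendsto _).comp (digamma_lim (z := z) (by linarith))
  have hre : ∀ j : ℕ, (1 / (z + j)).re = (x + j) / ((x + j) ^ 2 + y ^ 2) := by
    intro j
    rw [one_div, inv_re, normSq_apply]; simp [← hx, ← hy, pow_two]
  have key : ∀ n : ℕ, 1 / (2 * x - 1) - 1 / (2 * x + 2 * n - 1) + ∑ j ∈ Finset.range n, (x + j) / ((x + j) ^ 2 + y ^ 2) ≥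
      Real.log ((x + n) ^ 2 + y ^ 2) / 2 - Real.log (x ^ 2 + y ^ 2) / 2 := by
    intro n
    induction n with
    | zero => simp
    | succ n ih =>
      rw [Finset.sum_range_succ]
      set u := x + n with hu
      have hu2 : 1/2 < u := by have : (0:ℝ) ≤ n := by positivity
                               linarith
      have hpos : 0 < u ^ 2 + y ^ 2 := by positivity
      have h1 : Real.log ((u + 1) ^ 2 + y ^ 2) / 2 - Real.log (u ^ 2 + y ^ 2) / 2 ≤ (u + 1/2) / (u ^ 2 + y ^ 2) := by
        have h2 : Real.log ((u + 1) ^ 2 + y ^ 2) - Real.log (u ^ 2 + y ^ 2) = Real.log (((u + 1) ^ 2 + y ^ 2) / (u ^ 2 + y ^ 2)) :=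
          (Real.log_div (by positivity) hpos.ne').symm
        have h3 := Real.log_le_sub_one_of_pos (x := ((u + 1) ^ 2 + y ^ 2) / (u ^ 2 + y ^ 2)) (by positivity)
        have h4 : ((u + 1) ^ 2 + y ^ 2) / (u ^ 2 + y ^ 2) - 1 = 2 * ((u + 1/2) / (u ^ 2 + y ^ 2)) := by field_simp; ring
        linarith
      have h5 : (u + 1/2) / (u ^ 2 + y ^ 2) ≤ u / (u ^ 2 + y ^ 2) + (1 / (2 * u - 1) - 1 / (2 * u + 1)) := by
        rw [add_div]
        have : 1/2 / (u^2 + y^2) ≤ 1 / (2 * u - 1) - 1 / (2 * u + 1) := by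
          rw [div_sub_div _ _ (by linarith) (by linarith), div_le_div_iff₀ hpos (by nlinarith)]
          nlinarith [sq_nonneg y]
        linarith
      have e1 : 2 * x + 2 * (n:ℝ) - 1 = 2 * u - 1 := by rw [hu]; ring
      have e2 : 2 * x + 2 * ((n+1:ℕ):ℝ) - 1 = 2 * u + 1 := by rw [hu]; push_cast; ring
      have e3 : x + ((n+1:ℕ):ℝ) = u + 1 := by rw [hu]; push_cast; ring
      rw [e1] at ih
      rw [e2, e3]
      linarith
  refine le_of_tendsto hl ?_
  filter_upwards [eventually_ge_atTop 1] with n hn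
  have h0 : (0:ℝ) < n := by exact_mod_cast hn
  simp only [Function.comp, sub_re, ofReal_re, re_sum, hre]
  have h1 := key (n + 1)
  have h2 : Real.log n ≤ Real.log ((x + ((n+1:ℕ):ℝ)) ^ 2 + y ^ 2) / 2 := by
    have : Real.log (n ^ 2) ≤ Real.log ((x + ((n+1:ℕ):ℝ)) ^ 2 + y ^ 2) := by
      refine Real.log_le_log (by positivity) ?_
      push_cast
      nlinarith [sq_nonneg y]
    rw [Real.log_pow] at this
    push_cast at this ⊢
    linarith
  have h3 : 0 ≤ 1 / (2 * x + 2 * ((n+1:ℕ):ℝ) - 1) := by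
    apply div_nonneg (by norm_num); push_cast; linarith
  linarith

lemma sum_three_half (n : ℕ) : ∑ j ∈ Finset.range (n+1), 1 / (((j:ℝ) + 1) * √((j:ℝ) + 1)) ≤ 3 - 2 / √((n:ℝ) + 1) := by
  induction n with
  | zero => simp; norm_num
  | succ n ih =>
    rw [Finset.sum_range_succ]
    have h1 : (0:ℝ) ≤ n := by positivity
    set a := √((n:ℝ) + 1) with ha
    set b := √(((n+1:ℕ):ℝ) + 1) with hb
    have ha2 : a ^ 2 = n + 1 := Real.sq_sqrt (by positivity)
    have hb2 : b ^ 2 = ((n+1:ℕ):ℝ) + 1 := Real.sq_sqrt (by positivity)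
    have hap : 0 < a := by rw [ha]; positivity
    have hbp : a ≤ b := by apply Real.sqrt_le_sqrt; push_cast; linarith
    have hb0 : 0 < b := by linarith
    rw [← hb2]
    push_cast at hb2
    have hab : (b - a) * (b + a) = 1 := by nlinarith
    have : 1 / (b ^ 2 * b) ≤ 2 / a - 2 / b := by
      rw [div_sub_div _ _ hap.ne' hb0.ne', div_le_div_iff₀ (by positivity) (by positivity)]
      have e : 2 * b - a * 2 = 2 * (b - a) := by ring
      have h5 : 1 ≤ 2 * b * (b - a) := by nlinarith
      have h6 : 1 * (a * b) ≤ b * b := by nlinarith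
      rw [e]
      calc 1 * (a * b) ≤ (b * b) * 1 := by linarith
        _ ≤ (b * b) * (2 * b * (b - a)) := by gcongr
        _ = 2 * (b - a) * (b ^ 2 * b) := by ring
    linarith

/-- partial sum bounds -/
lemma digamma_part_le {z : ℂ} (hz : 3/4 ≤ z.re) (n : ℕ) :
    ‖∑ j ∈ Finset.range (n+1), (1 / ((1:ℂ) + j) - 1 / (z + j))‖ ≤ 6 * ‖z - 1‖ / √(1 + |z.im|) := by
  set Y := |z.im| with hY
  have hY0 : 0 ≤ Y := abs_nonneg _
  have hterm : ∀ j ∈ Finset.range (n+1), ‖1 / ((1:ℂ) + j) - 1 / (z + j)‖ ≤ 2 * ‖z - 1‖ / √(1 + Y) * (1 / (((j:ℝ) + 1) * √((j:ℝ) + 1))) := by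
    intro j _
    have h0 : (0:ℝ) ≤ j := by positivity
    have hj1 : (1:ℂ) + j ≠ 0 := add_ne (by simp) j
    have hjz : z + j ≠ 0 := add_ne (by linarith) j
    have hn1 : ‖(1:ℂ) + j‖ = j + 1 := by
      rw [show (1:ℂ) + j = ((1 + j : ℝ) : ℂ) by push_cast; ring, Complex.norm_of_nonneg (by positivity)]; ring
    have hlow : √((j + 1) * (1 + Y)) / 2 ≤ ‖z + j‖ := by
      rw [div_le_iff₀ (by norm_num), Real.sqrt_le_left (by positivity)]
      have : ‖z + j‖ ^ 2 = (z.re + j) ^ 2 + Y ^ 2 := by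
        rw [← normSq_eq_norm_sq, normSq_apply, hY, sq_abs]; simp; ring
      rw [mul_pow, this]
      nlinarith [sq_nonneg (z.re + j - Y), sq_nonneg (z.re - 3/4), mul_nonneg h0 hY0]
    rw [div_sub_div _ _ hj1 hjz, norm_div, norm_mul, hn1]
    rw [show 1 * (z + j) - (1 + (j:ℂ)) * 1 = z - 1 by ring]
    have hs : √((j + 1) * (1 + Y)) = √((j:ℝ)+1) * √(1 + Y) := Real.sqrt_mul (by positivity) _
    rw [hs] at hlow
    have hsj : 0 < √((j:ℝ)+1) := by positivity
    have hsY : 0 < √(1 + Y) := by positivity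
    calc ‖z - 1‖ / ((j + 1) * ‖z + j‖) ≤ ‖z - 1‖ / ((j + 1) * (√((j:ℝ)+1) * √(1 + Y) / 2)) := by gcongr
      _ = _ := by field_simp
  refine (norm_sum_le_of_le _ hterm).trans ?_
  rw [← Finset.mul_sum]
  have h1 := sum_three_half n
  have h2 : 0 ≤ 2 / √((n:ℝ) + 1) := by positivity
  calc _ ≤ 2 * ‖z - 1‖ / √(1 + Y) * 3 := by gcongr; linarith
    _ = _ := by ring

lemma digamma_bound {z : ℂ} (hz : 3/4 ≤ z.re) (hz2 : z.re ≤ 2) :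
    ‖digamma z‖ ≤ 1 + 6 * √(1 + |z.im|) := by
  refine le_of_tendsto (digamma_lim' (z := z) (by linarith)).norm (Eventually.of_forall fun n => ?_)
  refine (norm_add_le _ _).trans (add_le_add ?_ ((digamma_part_le hz n).trans ?_))
  · rw [norm_neg, norm_real, Real.norm_eq_abs, abs_le]
    have h1 := Real.one_half_lt_eulerMascheroniConstant
    have h2 := Real.eulerMascheroniConstant_lt_two_thirds
    constructor <;> linarith
  · have h1 : ‖z - 1‖ ≤ 1 + |z.im| := by
      refine (norm_le_abs_re_add_abs_im _).trans ?_
      simp only [sub_re, one_re, sub_im, one_im, sub_zero]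
      have : |z.re - 1| ≤ 1 := abs_le.2 ⟨by linarith, by linarith⟩
      linarith
    have h0 : 0 < 1 + |z.im| := by positivity
    rw [div_le_iff₀ (by positivity), mul_assoc, Real.mul_self_sqrt h0.le]
    linarith
end EP

open MeasureTheory Set

namespace EP
open Complex Metric Filter Topology

local notation "Λ" => ArithmeticFunction.vonMangoldt

noncomputable def LL (s : ℂ) : ℂ := LSeries (fun n => (Λ n : ℂ)) s
noncomputable def qq (s : ℂ) : ℂ := digamma (s/2 + 1) / 2 - Real.log Real.pi / 2

lemma LL_hasSum {s : ℂ} (hs : 1 < s.re) : HasSum (fun n : ℕ => (Λ n : ℂ) * (n:ℂ) ^ (-s)) (LL s) := by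
  have h := (ArithmeticFunction.LSeriesSummable_vonMangoldt hs).LSeriesHasSum
  unfold LSeriesHasSum at h
  change HasSum _ (LL s) at h
  convert h using 1
  ext n
  rcases Nat.eq_zero_or_pos n with rfl | hn
  · simp
  · rw [LSeries.term_of_ne_zero (by omega), cpow_neg, div_eq_mul_inv]

lemma LL_eq {s : ℂ} (hs : 1 < s.re) : LL s = - logDeriv riemannZeta s := by
  rw [LL, ArithmeticFunction.LSeries_vonMangoldt_eq_deriv_riemannZeta_div hs, logDeriv_apply, neg_div]

lemma LL_term_re {s : ℂ} (n : ℕ) : ((Λ n : ℂ) * (n:ℂ) ^ (-s)).re = Λ n * (n:ℝ) ^ (-s.re) * Real.cos (s.im * Real.log n) := by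
  rcases Nat.eq_zero_or_pos n with rfl | hn
  · simp
  · have h0 : (n:ℂ) ≠ 0 := by exact_mod_cast hn.ne'
    have h1 : (0:ℝ) < n := by exact_mod_cast hn
    rw [re_ofReal_mul, mul_assoc]
    congr 1
    rw [cpow_def_of_ne_zero h0, ← ofReal_natCast, ← ofReal_log h1.le, exp_re, Real.rpow_def_of_pos h1]
    simp only [re_ofReal_mul, im_ofReal_mul, neg_re, neg_im, mul_neg, Real.cos_neg]
    rw [mul_comm (Real.log n) s.im]

lemma LL_re_hasSum {s : ℂ} (hs : 1 < s.re) : HasSum (fun n : ℕ => Λ n * (n:ℝ) ^ (-s.re) * Real.cos (s.im * Real.log n)) (LL s).re := by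
  have := (LL_hasSum hs).mapL reCLM
  simp only [reCLM_apply, LL_term_re] at this
  exact this

lemma LL_norm_summable {s : ℂ} (hs : 1 < s.re) : HasSum (fun n : ℕ => Λ n * (n:ℝ) ^ (-s.re)) (LL s.re).re := by
  have := LL_re_hasSum (s := (s.re : ℂ)) (by simpa using hs)
  simpa using this

lemma LL_term_norm {s : ℂ} (n : ℕ) : ‖(Λ n : ℂ) * (n:ℂ) ^ (-s)‖ = Λ n * (n:ℝ) ^ (-s.re) := by
  have h2 : 0 ≤ Λ n := ArithmeticFunction.vonMangoldt_nonneg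
  rcases Nat.eq_zero_or_pos n with rfl | hn
  · simp
  rw [norm_mul, norm_natCast_cpow_of_pos hn, Complex.norm_of_nonneg h2, neg_re]

lemma LL_norm_le {s : ℂ} {σ : ℝ} (hσ : 1 < σ) (hs : σ ≤ s.re) : ‖LL s‖ ≤ (LL σ).re := by
  have h1 := LL_hasSum (s := s) (by linarith)
  have h2 := LL_norm_summable (s := (σ:ℂ)) (by simpa using hσ)
  rw [← h1.tsum_eq]
  refine tsum_of_norm_bounded (by simpa using h2) fun n => ?_
  rw [LL_term_norm]
  have h3 : 0 ≤ Λ n := ArithmeticFunction.vonMangoldt_nonneg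
  rcases Nat.eq_zero_or_pos n with rfl | hn
  · simp
  have : (1:ℝ) ≤ n := by exact_mod_cast hn
  refine mul_le_mul_of_nonneg_left ?_ h3
  exact Real.rpow_le_rpow_of_exponent_le this (by linarith)

lemma comb_nonneg {d γ : ℝ} (hd : 0 < d) :
    0 ≤ 3 * (LL ((1 + d : ℝ) : ℂ)).re + 4 * (LL ((1 + d : ℝ) + γ * I)).re + (LL ((1 + d : ℝ) + (2 * γ : ℝ) * I)).re := by
  have h1 := LL_re_hasSum (s := ((1 + d : ℝ) : ℂ)) (by simpa using hd)
  have h2 := LL_re_hasSum (s := ((1 + d : ℝ) : ℂ) + γ * I) (by simpa using hd)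
  have h3 := LL_re_hasSum (s := ((1 + d : ℝ) : ℂ) + (2 * γ : ℝ) * I) (by simpa using hd)
  refine ((h1.mul_left 3).add (h2.mul_left 4) |>.add h3).nonneg fun n => ?_
  have h4 : 0 ≤ Λ n := ArithmeticFunction.vonMangoldt_nonneg
  have e1 : (((1 + d : ℝ) : ℂ) + γ * I).re = 1 + d := by simp
  have e2 : (((1 + d : ℝ) : ℂ) + γ * I).im = γ := by simp
  have e3 : (((1 + d : ℝ) : ℂ) + (2 * γ : ℝ) * I).re = 1 + d := by simp
  have e4 : (((1 + d : ℝ) : ℂ) + (2 * γ : ℝ) * I).im = 2 * γ := by simp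
  have e5 : (((1 + d : ℝ) : ℂ)).im = 0 := ofReal_im _
  rw [e1, e2, e3, e4, e5, ofReal_re, zero_mul, Real.cos_zero, mul_assoc 2 γ, Real.cos_two_mul]
  have : 0 ≤ Λ n * (n:ℝ) ^ (-(1+d)) := by positivity
  nlinarith [mul_nonneg this (sq_nonneg (1 + Real.cos (γ * Real.log n)))]

lemma logDeriv_Xi {s : ℂ} (hs : 1 < s.re) : logDeriv Xi (s - 1/2) = 1 / (s - 1) + qq s - LL s := by
  have hs1 : s ≠ 1 := by rintro rfl; simp at hs
  have hs0 : s ≠ 0 := by rintro rfl; norm_num at hs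
  have e1 : logDeriv Xi (s - 1/2) = logDeriv xi s := by
    rw [logDeriv_apply, logDeriv_apply]
    have : Xi = fun z => xi (1/2 + z) := rfl
    rw [this, deriv_comp_const_add]; simp
  have hpi : (Real.pi : ℂ) ≠ 0 := by exact_mod_cast Real.pi_ne_zero
  have ev : xi =ᶠ[𝓝 s] fun s => (2 * (s - 1)) * ((Real.pi : ℂ) ^ (-s/2) * (Complex.Gamma (s/2 + 1) * riemannZeta s)) := by
    have : ∀ᶠ w in 𝓝 s, 1 < w.re := (isOpen_lt continuous_const continuous_re).mem_nhds hs
    filter_upwards [this] with w hw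
    have hw0 : w ≠ 0 := by rintro rfl; norm_num at hw
    rw [xi_eq' (by linarith) (by rintro rfl; simp at hw), Gammaℝ_def, Complex.Gamma_add_one _ (by simpa using hw0)]
    ring
  have hre : 0 < (s/2+1).re := by simp; linarith
  have hG : DifferentiableAt ℂ Complex.Gamma (s/2+1) := differentiableAt_Gamma _ fun m h => by
    rw [h] at hre; simp at hre
    have : (0:ℝ) ≤ m := by positivity
    linarith
  have hG0 : Complex.Gamma (s/2+1) ≠ 0 := Gamma_ne_zero_of_re_pos hre
  have hz : riemannZeta s ≠ 0 := riemannZeta_ne_zero_of_one_le_re hs.le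
  have hzd := differentiableAt_riemannZeta hs1
  have hc : (Real.pi : ℂ) ^ (-s/2) ≠ 0 := by simp [cpow_eq_zero_iff, hpi]
  have hGc : DifferentiableAt ℂ (fun s : ℂ => Complex.Gamma (s/2+1)) s := by
    have := DifferentiableAt.comp (f := fun s : ℂ => s/2+1) (g := Complex.Gamma) s hG (by fun_prop)
    exact this
  have hp : HasDerivAt (fun s : ℂ => (Real.pi : ℂ) ^ (-s/2)) ((Real.pi : ℂ) ^ (-s/2) * Complex.log Real.pi * (-1/2)) s :=
    (((hasDerivAt_id s).neg).div_const 2).const_cpow (Or.inl hpi)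
  have e2 : logDeriv xi s = logDeriv (fun s => (2 * (s - 1)) * ((Real.pi : ℂ) ^ (-s/2) * (Complex.Gamma (s/2 + 1) * riemannZeta s))) s := by
    rw [logDeriv_apply, logDeriv_apply, ev.deriv_eq, ev.eq_of_nhds]
  rw [e1, e2, logDeriv_mul (f := fun s : ℂ => 2 * (s - 1)) (g := fun s : ℂ => (Real.pi : ℂ) ^ (-s/2) * (Complex.Gamma (s/2 + 1) * riemannZeta s)) s (by simpa [sub_eq_zero] using hs1) (by simp [hc, hG0, hz]) (by fun_prop) (hp.differentiableAt.mul (hGc.mul hzd)),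
    logDeriv_mul (f := fun s : ℂ => (Real.pi : ℂ) ^ (-s/2)) (g := fun s : ℂ => Complex.Gamma (s/2 + 1) * riemannZeta s) s hc (by simp [hG0, hz]) hp.differentiableAt (hGc.mul hzd),
    logDeriv_mul (f := fun s : ℂ => Complex.Gamma (s/2+1)) s hG0 hz hGc hzd, LL_eq hs]
  have e3 : logDeriv (fun s : ℂ => 2 * (s - 1)) s = 1 / (s - 1) := by
    rw [logDeriv_const_mul _ _ two_ne_zero, logDeriv_apply]; simp
  have e4 : logDeriv (fun s : ℂ => (Real.pi : ℂ) ^ (-s/2)) s = - Real.log Real.pi / 2 := by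
    rw [logDeriv_apply, hp.deriv, ofReal_log Real.pi_pos.le]; field_simp
  have e5 : logDeriv (fun s : ℂ => Complex.Gamma (s/2+1)) s = digamma (s/2+1) / 2 := by
    rw [digamma_def, show (fun s : ℂ => Complex.Gamma (s/2+1)) = Complex.Gamma ∘ (fun s : ℂ => s/2+1) from rfl,
      logDeriv_comp (g := fun s : ℂ => s/2+1) hG (by fun_prop)]
    have : deriv (fun s : ℂ => s/2+1) s = 1/2 := by simp
    rw [this]; ring
  rw [e3, e4, e5, qq]; ring

lemma logDeriv_Xi_neg (z : ℂ) : logDeriv Xi (-z) = - logDeriv Xi z := by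
  rw [logDeriv_apply, logDeriv_apply, Xi_even, ← neg_div]
  congr 1
  have : deriv (fun z => Xi (-z)) z = - deriv Xi (-z) := deriv_comp_neg _ _
  rw [show (fun z => Xi (-z)) = Xi from funext Xi_even] at this
  rw [this, neg_neg]

lemma logDeriv_Xi_re_nonneg {z : ℂ} (hz : 1/2 ≤ z.re) : 0 ≤ (logDeriv Xi z).re :=
  le_trans (Finset.sum_nonneg fun a ha => mul_nonneg (mult_nonneg a) (by
    have := re_term_nonneg hz (mem_Z.1 ha).1; linarith [this.1, this.2])) (sum_le hz 0)

lemma LL_re_le {s : ℂ} (hs : 1 < s.re) : (LL s).re ≤ (1 / (s - 1)).re + (qq s).re := by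
  have h := logDeriv_Xi_re_nonneg (z := s - 1/2) (by simp; linarith)
  rw [logDeriv_Xi hs] at h
  simp only [sub_re, add_re] at h ⊢
  linarith

lemma log_pi_ge : 1.14 ≤ Real.log Real.pi := by
  rw [Real.le_log_iff_exp_le Real.pi_pos]
  refine le_trans ?_ Real.pi_gt_d2.le
  have h1 := Real.exp_bound' (x := 0.14) (by norm_num) (by norm_num) (n := 4) (by norm_num)
  have h2 := Real.exp_one_lt_d9
  rw [show (1.14:ℝ) = 1 + 0.14 by norm_num, Real.exp_add]
  have h3 : Real.exp 0.14 ≤ 1.1503 := by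
    refine h1.trans ?_
    norm_num [Finset.sum_range_succ, Nat.factorial]
  nlinarith [Real.exp_pos 0.14, Real.exp_pos 1]

lemma qq_re (s : ℂ) : (qq s).re = (digamma (s/2+1)).re / 2 - Real.log Real.pi / 2 := by
  rw [qq, sub_re]
  congr 1
  · simp
  · rw [show (Real.log Real.pi : ℂ) / 2 = ((Real.log Real.pi / 2 : ℝ) : ℂ) by push_cast; ring, ofReal_re]

lemma qq_re_le {s : ℂ} (hs : 1 ≤ s.re) : (qq s).re ≤ Real.log ((s.re/2+1)^2 + s.im^2/4) / 4 + 1/(2*(s.re+1)) - 0.57 := by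
  have h := digamma_re_le (z := s/2+1) (by simp; linarith)
  rw [qq_re]
  have e1 : (s/2+1).re = s.re/2+1 := by simp
  have e2 : (s/2+1).im = s.im/2 := by simp
  rw [e1, e2] at h
  have : 1 / (2 * (s.re/2+1) - 1) = 2 * (1/(2*(s.re+1))) := by
    have : s.re + 1 ≠ 0 := by linarith
    rw [show 2 * (s.re/2+1) - 1 = s.re + 1 by ring]; field_simp
  have h2 := log_pi_ge
  rw [this, div_pow] at h
  norm_num at h ⊢
  linarith

end EP

open MeasureTheory Set

namespace EP
open Complex Metric Filter Topology

local notation "Λ" => ArithmeticFunction.vonMangoldt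

lemma re_inv_formula (z : ℂ) : (1 / z).re = z.re / (z.re ^ 2 + z.im ^ 2) := by
  rw [one_div, inv_re, normSq_apply]; ring_nf

lemma digamma_three : (digamma 3).re ≤ 1 := by
  have h1 : digamma 2 = digamma 1 + 1 := by
    have := digamma_apply_add_one 1 (fun m h => by
      have := congrArg re h; simp at this; have : (0:ℝ) ≤ m := by positivity
      linarith)
    norm_num at this; rw [this]
  have h2 : digamma 3 = digamma 2 + 1/2 := by
    have := digamma_apply_add_one 2 (fun m h => by
      have := congrArg re h; simp at this; have : (0:ℝ) ≤ m := by positivity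
      linarith)
    norm_num at this ⊢; rw [this]
  rw [h2, h1, digamma_one]
  have := Real.one_half_lt_eulerMascheroniConstant
  simp; norm_num; linarith

lemma at_four : (logDeriv Xi (7/2)).re ≤ 0.2202 := by
  have h := logDeriv_Xi (s := 4) (by norm_num)
  rw [show (4:ℂ) - 1/2 = 7/2 by norm_num] at h
  rw [h, sub_re, add_re, qq_re]
  have h1 : (1 / ((4:ℂ) - 1)).re = 1/3 := by rw [re_inv_formula]; norm_num
  have h2 := digamma_three
  have h3 := log_pi_ge
  have h4 : Real.log 2 / 16 ≤ (LL 4).re := by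
    have hs := LL_re_hasSum (s := 4) (by norm_num)
    have := le_hasSum hs 2 (fun n _ => by
      have h4 : 0 ≤ Λ n := ArithmeticFunction.vonMangoldt_nonneg
      simp; positivity)
    refine le_trans (le_of_eq ?_) this
    rw [ArithmeticFunction.vonMangoldt_apply_prime Nat.prime_two]
    have e : ((4:ℂ)).re = (4:ℕ) := by norm_num
    rw [e, Real.rpow_neg (by norm_num), Real.rpow_natCast]
    simp; norm_num; ring
  have h5 := Real.log_two_gt_d9
  rw [h1, show (4:ℂ)/2+1 = 3 by norm_num]
  norm_num at *
  linarith

lemma term_four {a : ℂ} (ha : Xi a = 0) : 3 / (16 + a.im^2) ≤ ((1 / (7/2 - a)).re + (1 / (7/2 + a)).re) / 2 := by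
  have h := abs_lt.1 (Xi_zero ha).2
  have key : ∀ d : ℝ, 3 ≤ d → d ≤ 4 → 3 / (16 + a.im^2) ≤ d / (d^2 + a.im^2) := by
    intro d h1 h2
    rw [div_le_div_iff₀ (by positivity) (by positivity)]
    nlinarith [mul_nonneg (sub_nonneg.2 h1) (sq_nonneg a.im)]
  have h1 := key (7/2 - a.re) (by linarith [h.2]) (by linarith [h.1])
  have h2 := key (7/2 + a.re) (by linarith [h.1]) (by linarith [h.2])
  rw [re_inv_formula, re_inv_formula]
  have e1 : (7/2 - a).re = 7/2 - a.re := by simp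
  have e2 : (7/2 + a).re = 7/2 + a.re := by simp
  have e3 : (7/2 - a).im = - a.im := by simp
  have e4 : (7/2 + a).im = a.im := by simp
  rw [e1, e2, e3, e4, neg_sq]
  linarith

lemma sum_four (n : ℕ) : ∑ a ∈ Z n, mult a / (16 + a.im^2) ≤ 1 := by
  have h := sum_le (z := 7/2) (by norm_num) n
  have h2 := at_four
  have : ∑ a ∈ Z n, mult a / (16 + a.im^2) ≤ ∑ a ∈ Z n, mult a * (((1 / (7/2 - a)).re + (1 / (7/2 + a)).re) / 2) := by
    refine Finset.sum_le_sum fun a ha => ?_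
    have h3 := term_four (mem_Z.1 ha).1
    rw [div_eq_mul_inv]
    refine mul_le_mul_of_nonneg_left (le_trans ?_ h3) (mult_nonneg a)
    rw [inv_eq_one_div]
    gcongr; norm_num
  linarith

lemma sum_online (n : ℕ) : ∑ a ∈ (Z n).filter (fun a => a.re = 0), mult a / (12.25 + a.im^2) ≤ 0.063 := by
  have h := sum_le (z := 7/2) (by norm_num) n
  have h2 := at_four
  have h4 : ∑ a ∈ (Z n).filter (fun a => a.re = 0), mult a / (12.25 + a.im^2) * (7/2) ≤ ∑ a ∈ (Z n), mult a * (((1 / (7/2 - a)).re + (1 / (7/2 + a)).re) / 2) := by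
    refine le_trans (Finset.sum_le_sum (g := fun a => mult a * (((1 / (7/2 - a)).re + (1 / (7/2 + a)).re) / 2)) fun a ha => ?_) (Finset.sum_le_sum_of_subset_of_nonneg (Finset.filter_subset _ _) fun a ha _ => ?_)
    · have h0 := (Finset.mem_filter.1 ha).2
      rw [re_inv_formula, re_inv_formula]
      simp [h0]
      refine le_of_eq ?_
      norm_num; field_simp
    · have := re_term_nonneg (z := 7/2) (by norm_num) (mem_Z.1 ha).1
      exact mul_nonneg (mult_nonneg a) (by linarith [this.1, this.2])
  rw [← Finset.sum_mul] at h4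
  norm_num at *
  linarith

lemma LL_two : (LL 2).re ≤ 0.7 := by
  have h := LL_re_le (s := 2) (by norm_num)
  have h3 : (1 / ((2:ℂ) - 1)).re = 1 := by rw [re_inv_formula]; norm_num
  have h1 : digamma 2 = digamma 1 + 1 := by
    have := digamma_apply_add_one 1 (fun m h => by
      have := congrArg re h; simp at this; have : (0:ℝ) ≤ m := by positivity
      linarith)
    norm_num at this; rw [this]
  have h4 : (digamma 2).re ≤ 1/2 := by
    rw [h1, digamma_one]
    have := Real.one_half_lt_eulerMascheroniConstant
    simp; linarith
  have h5 := log_pi_ge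
  rw [h3, qq_re, show (2:ℂ)/2+1 = 2 by norm_num] at h
  norm_num at *
  linarith

lemma LL_three_half : (LL (3/2)).re ≤ 2 := by
  have h := LL_re_le (s := 3/2) (by norm_num)
  have h2 := qq_re_le (s := 3/2) (by norm_num)
  have h3 : (1 / ((3/2:ℂ) - 1)).re = 2 := by rw [re_inv_formula]; norm_num
  have h5 : Real.log (49/16) ≤ 1.386 := by
    refine (Real.log_le_log (by norm_num) (by norm_num : (49/16:ℝ) ≤ 4 - 15/16)).trans ?_
    rw [show (4 - 15/16:ℝ) = 2^2 * (49/64) by norm_num, Real.log_mul (by norm_num) (by norm_num), Real.log_pow]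
    have := Real.log_two_lt_d9
    have h0 : Real.log (49/64) ≤ 49/64 - 1 := Real.log_le_sub_one_of_pos (by norm_num)
    norm_num at *; linarith
  rw [h3] at h
  norm_num at *
  linarith

lemma log_ge_five {T : ℝ} (hT : 150 ≤ T) : 5 ≤ Real.log T := by
  rw [Real.le_log_iff_exp_le (by linarith)]
  refine le_trans ?_ hT
  have := Real.exp_one_lt_d9
  rw [show (5:ℝ) = ((5:ℕ):ℝ) * 1 by norm_num, Real.exp_nat_mul]
  calc Real.exp 1 ^ 5 ≤ 2.7182818286 ^ 5 := by gcongr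
    _ ≤ 150 := by norm_num

lemma sum_near {T : ℝ} (hT : 150 ≤ T) (n : ℕ) : ∑ a ∈ Z n, mult a / (4 + (|a.im| - T)^2) ≤ Real.log T := by
  set s : ℂ := 2 + T * I with hs
  have hsre : s.re = 2 := by simp [hs]
  have hsim : s.im = T := by simp [hs]
  have hzre : (s - 1/2).re = 3/2 := by simp [hsre]; norm_num
  have hzim : (s - 1/2).im = T := by simp [hsim]
  have h := sum_le (z := s - 1/2) (by rw [hzre]; norm_num) n
  rw [logDeriv_Xi (by rw [hsre]; norm_num), sub_re, add_re] at h
  have h1 : (1 / (s - 1)).re ≤ 0.001 := by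
    rw [re_inv_formula]; simp [hsre, hsim]; norm_num
    rw [inv_le_comm₀ (by positivity) (by positivity)]; nlinarith
  have h2 := qq_re_le (s := s) (by rw [hsre]; norm_num)
  rw [hsre, hsim] at h2
  have h3 : -(LL s).re ≤ 0.7 := by
    have e1 := LL_norm_le (s := s) (σ := 2) (by norm_num) (by rw [hsre])
    have e2 := LL_two
    have e3 := abs_le.1 (abs_re_le_norm (LL s))
    push_cast at e1
    linarith [e3.1]
  have hl : 0 < T := by linarith
  have h4 : Real.log ((2/2+1)^2 + T^2/4) ≤ 2 * Real.log T - 1.3 := by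
    have : ((2/2+1:ℝ))^2 + T^2/4 ≤ T^2 / 2^2 * (1.001) := by norm_num; nlinarith
    refine (Real.log_le_log (by positivity) this).trans ?_
    rw [Real.log_mul (by positivity) (by norm_num), Real.log_div (by positivity) (by norm_num), Real.log_pow, Real.log_pow]
    have h0 : Real.log (1.001) ≤ 1.001 - 1 := Real.log_le_sub_one_of_pos (by norm_num)
    have := Real.log_two_gt_d9
    norm_num at *; linarith
  have h5 : ∑ a ∈ Z n, mult a / (4 + (|a.im| - T)^2) / 2 ≤ ∑ a ∈ Z n, mult a * (((1 / (s - 1/2 - a)).re + (1 / (s - 1/2 + a)).re) / 2) := by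
    refine Finset.sum_le_sum fun a ha => ?_
    have ha0 := (mem_Z.1 ha).1
    have hab := abs_lt.1 (Xi_zero ha0).2
    have hnn := re_term_nonneg (z := s - 1/2) (by rw [hzre]; norm_num) ha0
    rw [div_div, div_eq_mul_inv]
    refine mul_le_mul_of_nonneg_left ?_ (mult_nonneg a)
    have key : ∀ d w : ℝ, 1 ≤ d → d ≤ 2 → w ^ 2 = (|a.im| - T)^2 → 1 / (4 + (|a.im| - T)^2) ≤ d / (d^2 + w^2) := by
      intro d w h1 h2 hw
      rw [hw]
      rw [div_le_div_iff₀ (by positivity) (by positivity)]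
      nlinarith [mul_nonneg (sub_nonneg.2 h1) (sq_nonneg (|a.im| - T))]
    rw [mul_inv, ← one_div, ← div_eq_mul_inv]
    refine div_le_div_of_nonneg_right ?_ (by norm_num)
    rcases abs_cases a.im with ⟨e, _⟩ | ⟨e, _⟩
    · have := key (3/2 - a.re) (T - a.im) (by linarith) (by linarith) (by rw [e]; ring)
      have e2 : (1 / (s - 1/2 - a)).re = (3/2 - a.re) / ((3/2 - a.re)^2 + (T - a.im)^2) := by
        rw [re_inv_formula, sub_re (s-1/2), sub_im (s-1/2), hzre, hzim]
      linarith [hnn.2]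
    · have := key (3/2 + a.re) (T + a.im) (by linarith) (by linarith) (by rw [e]; ring)
      have e2 : (1 / (s - 1/2 + a)).re = (3/2 + a.re) / ((3/2 + a.re)^2 + (T + a.im)^2) := by
        rw [re_inv_formula, add_re (s-1/2), add_im (s-1/2), hzre, hzim]
      linarith [hnn.1]
  rw [← Finset.sum_div] at h5
  have := log_ge_five hT
  norm_num at *
  linarith

lemma mult_one_le {a : ℂ} (h : Xi a = 0) : 1 ≤ mult a := by
  unfold mult
  have h1 : analyticOrderNatAt Xi a ≠ 0 := by
    intro h0
    have hA : AnalyticAt ℂ Xi a := Xi_diff.analyticAt a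
    have ht : analyticOrderAt Xi a ≠ ⊤ := order_ne_top Xi_diff Xi_half a
    have h2 : analyticOrderAt Xi a = 0 := by
      rw [← Nat.cast_analyticOrderNatAt ht, h0]; rfl
    exact hA.analyticOrderAt_eq_zero.1 h2 h
  exact_mod_cast Nat.one_le_iff_ne_zero.2 h1

lemma zero_term {z a : ℂ} (hz : 1/2 ≤ z.re) (ha : Xi a = 0) (ha0 : a ≠ 0) : (1 / (z - a)).re ≤ (logDeriv Xi z).re := by
  obtain ⟨n, hn⟩ := exists_nat_ge ‖a‖
  refine le_trans ?_ (sum_le hz n)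
  have h1 : a ∈ Z n := mem_Z.2 ⟨ha, hn⟩
  have h2 : -a ∈ Z n := mem_Z.2 ⟨by rw [Xi_even, ha], by rwa [norm_neg]⟩
  have hne : a ≠ -a := fun h => ha0 (self_eq_neg.1 h)
  have hsub : ({a, -a} : Finset ℂ) ⊆ Z n := by
    intro b hb; simp at hb; rcases hb with rfl | rfl <;> assumption
  refine le_trans ?_ (Finset.sum_le_sum_of_subset_of_nonneg hsub fun b hb _ => ?_)
  · rw [Finset.sum_pair hne]
    have m1 := mult_one_le ha
    have m2 := mult_one_le (mem_Z.1 h2).1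
    have t := re_term_nonneg hz ha
    rw [sub_neg_eq_add, ← sub_eq_add_neg]
    nlinarith [mul_nonneg (sub_nonneg.2 m1) (add_nonneg t.1 t.2), mul_nonneg (sub_nonneg.2 m2) (add_nonneg t.1 t.2), t.1, t.2]
  · have t := re_term_nonneg hz (mem_Z.1 hb).1
    exact mul_nonneg (mult_nonneg b) (by linarith [t.1, t.2])

lemma zero_free {a : ℂ} (ha : Xi a = 0) (hT : 150 ≤ |a.im|) : a.re ≤ 1/2 - 1 / (35 * Real.log |a.im|) := by
  set t := |a.im| with ht
  set l := Real.log t with hl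
  have hl5 : 5 ≤ l := log_ge_five hT
  have ht0 : 0 < t := by linarith
  set d := 1 / (5 * l) with hd
  have hd0 : 0 < d := by positivity
  have hd1 : d ≤ 0.04 := by rw [hd, div_le_iff₀ (by positivity)]; linarith
  have hc := comb_nonneg (γ := a.im) hd0
  have hsq : a.im ^ 2 = t ^ 2 := by rw [ht, sq_abs]
  have h1 : (LL ((1 + d : ℝ) : ℂ)).re ≤ 1 / d := by
    have h := LL_re_le (s := ((1 + d : ℝ) : ℂ)) (by simpa using hd0)
    have h2 := qq_re_le (s := ((1 + d : ℝ) : ℂ)) (by rw [ofReal_re]; linarith)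
    have h3 : (1 / (((1 + d : ℝ) : ℂ) - 1)).re = 1 / d := by
      rw [re_inv_formula]; simp; field_simp
    rw [ofReal_re, ofReal_im] at h2
    have h4 : Real.log (((1+d)/2+1)^2 + 0^2/4) ≤ 1.2 := by
      refine (Real.log_le_log (by positivity) (by nlinarith : ((1+d)/2+1)^2 + 0^2/4 ≤ 2 * 1.25)).trans ?_
      rw [Real.log_mul (by norm_num) (by norm_num)]
      have h0 : Real.log (1.25) ≤ 1.25 - 1 := Real.log_le_sub_one_of_pos (by norm_num)
      have := Real.log_two_lt_d9
      norm_num at *; linarith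
    have h5 : 1 / (2 * (1 + d + 1)) ≤ 1/4 := by gcongr; linarith
    norm_num at *; linarith
  have hq : ∀ w : ℝ, w ^ 2 / 4 ≤ t ^ 2 → t^2 ≤ w^2 → (qq ((1 + d : ℝ) + w * I)).re + (1 / (((1 + d : ℝ) : ℂ) + w * I - 1)).re ≤ l / 2 := by
    intro w hw hw2
    have e1 : (((1 + d : ℝ) : ℂ) + w * I).re = 1 + d := by simp
    have e2 : (((1 + d : ℝ) : ℂ) + w * I).im = w := by simp
    have h2 := qq_re_le (s := ((1 + d : ℝ) : ℂ) + w * I) (by rw [e1]; linarith)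
    rw [e1, e2] at h2
    have h3 : (1 / (((1 + d : ℝ) : ℂ) + w * I - 1)).re ≤ 0.001 := by
      rw [re_inv_formula, sub_re, sub_im, e1, e2, one_re, one_im, div_le_iff₀ (by nlinarith)]
      nlinarith
    have h4 : Real.log (((1+d)/2+1)^2 + w^2/4) ≤ 2 * l + 0.001 := by
      have : ((1+d)/2+1)^2 + w^2/4 ≤ t^2 * (1.001) := by nlinarith
      refine (Real.log_le_log (by positivity) this).trans ?_
      rw [Real.log_mul (by positivity) (by norm_num), Real.log_pow]
      have h0 : Real.log (1.001) ≤ 1.001 - 1 := Real.log_le_sub_one_of_pos (by norm_num)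
      norm_num at *; linarith
    have h5 : 1 / (2 * (1 + d + 1)) ≤ 1/4 := by gcongr; linarith
    norm_num at *; linarith
  have h2 : (LL ((1 + d : ℝ) + (2 * a.im : ℝ) * I)).re ≤ l / 2 := by
    have h := LL_re_le (s := ((1 + d : ℝ) : ℂ) + (2 * a.im : ℝ) * I) (by simpa using hd0)
    have := hq (2 * a.im) (by rw [mul_pow, hsq]; linarith) (by rw [mul_pow, hsq]; nlinarith)
    linarith
  have h3 : (LL ((1 + d : ℝ) + a.im * I)).re ≤ l / 2 - 1 / (1/2 + d - a.re) := by
    have hx := logDeriv_Xi (s := ((1 + d : ℝ) : ℂ) + a.im * I) (by simpa using hd0)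
    have hz := zero_term (z := ((1 + d : ℝ) : ℂ) + a.im * I - 1/2) (by simp; linarith) ha (by rintro rfl; simp at ht; linarith)
    have e : ((1 + d : ℝ) : ℂ) + a.im * I - 1/2 - a = ((1/2 + d - a.re : ℝ) : ℂ) := by
      apply Complex.ext <;> simp; ring
    rw [e, hx, sub_re, add_re, ← ofReal_one, ← ofReal_div, ofReal_re] at hz
    have := hq a.im (by rw [hsq]; nlinarith) (by rw [hsq])
    simp only [ofReal_one] at hz
    linarith
  have hb := (abs_lt.1 (Xi_zero ha).2).2
  have hpos : 0 < 1/2 + d - a.re := by linarith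
  have h4 : 4 / (1/2 + d - a.re) ≤ 17.5 * l := by
    have e1 : 1 / d = 5 * l := by rw [hd]; simp
    have e2 : 4 / (1/2 + d - a.re) = 4 * (1 / (1/2 + d - a.re)) := by ring
    rw [e2]; norm_num at *; linarith
  rw [div_le_iff₀ hpos] at h4
  have h5 : 8 / (35 * l) ≤ 1/2 + d - a.re := by
    rw [div_le_iff₀ (by positivity)]; norm_num at h4; linarith
  have e3 : 8 / (35 * l) = 1 / (35 * l) + d := by rw [hd]; field_simp; norm_num
  linarith

end EP

open MeasureTheory Set

namespace EP
open Complex Metric Filter Topology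

lemma cpow_pred {t : ℝ} (ht : 0 < t) (s : ℂ) : (t:ℂ) ^ s = (t:ℂ) ^ (s - 1) * t := by
  rw [cpow_sub _ _ (by exact_mod_cast ht.ne'), cpow_one, div_mul_cancel₀ _ (by exact_mod_cast ht.ne')]

lemma int_rpow_exp {b δ : ℝ} (hb : 0 < b) (hδ : 0 < δ) : IntegrableOn (fun t : ℝ => t ^ (b - 1) * Real.exp (-(δ * t))) (Ioi 0) := by
  by_contra hni
  have h0 := integral_undef hni
  rw [Real.integral_rpow_mul_exp_neg_mul_Ioi hb hδ] at h0
  have h1 := Real.Gamma_pos_of_pos hb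
  have : 0 < (1 / δ) ^ b * Real.Gamma b := by positivity
  linarith

lemma lap_norm {s r : ℂ} {t : ℝ} (ht : 0 < t) : ‖(t:ℂ) ^ (s - 1) * exp (-(r * t))‖ = t ^ (s.re - 1) * Real.exp (-(r.re * t)) := by
  rw [norm_mul, norm_cpow_eq_rpow_re_of_pos ht, norm_exp]; simp

lemma lap_meas (s r : ℂ) : AEStronglyMeasurable (fun t : ℝ => (t:ℂ) ^ (s - 1) * exp (-(r * t))) (volume.restrict (Ioi 0)) := by
  refine ContinuousOn.aestronglyMeasurable (fun t ht => ContinuousAt.continuousWithinAt ?_) measurableSet_Ioi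
  exact (continuousAt_ofReal_cpow_const _ _ (Or.inr (ne_of_gt ht))).mul (by fun_prop)

lemma lap_diff {s r : ℂ} (hs : 0 < s.re) (hr : 0 < r.re) :
    DifferentiableAt ℂ (fun r : ℂ => ∫ t in Ioi (0:ℝ), (t:ℂ) ^ (s - 1) * exp (-(r * t))) r := by
  set δ := r.re / 2 with hδ
  have hδ0 : 0 < δ := by positivity
  have hre : ∀ w ∈ ball r δ, δ ≤ w.re := by
    intro w hw
    have h1 : ‖w - r‖ < δ := by simpa [dist_eq_norm] using hw
    have h2 := (abs_lt.1 ((abs_re_le_norm (w - r)).trans_lt h1)).1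
    simp at h2; linarith
  refine (hasDerivAt_integral_of_dominated_loc_of_deriv_le (F' := fun w t => (t:ℂ) ^ (s + 1 - 1) * exp (-(w * t)) * (-1)) (bound := fun t => t ^ (s.re + 1 - 1) * Real.exp (-(δ * t))) (ball_mem_nhds _ hδ0) ?_ ?_ ?_ ?_ ?_ ?_).2.differentiableAt
  · exact Eventually.of_forall fun w => lap_meas s w
  · refine Integrable.mono' (int_rpow_exp hs hr) (lap_meas s r) ?_
    exact (ae_restrict_iff' measurableSet_Ioi).2 (Eventually.of_forall fun t ht => (lap_norm ht).le)
  · exact (lap_meas (s+1) r).mul_const _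
  · refine (ae_restrict_iff' measurableSet_Ioi).2 (Eventually.of_forall fun t ht w hw => ?_)
    have ht' : (0:ℝ) < t := ht
    rw [norm_mul, lap_norm ht]
    simp only [norm_neg, norm_one, mul_one, add_re, one_re]
    gcongr
    exact hre w hw
  · exact int_rpow_exp (by linarith) hδ0
  · refine (ae_restrict_iff' measurableSet_Ioi).2 (Eventually.of_forall fun t ht w hw => ?_)
    have h := ((((hasDerivAt_id w).mul_const (t:ℂ)).neg).cexp).const_mul ((t:ℂ) ^ (s - 1))
    refine h.congr_deriv ?_
    rw [show s + 1 - 1 = (s : ℂ) by ring, cpow_pred ht s]; simp; ring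

lemma lap_eq {s r : ℂ} (hs : 0 < s.re) (hr : 0 < r.re) :
    ∫ t in Ioi (0:ℝ), (t:ℂ) ^ (s - 1) * exp (-(r * t)) = (1 / r) ^ s * Complex.Gamma s := by
  have hU : IsOpen {r : ℂ | 0 < r.re} := isOpen_lt continuous_const continuous_re
  have hpre : IsPreconnected {r : ℂ | 0 < r.re} := (convex_halfSpace_re_gt 0).isPreconnected
  have h1 : AnalyticOnNhd ℂ (fun r : ℂ => ∫ t in Ioi (0:ℝ), (t:ℂ) ^ (s - 1) * exp (-(r * t))) {r : ℂ | 0 < r.re} :=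
    DifferentiableOn.analyticOnNhd (fun w hw => (lap_diff hs hw).differentiableWithinAt) hU
  have h2 : AnalyticOnNhd ℂ (fun r : ℂ => (1 / r) ^ s * Complex.Gamma s) {r : ℂ | 0 < r.re} := by
    refine DifferentiableOn.analyticOnNhd (fun w hw => ?_) hU
    have hw' : 0 < w.re := hw
    have hw0 : w ≠ 0 := by rintro rfl; simp at hw'
    refine (DifferentiableAt.mul_const ?_ _).differentiableWithinAt
    refine DifferentiableAt.cpow_const (DifferentiableAt.div (by fun_prop) (by fun_prop) hw0) (Or.inl ?_)
    rw [re_inv_formula]; positivity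
  refine h1.eqOn_of_preconnected_of_frequently_eq h2 hpre (z₀ := 1) (by simp) ?_ hr
  have ht : Tendsto (fun n : ℕ => (1:ℂ) + 1 / ((n:ℂ) + 1)) atTop (𝓝[≠] 1) := by
    refine tendsto_nhdsWithin_iff.2 ⟨?_, Eventually.of_forall fun n => ?_⟩
    · have := (tendsto_one_div_add_atTop_nhds_zero_nat (𝕜 := ℂ)).const_add 1
      simpa using this
    · simp; exact_mod_cast Nat.succ_ne_zero n
  refine ht.frequently (Frequently.of_forall fun n => ?_)
  have := Complex.integral_cpow_mul_exp_neg_mul_Ioi hs (r := 1 + 1/((n:ℝ)+1)) (by positivity)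
  push_cast at this
  exact this

lemma Gamma_ray0 {s : ℂ} (hs : 0 < s.re) {θ : ℝ} (h1 : -(Real.pi/2) < θ) (h2 : θ < Real.pi/2) :
    ‖Complex.Gamma s‖ * Real.exp (θ * s.im) ≤ Real.Gamma s.re * (Real.cos θ) ^ (-s.re) := by
  have hcos : 0 < Real.cos θ := Real.cos_pos_of_mem_Ioo ⟨h1, h2⟩
  set r : ℂ := exp (θ * I) with hr
  have hrre : r.re = Real.cos θ := by rw [hr, exp_ofReal_mul_I_re]
  have h := lap_eq hs (r := r) (by rw [hrre]; exact hcos)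
  have hn : ‖(1 / r) ^ s * Complex.Gamma s‖ = ‖Complex.Gamma s‖ * Real.exp (θ * s.im) := by
    rw [norm_mul, mul_comm]
    congr 1
    have e : 1 / r = exp ((-θ : ℝ) * I) := by rw [hr, one_div, ← exp_neg]; push_cast; ring_nf
    have hl : Complex.log (1/r) = (-θ : ℝ) * I := by
      rw [e, Complex.log_exp] <;> simp <;> linarith [Real.pi_pos]
    rw [cpow_def_of_ne_zero (by rw [e]; exact exp_ne_zero _), norm_exp, hl]
    congr 1; simp
  rw [← hn, ← h]
  have hint := Real.GammaIntegral_convergent hs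
  have key : ∫ t in Ioi (0:ℝ), t ^ (s.re - 1) * Real.exp (-(Real.cos θ * t)) = (1 / Real.cos θ) ^ s.re * Real.Gamma s.re :=
    Real.integral_rpow_mul_exp_neg_mul_Ioi hs hcos
  have key2 : Real.Gamma s.re * (Real.cos θ) ^ (-s.re) = ∫ t in Ioi (0:ℝ), t ^ (s.re - 1) * Real.exp (-(Real.cos θ * t)) := by
    rw [key, mul_comm, one_div, Real.inv_rpow hcos.le, Real.rpow_neg hcos.le]
  rw [key2]
  refine norm_integral_le_of_norm_le ?_ ?_
  · exact int_rpow_exp hs hcos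
  · refine (ae_restrict_iff' measurableSet_Ioi).2 (Eventually.of_forall fun t ht => ?_)
    rw [norm_mul, norm_cpow_eq_rpow_re_of_pos ht, norm_exp]
    simp [hrre]

lemma Gamma_ray {s : ℂ} (hs : 0 < s.re) {θ : ℝ} (h1 : 0 ≤ θ) (h2 : θ < Real.pi/2) :
    ‖Complex.Gamma s‖ ≤ Real.Gamma s.re * (Real.cos θ) ^ (-s.re) * Real.exp (-(θ * |s.im|)) := by
  have hp := Real.pi_pos
  have : ‖Complex.Gamma s‖ * Real.exp (θ * |s.im|) ≤ Real.Gamma s.re * (Real.cos θ) ^ (-s.re) := by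
    rcases abs_cases s.im with ⟨e, _⟩ | ⟨e, _⟩
    · rw [e]; exact Gamma_ray0 hs (by linarith) h2
    · rw [e]
      have := Gamma_ray0 hs (θ := -θ) (by linarith) (by linarith)
      rw [Real.cos_neg, neg_mul_comm] at this
      exact this
  rw [Real.exp_neg, ← div_eq_mul_inv, le_div_iff₀ (Real.exp_pos _)]
  exact this

lemma Gamma_le_two {a : ℝ} (h1 : 1/2 ≤ a) (h2 : a ≤ 3) : Real.Gamma a ≤ 2 := by
  have hc := Real.convexOn_Gamma.le_max_of_mem_Icc (x := 1/2) (y := 3) (by simp) (by simp) ⟨h1, h2⟩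
  refine hc.trans (max_le ?_ ?_)
  · rw [Real.Gamma_one_half_eq, Real.sqrt_le_left (by norm_num)]
    have := Real.pi_lt_d2; norm_num at *; linarith
  · have : Real.Gamma 3 = 2 := by
      rw [show (3:ℝ) = ((2:ℕ):ℝ) + 1 by norm_num, Real.Gamma_nat_eq_factorial]; norm_num
    rw [this]

lemma Gamma_le_one {a : ℝ} (h1 : 1 ≤ a) (h2 : a ≤ 2) : Real.Gamma a ≤ 1 := by
  have hc := Real.convexOn_Gamma.le_max_of_mem_Icc (x := 1) (y := 2) (by simp) (by simp) ⟨h1, h2⟩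
  simpa using hc

/-- crude ray bound at angle pi/4 -/
lemma Gamma_quarter {s : ℂ} (hs : 0 < s.re) :
    ‖Complex.Gamma s‖ ≤ Real.Gamma s.re * 2 ^ (s.re/2) * Real.exp (-(Real.pi/4 * |s.im|)) := by
  have hp := Real.pi_pos
  have h := Gamma_ray hs (θ := Real.pi/4) (by positivity) (by linarith)
  have : (Real.cos (Real.pi/4)) ^ (-s.re) = 2 ^ (s.re/2) := by
    rw [Real.cos_pi_div_four, show √2/2 = (2:ℝ) ^ (-(1/2):ℝ) by
      rw [Real.rpow_neg (by norm_num), ← Real.sqrt_eq_rpow, Real.sqrt_div_self', one_div], ← Real.rpow_mul (by norm_num)]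
    congr 1; ring
  rwa [this] at h

/-! ### the kernel K -/
noncomputable def KK (τ : ℝ) : ℂ := ∫ t in (0:ℝ)..2, (t:ℂ) ^ (I * τ - 1) * (hcut t : ℂ)

noncomputable def PP (t : ℝ) : ℝ := 8*t^2 - 12*t^3 + 6*t^4 - t^5
noncomputable def DP (t : ℝ) : ℝ := 16*t^2 - 28*t^3 + 12*t^4 + t^5 - t^6
noncomputable def D2 (t : ℝ) : ℝ := 32*t^2 - 68*t^3 + 20*t^4 + 17*t^5 - 5*t^6 - t^7
noncomputable def uu (t : ℝ) : ℝ := (66*t - 79*t^2 + 107/2*t^3 - 117/4*t^4 + 5*t^5 + t^6) * Real.exp (t - 1/2)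

lemma hcut_eq {t : ℝ} (h : t ∈ Icc (0:ℝ) 2) : hcut t = PP t * Real.exp (t - 1/2) := by
  rw [hcut, if_pos h, PP]; ring

lemma PP_zero (t : ℝ) : PP t = t^2 * (2-t)^3 := by rw [PP]; ring

lemma uu_sq_int : ∫ t in (0:ℝ)..2, (uu t)^2 ≤ 684.5 := by
  set R : ℝ → ℝ := fun t => (7133031/32 + -7133031/16*t + 7133031/16*t^2 - 2366061/8*t^3 + 2324349/16*t^4 - 443585/8*t^5 + 131443/8*t^6 - 3531*t^7 + 13097/32*t^8 + 46*t^9 - 111/4*t^10 + 2*t^11 + 1/2*t^12) with hR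
  have hd : ∀ t : ℝ, HasDerivAt (fun t => R t * Real.exp (2*t - 1)) ((uu t)^2) t := by
    intro t
    have h1 : HasDerivAt R (-7133031/16 + 7133031/16*(2*t) - 2366061/8*(3*t^2) + 2324349/16*(4*t^3) - 443585/8*(5*t^4) + 131443/8*(6*t^5) - 3531*(7*t^6) + 13097/32*(8*t^7) + 46*(9*t^8) - 111/4*(10*t^9) + 2*(11*t^10) + 1/2*(12*t^11)) t := by
      have p := fun (n : ℕ) (c : ℝ) => (hasDerivAt_pow n t).const_mul c
      have := ((((((((((((hasDerivAt_id t).const_mul (-7133031/16 : ℝ)).const_add (7133031/32 : ℝ)).add (p 2 (7133031/16))).sub (p 3 (2366061/8))).add (p 4 (2324349/16))).sub (p 5 (443585/8))).add (p 6 (131443/8))).sub (p 7 3531)).add (p 8 (13097/32))).add (p 9 46)).sub (p 10 (111/4))).add (p 11 2) |>.add (p 12 (1/2))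
      exact this.congr_deriv (by norm_num)
    have h2 : HasDerivAt (fun t : ℝ => Real.exp (2*t - 1)) (Real.exp (2*t-1) * 2) t := by
      have := (((hasDerivAt_id t).const_mul (2:ℝ)).sub_const 1).exp
      simpa using this
    refine (h1.mul h2).congr_deriv ?_
    have e : (Real.exp (t - 1/2))^2 = Real.exp (2*t-1) := by rw [← Real.exp_nat_mul]; congr 1; push_cast; ring
    unfold uu
    rw [mul_pow, e]; simp only [hR]; ring
  rw [intervalIntegral.integral_eq_sub_of_hasDerivAt (fun t _ => hd t) (by
    refine Continuous.intervalIntegrable ?_ _ _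
    unfold uu; fun_prop)]
  have e1 := Real.exp_one_lt_d9
  have e2 := Real.exp_one_gt_d9
  have e3 : Real.exp (2*2-1) = Real.exp 1 ^ 3 := by rw [← Real.exp_nat_mul]; norm_num
  have e4 : Real.exp (2*0-1) = (Real.exp 1)⁻¹ := by rw [← Real.exp_neg]; norm_num
  have e5 : Real.exp 1 ^ 3 ≤ 2.7182818286^3 := by gcongr
  have e6 : (2.7182818286:ℝ)⁻¹ ≤ (Real.exp 1)⁻¹ := by gcongr
  simp only [e3, e4, hR]
  norm_num at *
  linarith

lemma uu_int : ∫ t in (0:ℝ)..2, |uu t| ≤ 37 := by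
  have hc : Continuous uu := by unfold uu; fun_prop
  have h1 : ∫ t in (0:ℝ)..2, |uu t| ≤ ∫ t in (0:ℝ)..2, (18.5/2 + (uu t)^2 * (1/37)) := by
    refine intervalIntegral.integral_mono_on (by norm_num) (hc.abs.intervalIntegrable _ _) (Continuous.intervalIntegrable (by fun_prop) _ _) fun t _ => ?_
    nlinarith [sq_nonneg (|uu t| - 18.5), sq_abs (uu t)]
  have h2 := uu_sq_int
  rw [intervalIntegral.integral_add (by simp) (Continuous.intervalIntegrable (by fun_prop) _ _), intervalIntegral.integral_mul_const] at h1
  simp only [intervalIntegral.integral_const] at h1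
  norm_num at *
  linarith

end EP

open MeasureTheory Set
namespace EP
open Complex Metric Filter Topology

lemma KK_integrand {τ t : ℝ} (ht : t ∈ Ioc (0:ℝ) 2) : (t:ℂ) ^ (I * τ - 1) * (hcut t : ℂ)
    = (t:ℂ) ^ (I * τ) * (((8*t-12*t^2+6*t^3-t^4) * Real.exp (t-1/2) : ℝ) : ℂ) := by
  have h0 : (t:ℂ) ≠ 0 := by exact_mod_cast ht.1.ne'
  rw [hcut_eq ⟨ht.1.le, ht.2⟩, Complex.cpow_sub _ _ h0, PP, Complex.cpow_one]
  field_simp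
  push_cast
  ring

lemma KK_bound (τ : ℝ) : ‖KK τ‖ ≤ 37 / (12.25 + τ^2) := by
  set s : ℂ := I * τ with hs
  have hsre : s.re = 0 := by simp [hs]
  have hs2 : s^2 = -(τ:ℂ)^2 := by rw [hs, mul_pow, I_sq]; ring
  set p1 : ℝ → ℝ := fun t => (8*t-12*t^2+6*t^3-t^4) * Real.exp (t-1/2) with hp1
  set p2 : ℝ → ℝ := fun t => (16*t-28*t^2+12*t^3+t^4-t^5) * Real.exp (t-1/2) with hp2
  set p3 : ℝ → ℝ := fun t => (32*t-68*t^2+20*t^3+17*t^4-5*t^5-t^6) * Real.exp (t-1/2) with hp3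
  have c1 : Continuous p1 := by rw [hp1]; fun_prop
  have c2 : Continuous p2 := by rw [hp2]; fun_prop
  have c3 : Continuous p3 := by rw [hp3]; fun_prop
  have cu : Continuous uu := by unfold uu; fun_prop
  have he : ∀ t : ℝ, HasDerivAt (fun t : ℝ => Real.exp (t-1/2)) (Real.exp (t-1/2)) t := fun t => by
    have := ((hasDerivAt_id t).sub_const (1/2:ℝ)).exp
    simpa using this
  have d1 : ∀ t : ℝ, HasDerivAt p1 ((8-24*t+18*t^2-4*t^3) * Real.exp (t-1/2) + (8*t-12*t^2+6*t^3-t^4) * Real.exp (t-1/2)) t := fun t => by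
    have p := fun (n : ℕ) (c : ℝ) => (hasDerivAt_pow n t).const_mul c
    have := ((((hasDerivAt_id t).const_mul (8:ℝ)).sub (p 2 12)).add (p 3 6)).sub (p 4 1)
    refine HasDerivAt.congr_of_eventuallyEq ((this.mul (he t)).congr_deriv ?_) (Eventually.of_forall fun y => ?_)
    · simp; ring
    · simp [hp1]
  have d2 : ∀ t : ℝ, HasDerivAt p2 ((16-56*t+36*t^2+4*t^3-5*t^4) * Real.exp (t-1/2) + (16*t-28*t^2+12*t^3+t^4-t^5) * Real.exp (t-1/2)) t := fun t => by
    have p := fun (n : ℕ) (c : ℝ) => (hasDerivAt_pow n t).const_mul c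
    have := (((((hasDerivAt_id t).const_mul (16:ℝ)).sub (p 2 28)).add (p 3 12)).add (p 4 1)).sub (p 5 1)
    refine HasDerivAt.congr_of_eventuallyEq ((this.mul (he t)).congr_deriv ?_) (Eventually.of_forall fun y => ?_)
    · simp; ring
    · simp [hp2]
  have hint : ∀ f : ℝ → ℂ, Continuous f → IntervalIntegrable (fun t : ℝ => (t:ℂ)^s * f t) volume 0 2 := fun f hf =>
    (intervalIntegral.intervalIntegrable_cpow' (by rw [hsre]; norm_num)).mul_continuousOn hf.continuousOn
  have hftc : ∫ t in (0:ℝ)..2, (t:ℂ)^s * (s^2 * p1 t - p3 t) = 0 := by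
    have := intervalIntegral.integral_eq_sub_of_hasDerivAt_of_le (a := (0:ℝ)) (b := 2) (f := fun t : ℝ => (t:ℂ)^(s+1) * (s * p1 t - p2 t)) (f' := fun t : ℝ => (t:ℂ)^s * (s^2 * p1 t - p3 t)) (by norm_num)
      (Continuous.continuousOn ((Complex.continuous_ofReal_cpow_const (by simp [hsre])).mul (by fun_prop))) (fun t ht => ?_) (hint _ (by fun_prop))
    · rw [this]
      have e1 : p1 2 = 0 := by simp only [hp1]; norm_num
      have e2 : p2 2 = 0 := by simp only [hp2]; norm_num
      have e3 : p1 0 = 0 := by simp only [hp1]; norm_num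
      have e4 : p2 0 = 0 := by simp only [hp2]; norm_num
      simp [e1, e2, e3, e4]
    · have h0 : (t:ℂ) ≠ 0 := by exact_mod_cast ht.1.ne'
      have g1 : HasDerivAt (fun t : ℝ => (t:ℂ)^(s+1)) ((s+1) * (t:ℂ)^s) t := by
        have h1 : s + 1 ≠ 0 := by intro h; have := congrArg re h; simp [hsre] at this
        have := hasDerivAt_ofReal_cpow_const (x := t) (r := s + 1) ht.1.ne' h1
        simpa using this
      have g2 := ((d1 t).ofReal_comp.const_mul s).sub (d2 t).ofReal_comp
      refine (g1.mul g2).congr_deriv ?_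
      rw [Complex.cpow_add _ _ h0, Complex.cpow_one]
      simp only [hp1, hp2, hp3, Pi.sub_apply]
      push_cast
      ring
  have hK : ((12.25 + τ^2 : ℝ):ℂ) * KK τ = ∫ t in (0:ℝ)..2, (t:ℂ)^s * (uu t : ℂ) := by
    have e : KK τ = ∫ t in (0:ℝ)..2, (t:ℂ)^s * (p1 t : ℂ) := by
      refine intervalIntegral.integral_congr_ae (Eventually.of_forall fun t ht => ?_)
      rw [uIoc_of_le (by norm_num)] at ht
      exact KK_integrand ht
    rw [e, ← intervalIntegral.integral_const_mul]
    have := intervalIntegral.integral_sub (hint (fun t => (uu t:ℂ)) (by fun_prop)) (hint (fun t => s^2 * p1 t - p3 t) (by fun_prop))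
    rw [hftc, sub_zero] at this
    rw [← this]
    congr 1; funext t
    rw [hs2]; simp only [hp1, hp3, uu]; push_cast; ring
  have hn : (12.25 + τ^2) * ‖KK τ‖ ≤ 37 := by
    have : (12.25 + τ^2) * ‖KK τ‖ = ‖((12.25 + τ^2 : ℝ):ℂ) * KK τ‖ := by
      rw [norm_mul, Complex.norm_real, Real.norm_of_nonneg (by positivity)]
    rw [this, hK]
    refine (intervalIntegral.norm_integral_le_of_norm_le (by norm_num) (Eventually.of_forall fun t ht => ?_) (cu.abs.intervalIntegrable _ _)).trans uu_int
    rw [norm_mul, norm_cpow_eq_rpow_re_of_pos ht.1, hsre]; simp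
  rw [le_div_iff₀ (by positivity)]; linarith

lemma KK_cont : Continuous KK := by
  have : ∀ τ, KK τ = ∫ t in (0:ℝ)..2, (t:ℂ) ^ (I * τ) * (((8*t-12*t^2+6*t^3-t^4) * Real.exp (t-1/2) : ℝ) : ℂ) := fun τ => by
    refine intervalIntegral.integral_congr_ae (Eventually.of_forall fun t ht => ?_)
    rw [uIoc_of_le (by norm_num)] at ht
    exact KK_integrand ht
  rw [funext this]
  have cc : Continuous fun t : ℝ => (((8*t-12*t^2+6*t^3-t^4) * Real.exp (t-1/2) : ℝ) : ℂ) := by fun_prop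
  refine intervalIntegral.continuous_of_dominated_interval (bound := fun t => ‖(((8*t-12*t^2+6*t^3-t^4) * Real.exp (t-1/2) : ℝ) : ℂ)‖) (fun τ => ?_) (fun τ => ?_) (cc.norm.intervalIntegrable _ _) (Eventually.of_forall fun t ht => ?_)
  · have h0 : IntervalIntegrable (fun t : ℝ => (t:ℂ)^(I*τ)) volume 0 2 := intervalIntegral.intervalIntegrable_cpow' (by simp)
    have h1 := (intervalIntegrable_iff.1 (h0.mul_continuousOn cc.continuousOn))
    exact h1.aestronglyMeasurable
  · refine Eventually.of_forall fun t ht => ?_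
    rw [uIoc_of_le (by norm_num)] at ht
    rw [norm_mul, norm_cpow_eq_rpow_re_of_pos ht.1]; simp
  · rw [uIoc_of_le (by norm_num)] at ht
    have h0 : (t:ℂ) ≠ 0 := by exact_mod_cast ht.1.ne'
    refine Continuous.mul ?_ continuous_const
    exact Continuous.const_cpow (by fun_prop) (Or.inl h0)

end EP

open MeasureTheory Set
namespace EP
open Complex Metric Filter Topology

lemma hcut_meas : Measurable hcut := by
  unfold hcut
  exact Measurable.ite measurableSet_Icc (by fun_prop) measurable_const

lemma hcut_nonneg (t : ℝ) : 0 ≤ hcut t := by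
  unfold hcut; split_ifs with h
  · have := sub_nonneg.2 h.2; positivity
  · exact le_rfl

lemma hcut_zero {t : ℝ} (h : 2 < t) : hcut t = 0 := by
  rw [hcut, if_neg]; intro h'; linarith [h'.2]

lemma hcut_mellin (τ : ℝ) : HasMellin (fun t => (hcut t : ℂ)) (I * τ) (KK τ) := by
  have h0 : ∀ t ∈ Ioi (2:ℝ), (t:ℂ) ^ (I * τ - 1) • (hcut t : ℂ) = 0 := fun t ht => by
    rw [hcut_zero ht]; simp
  have hi : IntegrableOn (fun t : ℝ => (t:ℂ) ^ (I * τ - 1) • (hcut t : ℂ)) (Ioc 0 2) := by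
    have h1 : IntervalIntegrable (fun t : ℝ => (t:ℂ)^(I*τ)) volume 0 2 := intervalIntegral.intervalIntegrable_cpow' (by simp)
    have cc : Continuous fun t : ℝ => (((8*t-12*t^2+6*t^3-t^4) * Real.exp (t-1/2) : ℝ) : ℂ) := by fun_prop
    have h2 := (h1.mul_continuousOn cc.continuousOn).1
    refine h2.congr_fun (fun t ht => ?_) measurableSet_Ioc
    exact (KK_integrand ht).symm
  have hu : Ioi (0:ℝ) = Ioc 0 2 ∪ Ioi 2 := (Ioc_union_Ioi_eq_Ioi (by norm_num)).symm
  have hz : IntegrableOn (fun t : ℝ => (t:ℂ) ^ (I * τ - 1) • (hcut t : ℂ)) (Ioi 2) :=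
    (integrableOn_zero).congr_fun (fun t ht => (h0 t ht).symm) measurableSet_Ioi
  constructor
  · rw [MellinConvergent, hu]; exact hi.union hz
  · rw [mellin, hu, setIntegral_union (Ioc_disjoint_Ioi le_rfl) measurableSet_Ioi hi hz, setIntegral_congr_fun measurableSet_Ioi h0, KK, intervalIntegral.integral_of_le (by norm_num)]
    simp

lemma FH_eq {H y : ℝ} (hH : 0 ≤ H) (hy : 0 < y) (hy1 : y ≠ 1) :
    (FH H y : ℂ) = 1/(2*Real.pi) * ∫ τ in Ioc (-H) H, (y:ℂ)^(I*(τ:ℂ)) := by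
  have hl : Real.log y ≠ 0 := Real.log_ne_zero_of_pos_of_ne_one hy hy1
  have hl' : (Real.log y : ℂ) ≠ 0 := by exact_mod_cast hl
  have h0 : (y:ℂ) ≠ 0 := by exact_mod_cast hy.ne'
  have hp : (Real.pi : ℂ) ≠ 0 := by exact_mod_cast Real.pi_ne_zero
  have : ∀ τ : ℝ, (y:ℂ)^(I*(τ:ℂ)) = cexp ((I * Real.log y) * τ) := fun τ => by
    rw [Complex.cpow_def_of_ne_zero h0, ← Complex.ofReal_log hy.le]; congr 1; ring
  simp_rw [this]
  rw [← intervalIntegral.integral_of_le (by linarith), integral_exp_mul_complex (by simp [hl])]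
  rw [FH]
  push_cast
  rw [Complex.sin]
  rw [show I * (Real.log y:ℂ) * -(H:ℂ) = -(H * Real.log y : ℂ) * I by ring, show I * (Real.log y:ℂ) * (H:ℂ) = (H * Real.log y : ℂ) * I by ring]
  field_simp
  rw [I_sq]; ring

lemma hH_eq {H t : ℝ} (hH0 : 0 ≤ H) (ht : 0 < t) :
    (hH H t : ℂ) = 1/(2*Real.pi) * ∫ τ in Ioc (-H) H, KK τ * (t:ℂ)^(-(I*(τ:ℂ))) := by
  have hmel : ∀ τ : ℝ, HasMellin (fun y => (hcut (t / y) : ℂ)) (I * τ) ((t:ℂ)^(I*(τ:ℂ)) * KK (-τ)) := by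
    intro τ
    have h1 := hcut_mellin (-τ)
    have e : I * ((-τ : ℝ):ℂ) = -(I*τ) := by push_cast; ring
    rw [e] at h1
    constructor
    · have := (MellinConvergent.comp_mul_left (f := fun t => (hcut t : ℂ)) ht).2 h1.1
      have := (MellinConvergent.comp_rpow (f := fun u => (hcut (t * u):ℂ)) (s := I*τ) (a := -1) (by norm_num)).2 (by push_cast; rw [div_neg, div_one]; exact this)
      simpa [Real.rpow_neg_one, div_eq_mul_inv] using this
    · have := mellin_comp_inv (fun u => (hcut (t * u):ℂ)) (I*τ)
      simp only [div_eq_mul_inv]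
      rw [this, mellin_comp_mul_left (fun u => (hcut u:ℂ)) _ ht, h1.2, neg_neg, smul_eq_mul]
  have hswap : ∫ y in Ioi (0:ℝ), ∫ τ in Ioc (-H) H, ((y:ℂ)^(I*(τ:ℂ) - 1) • (hcut (t/y):ℂ))
      = ∫ τ in Ioc (-H) H, ∫ y in Ioi (0:ℝ), ((y:ℂ)^(I*(τ:ℂ) - 1) • (hcut (t/y):ℂ)) := by
    refine integral_integral_swap ?_
    have hb : Integrable (fun p : ℝ × ℝ => ‖(p.1:ℂ)^(I*((0:ℝ):ℂ) - 1) • (hcut (t/p.1):ℂ)‖ * (1:ℝ)) ((volume.restrict (Ioi (0:ℝ))).prod (volume.restrict (Ioc (-H) H))) :=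
      Integrable.mul_prod (hmel 0).1.norm (integrable_const _)
    refine hb.mono' ?_ ?_
    · refine Measurable.aestronglyMeasurable ?_
      have := hcut_meas
      simp only [Function.uncurry_def]
      fun_prop
    · rw [Measure.prod_restrict]
      refine (ae_restrict_iff' (measurableSet_Ioi.prod measurableSet_Ioc)).2 (Eventually.of_forall fun p hp => ?_)
      have hp1 : 0 < p.1 := hp.1
      simp only [Function.uncurry_def, norm_smul, mul_one]
      rw [norm_cpow_eq_rpow_re_of_pos hp1, norm_cpow_eq_rpow_re_of_pos hp1]
      simp
  have e1 : (hH H t : ℂ) = 1/(2*Real.pi) * ∫ y in Ioi (0:ℝ), ∫ τ in Ioc (-H) H, ((y:ℂ)^(I*(τ:ℂ) - 1) • (hcut (t/y):ℂ)) := by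
    rw [hH, ← integral_complex_ofReal, ← integral_const_mul]
    have h1 : ∀ᵐ y : ℝ ∂(volume.restrict (Ioi (0:ℝ))), y ≠ 1 := by
      refine ae_restrict_of_ae ?_
      exact Measure.ae_ne volume 1
    refine integral_congr_ae ?_
    filter_upwards [h1, ae_restrict_mem measurableSet_Ioi] with y hy1 hy0
    have h0 : (y:ℂ) ≠ 0 := by exact_mod_cast (ne_of_gt hy0)
    push_cast
    rw [FH_eq hH0 hy0 hy1]
    simp only [smul_eq_mul, integral_mul_const, Complex.cpow_sub _ _ h0, Complex.cpow_one, integral_div]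
    ring
  rw [e1, hswap]
  congr 1
  have e2 : ∀ τ : ℝ, ∫ y in Ioi (0:ℝ), ((y:ℂ)^(I*(τ:ℂ) - 1) • (hcut (t/y):ℂ)) = (t:ℂ)^(I*(τ:ℂ)) * KK (-τ) := fun τ => (hmel τ).2
  simp_rw [e2]
  rw [← intervalIntegral.integral_of_le (by linarith), ← intervalIntegral.integral_of_le (by linarith)]
  have := intervalIntegral.integral_comp_neg (a := -H) (b := H) (fun τ : ℝ => KK τ * (t:ℂ)^(-(I*(τ:ℂ))))
  rw [neg_neg] at this
  rw [← this]
  congr 1; funext τ; push_cast; rw [mul_neg, neg_neg, mul_comm]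

noncomputable def nu (H : ℝ) : Measure ℝ := volume.restrict (Ioc (-H) H)

instance (H : ℝ) : IsFiniteMeasure (nu H) := by unfold nu; infer_instance

lemma KK_int (H : ℝ) : Integrable KK (nu H) :=
  (KK_cont.integrableOn_Icc (a := -H) (b := H)).mono_set Ioc_subset_Icc_self

noncomputable def gg (H t : ℝ) : ℂ := (((etaPlus H t)^2 : ℝ) : ℂ)

lemma gg_eq {H t : ℝ} (hH0 : 0 ≤ H) (ht : 0 < t) : gg H t = 1/(4*Real.pi^2) *
    ∫ p : ℝ × ℝ, KK p.1 * KK p.2 * ((t:ℂ)^(2 - I*(p.1+p.2)) * cexp (-t^2)) ∂((nu H).prod (nu H)) := by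
  have h0 : (t:ℂ) ≠ 0 := by exact_mod_cast ht.ne'
  have e1 : ∀ p : ℝ × ℝ, KK p.1 * KK p.2 * ((t:ℂ)^(2 - I*(p.1+p.2)) * cexp (-t^2))
      = (KK p.1 * (t:ℂ)^(-(I*(p.1:ℂ)))) * (KK p.2 * (t:ℂ)^(-(I*(p.2:ℂ)))) * ((t:ℂ)^2 * cexp (-t^2)) := fun p => by
    rw [show (2 - I*(p.1+p.2) : ℂ) = (-(I*(p.1:ℂ))) + (-(I*(p.2:ℂ))) + (2:ℕ) by push_cast; ring, Complex.cpow_add _ _ h0, Complex.cpow_add _ _ h0, Complex.cpow_natCast]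
    ring
  simp_rw [e1]
  rw [integral_mul_const, integral_prod_mul (fun τ => KK τ * (t:ℂ)^(-(I*(τ:ℂ)))) (fun τ => KK τ * (t:ℂ)^(-(I*(τ:ℂ))))]
  have e2 := hH_eq hH0 ht
  have e3 : (∫ τ, KK τ * (t:ℂ)^(-(I*(τ:ℂ))) ∂(nu H)) = 2 * Real.pi * hH H t := by
    rw [e2]
    have hp : (Real.pi : ℂ) ≠ 0 := by exact_mod_cast Real.pi_ne_zero
    unfold nu; field_simp
  have e4 : cexp (-t^2) = cexp (-t^2/2)^2 := by rw [← Complex.exp_nat_mul]; congr 1; push_cast; ring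
  have hp : (Real.pi : ℂ) ≠ 0 := by exact_mod_cast Real.pi_ne_zero
  rw [e3, gg, etaPlus, e4]
  push_cast
  field_simp
  ring

lemma gauss_mellin {w : ℂ} (hw : 0 < w.re) : HasMellin (fun t : ℝ => cexp (-t^2)) w (Complex.Gamma (w/2) / 2) := by
  have h1 : 0 < (w/2).re := by simpa using hw
  have h2 : MellinConvergent (fun x : ℝ => ((Real.exp (-x) : ℝ):ℂ)) (w/2) := by
    have := Complex.GammaIntegral_convergent h1
    refine this.congr_fun (fun t _ => ?_) measurableSet_Ioi
    simp [mul_comm]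
  have e : (fun t : ℝ => cexp (-t^2)) = fun t : ℝ => ((Real.exp (-(t^(2:ℝ))) : ℝ):ℂ) := by
    funext t; push_cast; rw [show (t^(2:ℝ):ℝ) = t^2 by exact_mod_cast Real.rpow_natCast t 2]; push_cast; rfl
  rw [e]
  constructor
  · exact (MellinConvergent.comp_rpow (f := fun x : ℝ => ((Real.exp (-x) : ℝ):ℂ)) (a := 2) (by norm_num)).2 (by simpa using h2)
  · rw [mellin_comp_rpow (fun x : ℝ => ((Real.exp (-x) : ℝ):ℂ))]
    rw [← Complex.GammaIntegral_eq_mellin]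
    push_cast
    rw [← Complex.Gamma_eq_integral h1]
    simp; ring

lemma GG_eq {H : ℝ} (hH0 : 0 ≤ H) {s : ℂ} (hs : -2 < s.re) : HasMellin (gg H) s
    (1/(8*Real.pi^2) * ∫ p : ℝ × ℝ, KK p.1 * KK p.2 * Complex.Gamma (s/2 + 1 - I*(p.1+p.2)/2) ∂((nu H).prod (nu H))) := by
  set f : ℝ → ℝ × ℝ → ℂ := fun t p => (t:ℂ)^(s-1) * (KK p.1 * KK p.2 * ((t:ℂ)^(2 - I*(p.1+p.2)) * cexp (-t^2))) with hf
  have hcc := KK_cont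
  have hg0 : IntegrableOn (fun t : ℝ => (t:ℂ)^(s+2-1) • cexp (-t^2)) (Ioi 0) := (gauss_mellin (w := s+2) (by simp; linarith)).1
  have hint : Integrable (Function.uncurry f) ((volume.restrict (Ioi 0)).prod ((nu H).prod (nu H))) := by
    have hb := Integrable.mul_prod hg0.norm (Integrable.mul_prod (KK_int H).norm (KK_int H).norm)
    refine hb.mono' ?_ ?_
    · refine Measurable.aestronglyMeasurable ?_
      simp only [Function.uncurry_def, hf]
      have : Measurable KK := hcc.measurable
      fun_prop
    · have : (volume.restrict (Ioi (0:ℝ))).prod ((nu H).prod (nu H)) = ((volume.prod ((nu H).prod (nu H))).restrict ((Ioi (0:ℝ)) ×ˢ univ)) := by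
        rw [← Measure.prod_restrict, Measure.restrict_univ]
      rw [this]
      refine (ae_restrict_iff' (measurableSet_Ioi.prod MeasurableSet.univ)).2 (Eventually.of_forall fun p hp => ?_)
      have hp1 : 0 < p.1 := hp.1
      simp only [Function.uncurry_def, hf, norm_mul, norm_smul]
      rw [norm_cpow_eq_rpow_re_of_pos hp1, norm_cpow_eq_rpow_re_of_pos hp1, norm_cpow_eq_rpow_re_of_pos hp1]
      have : p.1 ^ (s+2-1).re = p.1 ^ (s-1).re * p.1 ^ (2 - I*(p.2.1+p.2.2)).re := by
        rw [← Real.rpow_add hp1]; congr 1; simp; ring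
      rw [this]
      apply le_of_eq; ring
  have hpt : ∀ t ∈ Ioi (0:ℝ), (t:ℂ)^(s-1) • gg H t = 1/(4*Real.pi^2) * ∫ p, f t p ∂((nu H).prod (nu H)) := fun t ht => by
    rw [gg_eq hH0 ht, hf]
    simp only [integral_const_mul, smul_eq_mul]; ring
  constructor
  · refine IntegrableOn.congr_fun (f := fun t => 1/(4*Real.pi^2) * ∫ p, f t p ∂((nu H).prod (nu H))) ?_ (fun t ht => (hpt t ht).symm) measurableSet_Ioi
    exact hint.integral_prod_left.const_mul _
  · rw [mellin, setIntegral_congr_fun measurableSet_Ioi hpt, integral_const_mul, integral_integral_swap hint]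
    have : ∀ p : ℝ × ℝ, ∫ t in Ioi (0:ℝ), f t p = KK p.1 * KK p.2 * Complex.Gamma (s/2 + 1 - I*(p.1+p.2)/2) / 2 := fun p => by
      have h1 := (gauss_mellin (w := s + 2 - I*(p.1+p.2)) (by simp; linarith)).2
      have h2 : ∫ t in Ioi (0:ℝ), f t p = KK p.1 * KK p.2 * mellin (fun t : ℝ => cexp (-t^2)) (s + 2 - I*(p.1+p.2)) := by
        rw [mellin, ← integral_const_mul]
        refine setIntegral_congr_fun measurableSet_Ioi fun t ht => ?_
        have h0 : (t:ℂ) ≠ 0 := by exact_mod_cast (ne_of_gt ht)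
        simp only [hf, smul_eq_mul]
        rw [show s + 2 - I*(p.1+p.2) - 1 = (s-1) + (2 - I*(p.1+p.2)) by ring, Complex.cpow_add _ _ h0]
        ring
      rw [h2, h1]
      rw [show (s + 2 - I*(p.1+p.2))/2 = s/2 + 1 - I*(p.1+p.2)/2 by ring]
      ring
    simp_rw [this]
    rw [integral_div]
    have hp : (Real.pi : ℂ) ≠ 0 := by exact_mod_cast Real.pi_ne_zero
    field_simp; ring

end EP

open MeasureTheory Set
namespace EP
open Complex Metric Filter Topology

noncomputable def GG (H : ℝ) (s : ℂ) : ℂ := mellin (gg H) s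

lemma cont_int {H : ℝ} {f : ℝ × ℝ → ℝ} (hf : Continuous f) : Integrable f ((nu H).prod (nu H)) := by
  unfold nu
  rw [Measure.prod_restrict]
  have : IntegrableOn f (Icc (-H) H ×ˢ Icc (-H) H) := hf.continuousOn.integrableOn_compact (isCompact_Icc.prod isCompact_Icc)
  exact this.mono_set (prod_mono Ioc_subset_Icc_self Ioc_subset_Icc_self)

lemma cont_int1 {H : ℝ} {f : ℝ → ℝ} (hf : Continuous f) : Integrable f (nu H) := by
  unfold nu
  exact (hf.continuousOn.integrableOn_compact (isCompact_Icc (a := -H) (b := H))).mono_set Ioc_subset_Icc_self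

lemma GG_le {H : ℝ} (hH0 : 0 ≤ H) {s : ℂ} (hs : -2 < s.re) {B : ℝ × ℝ → ℝ} (hB : Continuous B)
    (h : ∀ p : ℝ × ℝ, p.1 ∈ Ioc (-H) H → p.2 ∈ Ioc (-H) H →
      ‖KK p.1‖ * ‖KK p.2‖ * ‖Complex.Gamma (s/2 + 1 - I*(p.1+p.2)/2)‖ ≤ B p) :
    ‖GG H s‖ ≤ 1/(8*Real.pi^2) * ∫ p, B p ∂((nu H).prod (nu H)) := by
  rw [GG, (GG_eq hH0 hs).2, norm_mul]
  have : ‖(1/(8*(Real.pi:ℂ)^2))‖ = 1/(8*Real.pi^2) := by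
    simp [abs_of_pos Real.pi_pos]
  rw [this]
  gcongr
  refine norm_integral_le_of_norm_le (cont_int hB) ?_
  unfold nu
  rw [Measure.prod_restrict]
  refine (ae_restrict_iff' (measurableSet_Ioc.prod measurableSet_Ioc)).2 (Eventually.of_forall fun p hp => ?_)
  rw [norm_mul, norm_mul]
  exact h p hp.1 hp.2

lemma int_exp_abs {q : ℝ} (hq : 0 < q) (u : ℝ) : Integrable (fun τ : ℝ => Real.exp (-(q * |u - τ|))) ∧ ∫ τ : ℝ, Real.exp (-(q * |u - τ|)) = 2/q := by
  have h0 : IntegrableOn (fun x : ℝ => Real.exp (-(q * x))) (Ioi 0) := by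
    have := exp_neg_integrableOn_Ioi 0 hq
    simpa using this
  have h1 : Integrable (fun τ : ℝ => Real.exp (-(q * |τ|))) := by
    have h2 : IntegrableOn (fun τ : ℝ => Real.exp (-(q * |τ|))) (Ioi 0) := h0.congr_fun (fun x hx => by
      simp only [abs_of_pos (show 0 < x from hx)]) measurableSet_Ioi
    have h3 : IntegrableOn (fun τ : ℝ => Real.exp (-(q * |τ|))) (Iic 0) := by
      have := (integrableOn_Iic_iff_integrableOn_Iio (μ := volume) (f := fun τ : ℝ => Real.exp (-(q * |τ|))) (b := 0)).2
      refine this ?_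
      have h4 := (h2.comp_neg)
      simpa using h4
    rw [← integrableOn_univ, ← Iic_union_Ioi (a := (0:ℝ))]
    exact h3.union h2
  refine ⟨(h1.comp_sub_left u), ?_⟩
  rw [integral_sub_left_eq_self (fun τ : ℝ => Real.exp (-(q * |τ|))) volume u]
  rw [integral_comp_abs (f := fun x => Real.exp (-(q * x)))]
  have := integral_exp_mul_Ioi (a := -q) (by linarith) 0
  simp only [neg_mul] at this
  rw [this]; simp; ring

lemma nu_exp_le {H : ℝ} (u : ℝ) : ∫ τ, Real.exp (-(0.39 * |u - τ|)) ∂(nu H) ≤ 5.13 := by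
  obtain ⟨h1, h2⟩ := int_exp_abs (q := 0.39) (by norm_num) u
  refine (setIntegral_le_integral h1 (Eventually.of_forall fun _ => (Real.exp_pos _).le)).trans ?_
  rw [h2]; norm_num

lemma nu_cauchy_le {H : ℝ} : ∫ τ, 1/(12.25 + τ^2) ∂(nu H) ≤ 0.898 := by
  have e : (fun τ : ℝ => 1/(12.25 + τ^2)) = fun τ : ℝ => (1/12.25) * (1 + (τ/3.5)^2)⁻¹ := by
    funext τ; field_simp; norm_num; ring
  have h1 : Integrable (fun τ : ℝ => 1/(12.25 + τ^2)) := by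
    rw [e]; exact (integrable_inv_one_add_sq.comp_div (by norm_num)).const_mul _
  refine (setIntegral_le_integral h1 (Eventually.of_forall fun _ => by positivity)).trans ?_
  rw [e, integral_const_mul, Measure.integral_comp_div (fun x : ℝ => (1 + x^2)⁻¹), integral_univ_inv_one_add_sq]
  have := Real.pi_lt_d4
  rw [abs_of_pos (by norm_num), smul_eq_mul]
  norm_num at *; linarith

lemma sq_exp_le (y : ℝ) : y^2 * Real.exp (-(0.39 * |y|)) ≤ 3.57 := by
  have h1 : 0.39*|y|/2 ≤ Real.exp (0.39*|y|/2 - 1) := by linarith [Real.add_one_le_exp (0.39*|y|/2 - 1)]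
  have h2 : (0.39*|y|/2)^2 ≤ Real.exp (0.39*|y|/2 - 1)^2 := by gcongr
  have h3 : Real.exp (0.39*|y|/2 - 1)^2 = Real.exp (0.39*|y|) * Real.exp (-2) := by
    rw [← Real.exp_nat_mul, ← Real.exp_add]; congr 1; push_cast; ring
  have h4 : Real.exp (-2) ≤ 0.13534 := by
    have : Real.exp (-2) = (Real.exp 1)⁻¹^2 := by rw [← Real.exp_neg, ← Real.exp_nat_mul]; norm_num
    rw [this]
    have : (Real.exp 1)⁻¹ ≤ (2.7182818283)⁻¹ := by gcongr; exact Real.exp_one_gt_d9.le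
    calc (Real.exp 1)⁻¹^2 ≤ ((2.7182818283:ℝ)⁻¹)^2 := by gcongr
      _ ≤ _ := by norm_num
  rw [Real.exp_neg, ← div_eq_mul_inv, div_le_iff₀ (Real.exp_pos _)]
  have h5 : y^2 = |y|^2 := (sq_abs y).symm
  have h6 := Real.exp_pos (0.39*|y|)
  have h7 : Real.exp (0.39*|y|) * Real.exp (-2) ≤ Real.exp (0.39*|y|) * 0.13534 := by gcongr
  rw [h3] at h2
  nlinarith

/-- quadratic decay -/
lemma GG_quad {H : ℝ} (hH0 : 0 ≤ H) {s : ℂ} (hs : -2 < s.re) {c : ℝ}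
    (hc : Real.Gamma (s.re/2+1) * 2^((s.re/2+1)/2) ≤ c) : ‖GG H s‖ ≤ 650 * c / (12.25 + s.im^2) := by
  have hc0 : 0 ≤ c := le_trans (by have := Real.Gamma_pos_of_pos (show 0 < s.re/2+1 by linarith); positivity) hc
  set t := s.im with ht
  set e : ℝ × ℝ → ℝ := fun p => Real.exp (-(0.39 * |t - p.1 - p.2|)) with he
  have ce : Continuous e := by rw [he]; fun_prop
  have cd : Continuous fun τ : ℝ => 1/(12.25 + τ^2) := by
    refine continuous_const.div (by fun_prop) fun τ => by positivity
  set B1 : ℝ × ℝ → ℝ := fun p => e p * (1/(12.25+p.2^2)) with hB1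
  set B2 : ℝ × ℝ → ℝ := fun p => e p * (1/(12.25+p.1^2)) with hB2
  set B3 : ℝ × ℝ → ℝ := fun p => 1/(12.25+p.1^2) * (1/(12.25+p.2^2)) with hB3
  have cB1 : Continuous B1 := ce.mul (cd.comp continuous_snd)
  have cB2 : Continuous B2 := ce.mul (cd.comp continuous_fst)
  have cB3 : Continuous B3 := (cd.comp continuous_fst).mul (cd.comp continuous_snd)
  have hb := GG_le hH0 hs (B := fun p => 3*37^2*c/(12.25+t^2) * (B1 p + B2 p + 3.57 * B3 p)) (by fun_prop) (fun p _ _ => by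
    have k1 := KK_bound p.1
    have k2 := KK_bound p.2
    have hre : (s/2 + 1 - I*(p.1+p.2)/2).re = s.re/2 + 1 := by simp
    have him : (s/2 + 1 - I*(p.1+p.2)/2).im = (t - p.1 - p.2)/2 := by simp [ht]; ring
    have hg := Gamma_quarter (s := s/2 + 1 - I*(p.1+p.2)/2) (by rw [hre]; linarith)
    rw [hre, him] at hg
    have hg2 : ‖Complex.Gamma (s/2 + 1 - I*(p.1+p.2)/2)‖ ≤ c * e p := by
      refine hg.trans ?_
      refine mul_le_mul hc ?_ (Real.exp_pos _).le hc0
      simp only [he]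
      rw [Real.exp_le_exp, abs_div, abs_two]
      have := Real.pi_gt_d2
      have h3 := abs_nonneg (t - p.1 - p.2)
      nlinarith
    have h1 : 0 < 12.25 + p.1^2 := by positivity
    have h2 : 0 < 12.25 + p.2^2 := by positivity
    have h3 : 0 < 12.25 + t^2 := by positivity
    have hep : 0 < e p := Real.exp_pos _
    calc _ ≤ 37/(12.25+p.1^2) * (37/(12.25+p.2^2)) * (c * e p) := by gcongr
      _ ≤ _ := by
        have h4 := sq_exp_le (t - p.1 - p.2)
        change (t-p.1-p.2)^2 * e p ≤ 3.57 at h4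
        have h5 : 12.25 + t^2 ≤ 3*(12.25+p.1^2) + 3*(12.25+p.2^2) + 3*(t-p.1-p.2)^2 := by
          nlinarith [sq_nonneg (p.1-p.2), sq_nonneg (p.1 - (t-p.1-p.2)), sq_nonneg (p.2 - (t-p.1-p.2))]
        have h6 : (12.25+t^2) * e p ≤ 3*((12.25+p.1^2)* e p + (12.25+p.2^2) * e p + 3.57) := by nlinarith
        have h7 : 37/(12.25+p.1^2) * (37/(12.25+p.2^2)) * (c * e p) = 37^2*c/((12.25+t^2)*(12.25+p.1^2)*(12.25+p.2^2)) * ((12.25+t^2) * e p) := by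
          field_simp
        have h8 : 3*37^2*c/(12.25+t^2) * (B1 p + B2 p + 3.57 * B3 p) = 37^2*c/((12.25+t^2)*(12.25+p.1^2)*(12.25+p.2^2)) * (3*((12.25+p.1^2)* e p + (12.25+p.2^2) * e p + 3.57)) := by
          simp only [hB1, hB2, hB3]; field_simp
        rw [h7, h8]
        gcongr)
  have i0 := nu_cauchy_le (H := H)
  have i1 : ∫ p, B1 p ∂((nu H).prod (nu H)) ≤ 5.13*0.898 := by
    rw [integral_prod_symm _ (cont_int cB1)]
    calc _ ≤ ∫ τ, 5.13 * (1/(12.25 + τ^2)) ∂(nu H) := by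
          refine integral_mono (cont_int cB1).integral_prod_right (cont_int1 (by fun_prop)) fun τ => ?_
          simp only [hB1, integral_mul_const]
          gcongr
          have := nu_exp_le (H := H) (t - τ)
          refine le_of_eq_of_le ?_ this
          congr 1; funext y; simp only [he]; ring_nf
      _ ≤ _ := by rw [integral_const_mul]; linarith
  have i2 : ∫ p, B2 p ∂((nu H).prod (nu H)) ≤ 5.13*0.898 := by
    rw [integral_prod _ (cont_int cB2)]
    calc _ ≤ ∫ τ, 5.13 * (1/(12.25 + τ^2)) ∂(nu H) := by
          refine integral_mono (cont_int cB2).integral_prod_left (cont_int1 (by fun_prop)) fun τ => ?_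
          simp only [hB2, integral_mul_const]
          gcongr
          exact nu_exp_le (H := H) (t - τ)
      _ ≤ _ := by rw [integral_const_mul]; linarith
  have i3 : ∫ p, B3 p ∂((nu H).prod (nu H)) ≤ 0.898*0.898 := by
    rw [hB3, integral_prod_mul (fun τ : ℝ => 1/(12.25 + τ^2)) (fun τ : ℝ => 1/(12.25 + τ^2))]
    have : 0 ≤ ∫ τ, 1/(12.25 + τ^2) ∂(nu H) := integral_nonneg fun τ => by positivity
    gcongr
  rw [integral_const_mul, integral_add (cont_int (f := fun p => B1 p + B2 p) (by fun_prop)) (cont_int (f := fun p => 3.57 * B3 p) (by fun_prop)), integral_add (cont_int cB1) (cont_int cB2), integral_const_mul] at hb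
  refine hb.trans ?_
  have hpi : 9.8595 ≤ Real.pi^2 := by nlinarith [Real.pi_gt_d2]
  calc _ ≤ 1/(8*9.8595) * (3*37^2*c/(12.25+t^2) * (5.13*0.898 + 5.13*0.898 + 3.57*(0.898*0.898))) := by gcongr
    _ = (3*37^2/(8*9.8595) * (5.13*0.898 + 5.13*0.898 + 3.57*(0.898*0.898))) * (c/(12.25+t^2)) := by ring
    _ ≤ 650 * (c/(12.25+t^2)) := by gcongr; norm_num
    _ = _ := by ring

end EP

open MeasureTheory Set
namespace EP
open Complex Metric Filter Topology

lemma GG_gen {H : ℝ} (hH0 : 0 ≤ H) : ∃ D : ℝ, 0 ≤ D ∧ ∀ s : ℂ, -1 ≤ s.re → s.re ≤ 4 →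
    ‖GG H s‖ ≤ D * Real.exp (-(0.39 * |s.im|)) := by
  have ck := KK_cont
  set A := ∫ p : ℝ × ℝ, ‖KK p.1‖ * ‖KK p.2‖ ∂((nu H).prod (nu H)) with hA
  refine ⟨1/(8*Real.pi^2) * (2 * 2^(3/2:ℝ) * Real.exp (0.39*(2*H)) * A), ?_, fun s h1 h2 => ?_⟩
  · have : 0 ≤ A := integral_nonneg fun p => by positivity
    positivity
  · have := GG_le hH0 (s := s) (by linarith) (B := fun p => (2 * 2^(3/2:ℝ) * Real.exp (0.39*(2*H)) * Real.exp (-(0.39 * |s.im|))) * (‖KK p.1‖ * ‖KK p.2‖)) (by fun_prop) (fun p p1 p2 => by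
      have hre : (s/2 + 1 - I*(p.1+p.2)/2).re = s.re/2 + 1 := by simp
      have him : (s/2 + 1 - I*(p.1+p.2)/2).im = (s.im - p.1 - p.2)/2 := by simp; ring
      have hg := Gamma_quarter (s := s/2 + 1 - I*(p.1+p.2)/2) (by rw [hre]; linarith)
      rw [hre, him] at hg
      rw [mul_comm]
      gcongr
      refine hg.trans ?_
      rw [mul_assoc (2 * 2^(3/2:ℝ)), ← Real.exp_add]
      gcongr
      · exact Gamma_le_two (by linarith) (by linarith)
      · norm_num
      · linarith
      · have h3 : |s.im| ≤ |s.im - p.1 - p.2| + 2*H := by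
          have q1 := abs_le.2 ⟨p1.1.le, p1.2⟩
          have q2 := abs_le.2 ⟨p2.1.le, p2.2⟩
          calc |s.im| = |(s.im - p.1 - p.2) + (p.1 + p.2)| := by ring_nf
            _ ≤ _ := abs_add_le _ _
            _ ≤ _ := by linarith [abs_add_le p.1 p.2]
        rw [abs_div, abs_two]
        have := Real.pi_gt_d2
        have h4 := abs_nonneg (s.im - p.1 - p.2)
        nlinarith)
    refine this.trans (le_of_eq ?_)
    rw [integral_const_mul, hA]; ring

lemma GG_conj (H : ℝ) (s : ℂ) : ‖GG H (starRingEnd ℂ s)‖ = ‖GG H s‖ := by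
  have : GG H (starRingEnd ℂ s) = starRingEnd ℂ (GG H s) := by
    rw [GG, GG, mellin, mellin, ← integral_conj]
    refine setIntegral_congr_fun measurableSet_Ioi fun t ht => ?_
    simp only [smul_eq_mul, map_mul, gg, Complex.conj_ofReal]
    congr 1
    have e : ∀ w : ℂ, (t:ℂ)^w = cexp (Real.log t * w) := fun w => by
      rw [Complex.cpow_def_of_ne_zero (by exact_mod_cast (ne_of_gt ht)), ← Complex.ofReal_log (le_of_lt ht)]
    rw [e, e, ← Complex.exp_conj]
    simp
  rw [this, Complex.norm_conj]

lemma nu_J {H : ℝ} (hH : 50 ≤ H) : ∫ τ, 37/(12.25+τ^2) * Real.exp (-(0.7*(H-τ))) ∂(nu H) ≤ 0.0562 := by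
  set γ : ℝ := 1/8.575 with hγ
  set β : ℝ := 2*γ/0.7 with hβ
  set α : ℝ := (1+β)/0.7 with hα
  have cd : Continuous fun τ : ℝ => 37/(12.25 + τ^2) := by
    refine continuous_const.div (by fun_prop) fun τ => by positivity
  have h1 : ∫ τ, (1 + (H-τ)^2/12.25) * Real.exp (-(0.7*(H-τ))) ∂(nu H) ≤ α := by
    unfold nu
    rw [← intervalIntegral.integral_of_le (by linarith)]
    rw [intervalIntegral.integral_eq_sub_of_hasDerivAt (f := fun τ => (α + β*(H-τ) + γ*(H-τ)^2) * Real.exp (-(0.7*(H-τ)))) (fun τ _ => ?_) (Continuous.intervalIntegrable (by fun_prop) _ _)]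
    · have : 0 ≤ (α + β*(H- -H) + γ*(H- -H)^2) * Real.exp (-(0.7*(H- -H))) := by
        have : 0 ≤ H - -H := by linarith
        positivity
      simp only [sub_self]; norm_num at *; linarith
    · have d0 : HasDerivAt (fun τ : ℝ => H - τ) (-1) τ := by simpa using (hasDerivAt_id τ).const_sub H
      have d1 : HasDerivAt (fun τ : ℝ => Real.exp (-(0.7*(H-τ)))) (Real.exp (-(0.7*(H-τ))) * 0.7) τ := by
        have := ((d0.const_mul (0.7:ℝ)).neg).exp
        refine this.congr_deriv ?_
        simp
      have d2 : HasDerivAt (fun τ : ℝ => α + β*(H-τ) + γ*(H-τ)^2) (β * (-1) + γ * (2*(H-τ)*(-1))) τ := by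
        have := ((d0.const_mul β).const_add α).add ((d0.pow 2).const_mul γ)
        refine this.congr_deriv ?_
        simp
      refine (d2.mul d1).congr_deriv ?_
      have a1 : 0.7*γ = 1/12.25 := by rw [hγ]; norm_num
      have a2 : 0.7*β = 2*γ := by rw [hβ]; ring
      have a3 : 0.7*α = 1 + β := by rw [hα]; ring
      linear_combination Real.exp (-(0.7*(H-τ))) * (a3 + (H-τ)*a2 + (H-τ)^2 * a1)
  calc _ ≤ ∫ τ, 74/2512.25 * ((1 + (H-τ)^2/12.25) * Real.exp (-(0.7*(H-τ)))) ∂(nu H) := by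
        refine integral_mono (cont_int1 (by fun_prop)) (cont_int1 (by fun_prop)) fun τ => ?_
        simp only
        rw [← mul_assoc]
        gcongr
        rw [div_le_iff₀ (by positivity)]
        have : 12.25 + H^2 ≤ 2*(1 + (H-τ)^2/12.25)*(12.25+τ^2) := by
          have : 2*(1 + (H-τ)^2/12.25)*(12.25+τ^2) - (12.25 + H^2) = 12.25 + (H - 2*τ)^2 + 2*(H-τ)^2*τ^2/12.25 := by ring
          have : 0 ≤ 12.25 + (H - 2*τ)^2 + 2*(H-τ)^2*τ^2/12.25 := by positivity
          linarith
        nlinarith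
    _ ≤ 74/2512.25 * α := by rw [integral_const_mul]; gcongr
    _ ≤ _ := by rw [hα, hβ, hγ]; norm_num

lemma GG_exp_pos {H : ℝ} (hH : 50 ≤ H) {s : ℂ} (h1 : -(1/2) ≤ s.re) (h2 : s.re ≤ 3/2) {v : ℝ} (hv : 49.5 ≤ v)
    (ht : 2*H + v ≤ s.im) : ‖GG H s‖ ≤ 1.17e-4 * v^(7/4:ℝ) * Real.exp (-(Real.pi/4*v)) := by
  have hp3 := Real.pi_gt_d4
  have hp4 := Real.pi_lt_d4
  have hv4 : 4/v ≤ 0.0809 := by rw [div_le_iff₀ (by linarith)]; linarith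
  have hv0 : 0 < 4/v := by positivity
  set θ := Real.pi/2 - 4/v with hθ
  set C := 2 * (Real.pi*v/8)^(7/4:ℝ) * Real.exp (2 - Real.pi/4*v) with hC
  have cd : Continuous fun τ : ℝ => 37/(12.25 + τ^2) := by
    refine continuous_const.div (by fun_prop) fun τ => by positivity
  set j : ℝ → ℝ := fun τ => 37/(12.25+τ^2) * Real.exp (-(0.7*(H-τ))) with hj
  have cj : Continuous j := cd.mul (by fun_prop)
  have hb := GG_le (H := H) (by linarith) (s := s) (by linarith) (B := fun p => C * (j p.1 * j p.2)) (by fun_prop) (fun p p1 p2 => by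
    have hre : (s/2 + 1 - I*(p.1+p.2)/2).re = s.re/2 + 1 := by simp
    have him : (s/2 + 1 - I*(p.1+p.2)/2).im = (s.im - p.1 - p.2)/2 := by simp; ring
    have hg := Gamma_ray (s := s/2 + 1 - I*(p.1+p.2)/2) (θ := θ) (by rw [hre]; linarith) (by rw [hθ]; linarith) (by rw [hθ]; linarith)
    rw [hre, him] at hg
    have k1 := KK_bound p.1
    have k2 := KK_bound p.2
    have hcos : 8/(Real.pi*v) ≤ Real.cos θ := by
      rw [hθ, Real.cos_pi_div_two_sub]
      have := Real.mul_le_sin hv0.le (by linarith)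
      refine le_of_eq_of_le ?_ this
      field_simp; norm_num
    have hg2 : ‖Complex.Gamma (s/2 + 1 - I*(p.1+p.2)/2)‖ ≤ 2 * (Real.pi*v/8)^(7/4:ℝ) * Real.exp (2 - Real.pi/4*v - 0.7*(H-p.1) - 0.7*(H-p.2)) := by
      refine hg.trans ?_
      have hcos0 : 0 ≤ (Real.cos θ)^(-(s.re/2+1)) := Real.rpow_nonneg (le_trans (by positivity) hcos) _
      gcongr
      · exact Gamma_le_two (by linarith) (by linarith)
      · have hb1 : 1 ≤ Real.pi*v/8 := by nlinarith
        calc (Real.cos θ)^(-(s.re/2+1)) ≤ (8/(Real.pi*v))^(-(s.re/2+1)) :=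
              Real.rpow_le_rpow_of_nonpos (by positivity) hcos (by linarith)
          _ = (Real.pi*v/8)^(s.re/2+1) := by
              rw [Real.rpow_neg (by positivity), ← Real.inv_rpow (by positivity), inv_div]
          _ ≤ _ := Real.rpow_le_rpow_of_exponent_le hb1 (by linarith)
      · rw [abs_of_nonneg (by linarith [p1.2, p2.2])]
        have q1 := p1.2
        have q2 := p2.2
        have hθ4 : 1.4 ≤ θ := by rw [hθ]; linarith
        have e1 : θ * v = Real.pi/2*v - 4 := by rw [hθ]; field_simp
        have e2 : s.im - p.1 - p.2 ≥ v + (H - p.1) + (H - p.2) := by linarith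
        nlinarith
    calc _ ≤ 37/(12.25+p.1^2) * (37/(12.25+p.2^2)) * (2 * (Real.pi*v/8)^(7/4:ℝ) * Real.exp (2 - Real.pi/4*v - 0.7*(H-p.1) - 0.7*(H-p.2))) := by gcongr
      _ = _ := by
        rw [show 2 - Real.pi/4*v - 0.7*(H-p.1) - 0.7*(H-p.2) = (2 - Real.pi/4*v) + (-(0.7*(H-p.1))) + (-(0.7*(H-p.2))) by ring, Real.exp_add, Real.exp_add]
        simp only [hC, hj]; ring)
  have hJ : ∫ τ, j τ ∂(nu H) ≤ 0.0562 := nu_J hH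
  have hJ0 : 0 ≤ ∫ τ, j τ ∂(nu H) := integral_nonneg fun τ => by positivity
  rw [integral_const_mul, integral_prod_mul j j] at hb
  refine hb.trans ?_
  have e1 : C = 2 * (Real.pi/8)^(7/4:ℝ) * Real.exp 2 * (v^(7/4:ℝ) * Real.exp (-(Real.pi/4*v))) := by
    rw [hC, show Real.pi*v/8 = Real.pi/8*v by ring, Real.mul_rpow (by positivity) (by linarith), show 2 - Real.pi/4*v = 2 + -(Real.pi/4*v) by ring, Real.exp_add]; ring
  have e2 : Real.exp 2 ≤ 7.39 := by
    have : Real.exp 2 = (Real.exp 1)^2 := by rw [← Real.exp_nat_mul]; norm_num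
    rw [this]
    calc (Real.exp 1)^2 ≤ (2.7182818286:ℝ)^2 := by gcongr; exact Real.exp_one_lt_d9.le
      _ ≤ _ := by norm_num
  have e3 : (Real.pi/8)^(7/4:ℝ) ≤ 0.1951 := by
    have h0 : (Real.pi/8)^(7/4:ℝ) ≤ (0.3927:ℝ)^(7/4:ℝ) := by gcongr; linarith
    refine h0.trans ?_
    have : (0.3927:ℝ)^(7/4:ℝ) = ((0.3927:ℝ)^(7:ℕ))^(1/4:ℝ) := by
      rw [← Real.rpow_natCast, ← Real.rpow_mul (by norm_num)]; norm_num
    rw [this]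
    calc ((0.3927:ℝ)^(7:ℕ))^(1/4:ℝ) ≤ ((0.1951:ℝ)^(4:ℕ))^(1/4:ℝ) := by gcongr; norm_num
      _ = 0.1951 := by rw [← Real.rpow_natCast, ← Real.rpow_mul (by norm_num)]; norm_num
  have hpi : 9.869 ≤ Real.pi^2 := by nlinarith
  have hw : 0 ≤ v^(7/4:ℝ) * Real.exp (-(Real.pi/4*v)) := by positivity
  calc 1/(8*Real.pi^2) * (C * ((∫ τ, j τ ∂(nu H)) * ∫ τ, j τ ∂(nu H))) ≤ 1/(8*9.869) * ((2 * 0.1951 * 7.39 * (v^(7/4:ℝ) * Real.exp (-(Real.pi/4*v)))) * (0.0562*0.0562)) := by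
        rw [e1]; gcongr
    _ = (1/(8*9.869) * (2 * 0.1951 * 7.39) * (0.0562*0.0562)) * (v^(7/4:ℝ) * Real.exp (-(Real.pi/4*v))) := by ring
    _ ≤ 1.17e-4 * (v^(7/4:ℝ) * Real.exp (-(Real.pi/4*v))) := by gcongr; norm_num
    _ = _ := by ring

lemma GG_exp {H : ℝ} (hH : 50 ≤ H) {s : ℂ} (h1 : -(1/2) ≤ s.re) (h2 : s.re ≤ 3/2) {v : ℝ} (hv : 49.5 ≤ v)
    (ht : 2*H + v ≤ |s.im|) : ‖GG H s‖ ≤ 1.17e-4 * v^(7/4:ℝ) * Real.exp (-(Real.pi/4*v)) := by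
  rcases le_total 0 s.im with h | h
  · rw [abs_of_nonneg h] at ht; exact GG_exp_pos hH h1 h2 hv ht
  · rw [abs_of_nonpos h] at ht; rw [← GG_conj]; exact GG_exp_pos hH (by simpa using h1) (by simpa using h2) hv (by simpa using ht)

end EP

open MeasureTheory Set
namespace EP
open Complex Metric Filter Topology

lemma gg_bd {H : ℝ} (hH0 : 0 ≤ H) : ∃ B : ℝ, 0 ≤ B ∧ ∀ t : ℝ, 0 < t → ‖gg H t‖ ≤ B * (t^2 * Real.exp (-t^2)) := by
  refine ⟨‖(1/(4*(Real.pi:ℂ)^2))‖ * ∫ p : ℝ × ℝ, ‖KK p.1‖ * ‖KK p.2‖ ∂((nu H).prod (nu H)), by positivity, fun t ht => ?_⟩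
  rw [gg_eq hH0 ht, norm_mul, mul_assoc, ← integral_mul_const]
  gcongr
  have ck := KK_cont
  refine norm_integral_le_of_norm_le (cont_int (by fun_prop)) (Eventually.of_forall fun p => ?_)
  rw [norm_mul, norm_mul, norm_mul, norm_cpow_eq_rpow_re_of_pos ht, Complex.norm_exp]
  refine le_of_eq ?_
  have : (-(t:ℂ)^2).re = -t^2 := by rw [← Complex.ofReal_pow, ← Complex.ofReal_neg, Complex.ofReal_re]
  rw [this]
  simp

lemma gg_cont {H : ℝ} (hH0 : 0 ≤ H) : ContinuousOn (gg H) (Ioi 0) := by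
  have ck := KK_cont
  have h1 : ContinuousOn (fun t : ℝ => ∫ τ in Ioc (-H) H, KK τ * (t:ℂ)^(-(I*(τ:ℂ)))) (Ioi 0) := by
    refine continuousOn_of_dominated (bound := fun τ => ‖KK τ‖) (fun t ht => ?_) (fun t ht => ?_) (KK_int H).norm (Eventually.of_forall fun τ => ?_)
    · refine Measurable.aestronglyMeasurable ?_
      have := ck.measurable
      fun_prop
    · refine Eventually.of_forall fun τ => ?_
      rw [norm_mul, norm_cpow_eq_rpow_re_of_pos ht]; simp
    · refine ContinuousOn.mul continuousOn_const ?_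
      refine ContinuousOn.cpow Complex.continuous_ofReal.continuousOn continuousOn_const fun t ht => ?_
      exact Or.inl (by simpa using ht)
  have h2 : ContinuousOn (fun t => (hH H t : ℂ)) (Ioi 0) :=
    (continuousOn_const.mul h1).congr fun t ht => hH_eq hH0 ht
  have h3 : gg H = fun t => ((hH H t : ℂ) * ((t * Real.exp (-t^2/2) : ℝ):ℂ))^2 := by
    funext t; simp [gg, etaPlus]
  rw [h3]
  refine (h2.mul (Continuous.continuousOn ?_)).pow 2
  fun_prop

lemma gg_top {H : ℝ} (hH0 : 0 ≤ H) (a : ℝ) : gg H =O[atTop] (· ^ (-a) : ℝ → ℝ) := by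
  obtain ⟨B, hB, h⟩ := gg_bd hH0
  have h1 : gg H =O[atTop] fun t : ℝ => Real.exp (-(1/2) * t) := by
    refine Asymptotics.IsBigO.of_bound (B * 4) ?_
    filter_upwards [eventually_ge_atTop 1] with t ht
    refine (h t (by linarith)).trans ?_
    rw [Real.norm_of_nonneg (Real.exp_pos _).le, mul_assoc]
    refine mul_le_mul_of_nonneg_left ?_ hB
    have e1 : t^2 ≤ 4 * Real.exp (t^2/2) := by
      have := Real.add_one_le_exp (t^2/2); nlinarith
    calc t^2 * Real.exp (-t^2) ≤ 4 * Real.exp (t^2/2) * Real.exp (-t^2) := by gcongr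
      _ = 4 * Real.exp (-(t^2/2)) := by rw [mul_assoc, ← Real.exp_add]; congr 2; ring
      _ ≤ _ := by gcongr; nlinarith
  exact h1.trans (isLittleO_exp_neg_mul_rpow_atTop (by norm_num) _).isBigO

lemma gg_bot {H : ℝ} (hH0 : 0 ≤ H) : gg H =O[𝓝[>] 0] (· ^ (-(-2:ℝ)) : ℝ → ℝ) := by
  obtain ⟨B, hB, h⟩ := gg_bd hH0
  refine Asymptotics.IsBigO.of_bound B ?_
  filter_upwards [self_mem_nhdsWithin] with t ht
  refine (h t ht).trans ?_
  have ht' : (0:ℝ) < t := ht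
  gcongr
  rw [neg_neg, Real.norm_of_nonneg (by positivity)]
  have : t^(2:ℝ) = t^2 := by exact_mod_cast Real.rpow_natCast t 2
  rw [this]
  have : Real.exp (-t^2) ≤ 1 := by rw [Real.exp_le_one_iff]; nlinarith
  nlinarith [sq_nonneg t]

lemma gg_deriv {H : ℝ} (hH0 : 0 ≤ H) {s : ℂ} (hs : -2 < s.re) :
    MellinConvergent (fun t => Real.log t • gg H t) s ∧ HasDerivAt (GG H) (mellin (fun t => Real.log t • gg H t) s) s :=
  mellin_hasDerivAt_of_isBigO_rpow ((gg_cont hH0).locallyIntegrableOn measurableSet_Ioi) (gg_top hH0 (s.re+1)) (by linarith) (gg_bot hH0) hs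

noncomputable def PH (H x : ℝ) (s : ℂ) : ℂ := Real.log x * GG H s + deriv (GG H) s

noncomputable def psi (H x u : ℝ) : ℂ := (Real.log x + Real.log (x⁻¹*u) : ℝ) • gg H (x⁻¹*u)

lemma psi_eq {H x u : ℝ} (hx : 0 < x) (hu : 0 < u) : psi H x u = ((Real.log u * (etaPlus H (u/x))^2 : ℝ) : ℂ) := by
  rw [psi, ← Real.log_mul hx.ne' (by positivity), mul_inv_cancel_left₀ hx.ne', gg, show x⁻¹*u = u/x by ring]
  simp

lemma psi_cont {H x : ℝ} (hH0 : 0 ≤ H) (hx : 0 < x) : ContinuousOn (psi H x) (Ioi 0) := by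
  have hm : MapsTo (fun u : ℝ => x⁻¹*u) (Ioi 0) (Ioi 0) := fun u hu => by
    have : 0 < u := hu
    exact mul_pos (inv_pos.2 hx) this
  unfold psi
  refine ContinuousOn.smul (f := fun u : ℝ => (Real.log x + Real.log (x⁻¹*u) : ℝ)) ?_ ((gg_cont hH0).comp (by fun_prop) hm)
  refine continuousOn_const.add ?_
  exact ContinuousOn.log (by fun_prop) fun u hu => (ne_of_gt (hm hu))

lemma psi_mellin {H x : ℝ} (hH0 : 0 ≤ H) (hx : 0 < x) {s : ℂ} (hs : -2 < s.re) :
    HasMellin (psi H x) s ((x:ℂ)^s * PH H x s) := by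
  obtain ⟨h1, h2⟩ := gg_deriv hH0 hs
  have h3 := (GG_eq hH0 hs).1.const_smul (Real.log x)
  have h4 := hasMellin_add h3 h1
  have hf : psi H x = fun u => (fun t => Real.log x • gg H t + Real.log t • gg H t) (x⁻¹*u) := by
    funext u; simp only [psi, add_smul]
  rw [hf]
  constructor
  · exact (MellinConvergent.comp_mul_left (f := fun t => Real.log x • gg H t + Real.log t • gg H t) (inv_pos.2 hx)).2 h4.1
  · rw [mellin_comp_mul_left (fun t => Real.log x • gg H t + Real.log t • gg H t) s (inv_pos.2 hx), h4.2, smul_eq_mul, PH, h2.deriv, mellin_const_smul]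
    congr 1
    rw [Complex.ofReal_inv, Complex.inv_cpow _ _ (by rw [Complex.arg_ofReal_of_nonneg hx.le]; exact Real.pi_pos.ne), Complex.cpow_neg, inv_inv]

lemma PH_le {H x : ℝ} (hH0 : 0 ≤ H) {s : ℂ} (hs : -1 ≤ s.re) (hL : 0 ≤ Real.log x) {A B : ℝ} (hA : ‖GG H s‖ ≤ A)
    (hB : ∀ z : ℂ, |z.re - s.re| ≤ 1/2 → |z.im - s.im| ≤ 1/2 → ‖GG H z‖ ≤ B) :
    ‖PH H x s‖ ≤ Real.log x * A + 2*B := by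
  have h1 : ‖deriv (GG H) s‖ ≤ B/(1/2) := by
    refine norm_deriv_le_of_forall_mem_sphere_norm_le (by norm_num) ?_ fun z hz => ?_
    · refine DifferentiableOn.diffContOnCl fun z hz => ?_
      rw [closure_ball _ (by norm_num), mem_closedBall, dist_eq] at hz
      have := (abs_re_le_norm (z - s)).trans hz
      rw [sub_re] at this
      exact ((gg_deriv hH0 (by linarith [(abs_le.1 this).1])).2.differentiableAt).differentiableWithinAt
    · rw [mem_sphere, dist_eq] at hz
      exact hB z (by simpa using (abs_re_le_norm (z-s)).trans hz.le) (by simpa using (abs_im_le_norm (z-s)).trans hz.le)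
  rw [PH]
  refine (norm_add_le _ _).trans ?_
  rw [norm_mul, Complex.norm_real, Real.norm_of_nonneg hL]
  have : Real.log x * ‖GG H s‖ ≤ Real.log x * A := by gcongr
  linarith

lemma log_x_ge {x : ℝ} (hx : (10:ℝ)^8 ≤ x) : 18.4 ≤ Real.log x := by
  have h1 : Real.log ((10:ℝ)^8) ≤ Real.log x := Real.log_le_log (by norm_num) hx
  have h2 : Real.log ((10:ℝ)^8) = 8 * Real.log 10 := by rw [Real.log_pow]; norm_num
  have h3 : 2.3 ≤ Real.log 10 := by
    rw [Real.le_log_iff_exp_le (by norm_num)]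
    have : Real.exp 2.3 = (Real.exp 1)^(23/10:ℝ) := by rw [← Real.exp_mul]; norm_num
    rw [this]
    calc (Real.exp 1)^(23/10:ℝ) ≤ (2.7182818286:ℝ)^(23/10:ℝ) := by gcongr; exact Real.exp_one_lt_d9.le
      _ = ((2.7182818286:ℝ)^(23:ℕ))^(1/10:ℝ) := by rw [← Real.rpow_natCast, ← Real.rpow_mul (by norm_num)]; norm_num
      _ ≤ ((10:ℝ)^(10:ℕ))^(1/10:ℝ) := by gcongr; norm_num
      _ = 10 := by rw [← Real.rpow_natCast, ← Real.rpow_mul (by norm_num)]; norm_num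
  linarith

lemma PH_quad {H x : ℝ} (hH0 : 0 ≤ H) (hL : 18.4 ≤ Real.log x) {s : ℂ} (hs : -1 ≤ s.re) {c : ℝ}
    (hc : ∀ σ : ℝ, |σ - s.re| ≤ 1/2 → Real.Gamma (σ/2+1) * 2^((σ/2+1)/2) ≤ c) :
    ‖PH H x s‖ ≤ 740 * c * Real.log x / (12.25 + s.im^2) := by
  have c0 := hc s.re (by norm_num)
  have hc0 : 0 ≤ c := le_trans (by have := Real.Gamma_pos_of_pos (show 0 < s.re/2+1 by linarith); positivity) c0
  have h := PH_le (x := x) hH0 hs (by linarith) (GG_quad hH0 (by linarith) c0) (B := 1.16 * (650*c/(12.25+s.im^2))) (fun z h1 h2 => by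
    refine (GG_quad hH0 (by linarith [(abs_le.1 h1).1]) (hc z.re h1)).trans ?_
    rw [← mul_div_assoc, div_le_div_iff₀ (by positivity) (by positivity)]
    obtain ⟨h3, h4⟩ := abs_le.1 h2
    have h5 : 12.25 + s.im^2 ≤ 1.16*(12.25 + z.im^2) := by nlinarith [sq_nonneg (z.im - 3), sq_nonneg (z.im + 3), mul_nonneg (sub_nonneg.2 h4) (by linarith : 0 ≤ z.im - s.im + 1/2), abs_nonneg z.im, sq_nonneg (s.im - 3.5), sq_nonneg (s.im+3.5)]
    nlinarith)
  refine h.trans ?_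
  have : 0 ≤ 650*c/(12.25+s.im^2) := by positivity
  have e : 740 * c * Real.log x / (12.25 + s.im^2) = 740/650 * Real.log x * (650*c/(12.25+s.im^2)) := by ring
  rw [e]
  nlinarith

lemma PH_half {H x : ℝ} (hH0 : 0 ≤ H) (hL : 18.4 ≤ Real.log x) {s : ℂ} (hs : s.re = 1/2) :
    ‖PH H x s‖ ≤ 1251 * Real.log x / (12.25 + s.im^2) := by
  have := PH_quad (x := x) hH0 hL (s := s) (c := 1.69) (by rw [hs]; norm_num) (fun σ hσ => by
    rw [hs] at hσ
    obtain ⟨h1, h2⟩ := abs_le.1 hσ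
    have g1 := Gamma_le_one (a := σ/2+1) (by linarith) (by linarith)
    have g2 : (2:ℝ)^((σ/2+1)/2) ≤ 1.69 := by
      calc (2:ℝ)^((σ/2+1)/2) ≤ 2^(3/4:ℝ) := Real.rpow_le_rpow_of_exponent_le (by norm_num) (by linarith)
        _ = ((2:ℝ)^(3:ℕ))^(1/4:ℝ) := by rw [← Real.rpow_natCast, ← Real.rpow_mul (by norm_num)]; norm_num
        _ ≤ ((1.69:ℝ)^(4:ℕ))^(1/4:ℝ) := by gcongr; norm_num
        _ = 1.69 := by rw [← Real.rpow_natCast, ← Real.rpow_mul (by norm_num)]; norm_num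
    have : (0:ℝ) ≤ 2^((σ/2+1)/2) := by positivity
    nlinarith)
  refine this.trans ?_
  gcongr
  norm_num

lemma PH_left {H x : ℝ} (hH0 : 0 ≤ H) (hL : 18.4 ≤ Real.log x) {s : ℂ} (hs : s.re = -1/2) :
    ‖PH H x s‖ ≤ 2220 * Real.log x / (12.25 + s.im^2) := by
  have := PH_quad (x := x) hH0 hL (s := s) (c := 3) (by rw [hs]; norm_num) (fun σ hσ => by
    rw [hs] at hσ
    obtain ⟨h1, h2⟩ := abs_le.1 hσ
    have g1 := Gamma_le_two (a := σ/2+1) (by linarith) (by linarith)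
    have g2 : (2:ℝ)^((σ/2+1)/2) ≤ 1.5 := by
      calc (2:ℝ)^((σ/2+1)/2) ≤ 2^(1/2:ℝ) := Real.rpow_le_rpow_of_exponent_le (by norm_num) (by linarith)
        _ ≤ ((1.5:ℝ)^(2:ℕ))^(1/2:ℝ) := by gcongr; norm_num
        _ = 1.5 := by rw [← Real.rpow_natCast, ← Real.rpow_mul (by norm_num)]; norm_num
    have : (0:ℝ) ≤ 2^((σ/2+1)/2) := by positivity
    nlinarith)
  refine this.trans ?_
  gcongr
  norm_num

lemma PH_high {H x : ℝ} (hH : 50 ≤ H) (hL : 18.4 ≤ Real.log x) {s : ℂ} (h1 : 0 ≤ s.re) (h2 : s.re ≤ 1) {v : ℝ} (hv : 50 ≤ v)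
    (ht : 2*H + v ≤ |s.im|) : ‖PH H x s‖ ≤ 1.4e-4 * v^(7/4:ℝ) * Real.exp (-(Real.pi/4*v)) * Real.log x := by
  have h := PH_le (x := x) (by linarith : 0 ≤ H) (s := s) (by linarith) (by linarith) (GG_exp hH (by linarith) (by linarith) (by linarith) ht)
    (B := 1.49 * (1.17e-4 * v^(7/4:ℝ) * Real.exp (-(Real.pi/4*v)))) (fun z z1 z2 => by
      obtain ⟨a1, a2⟩ := abs_le.1 z1
      have a3 : |s.im| ≤ |z.im| + 1/2 := by
        have := abs_sub_abs_le_abs_sub s.im z.im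
        rw [abs_sub_comm] at z2; linarith
      refine (GG_exp hH (v := v - 1/2) (by linarith) (by linarith) (by norm_num at *; linarith) (by linarith)).trans ?_
      have e1 : Real.exp (-(Real.pi/4*(v-1/2))) = Real.exp (Real.pi/8) * Real.exp (-(Real.pi/4*v)) := by rw [← Real.exp_add]; congr 1; ring
      have e2 : Real.exp (Real.pi/8) ≤ 1.49 := by
        have p := Real.pi_lt_d2
        have : Real.exp (Real.pi/8) ≤ Real.exp (0.394) := by gcongr; linarith
        have h5 : Real.exp (0.394/4) ≤ 1.104 := by
          have := Real.exp_bound' (x := 0.394/4) (by norm_num) (by norm_num) (n := 4) (by norm_num)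
          refine this.trans ?_
          norm_num [Finset.sum_range_succ, Nat.factorial]
        have h6 : Real.exp 0.394 = Real.exp (0.394/4)^4 := by rw [← Real.exp_nat_mul]; norm_num
        rw [h6] at this
        refine this.trans ?_
        calc Real.exp (0.394/4)^4 ≤ 1.104^4 := by gcongr
          _ ≤ 1.49 := by norm_num
      have e3 : (v-1/2)^(7/4:ℝ) ≤ v^(7/4:ℝ) := Real.rpow_le_rpow (by linarith) (by linarith) (by norm_num)
      rw [e1]
      calc 1.17e-4 * (v-1/2)^(7/4:ℝ) * (Real.exp (Real.pi/8) * Real.exp (-(Real.pi/4*v))) ≤ 1.17e-4 * v^(7/4:ℝ) * (1.49 * Real.exp (-(Real.pi/4*v))) := by gcongr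
        _ = _ := by ring)
  refine h.trans ?_
  have : 0 ≤ v^(7/4:ℝ) * Real.exp (-(Real.pi/4*v)) := by positivity
  nlinarith

lemma PH_gen {H x : ℝ} (hH0 : 0 ≤ H) (hL : 0 ≤ Real.log x) : ∃ D : ℝ, 0 ≤ D ∧ ∀ s : ℂ, -(1/2) ≤ s.re → s.re ≤ 7/2 →
    ‖PH H x s‖ ≤ D * Real.exp (-(0.39 * |s.im|)) := by
  obtain ⟨D, hD, h⟩ := GG_gen hH0
  refine ⟨Real.log x * D + 2 * (D * Real.exp 1), by positivity, fun s h1 h2 => ?_⟩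
  have := PH_le (x := x) hH0 (s := s) (by linarith) hL (h s (by linarith) (by linarith)) (B := D * Real.exp 1 * Real.exp (-(0.39 * |s.im|))) (fun z z1 z2 => by
      obtain ⟨a1, a2⟩ := abs_le.1 z1
      have a3 : |s.im| ≤ |z.im| + 1/2 := by
        have := abs_sub_abs_le_abs_sub s.im z.im
        rw [abs_sub_comm] at z2; linarith
      refine (h z (by linarith) (by linarith)).trans ?_
      rw [mul_assoc, ← Real.exp_add]
      gcongr
      linarith)
  refine this.trans (le_of_eq ?_)
  ring

end EP

open MeasureTheory Set
namespace EP
open Complex Metric Filter Topology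

structure KP (ψ : ℝ → ℂ) (F : ℂ → ℂ) (D : ℝ) : Prop where
  mel : ∀ s : ℂ, -2 < s.re → HasMellin ψ s (F s)
  cts : ∀ c : ℝ, -2 < c → Continuous (fun y : ℝ => F (c + y * I))
  bd : ∀ s : ℂ, (-(1/2) ≤ s.re) → s.re ≤ 2 → ‖F s‖ ≤ D * Real.exp (-(0.39 * |s.im|))
  psi : ContinuousOn ψ (Ioi 0)

lemma wint (m : ℕ) : Integrable (fun y : ℝ => Real.exp (-(0.39 * |y|)) * (1+|y|)^m) := by
  have h := ((int_exp_abs (q := 0.29) (by norm_num) 0).1).const_mul ((m.factorial:ℝ) * 10^m * Real.exp 0.1)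
  refine h.mono' (by fun_prop) (Eventually.of_forall fun y => ?_)
  rw [Real.norm_of_nonneg (by positivity), zero_sub, abs_neg]
  have h1 := Real.pow_div_factorial_le_exp (x := 0.1*(1+|y|)) (by positivity) m
  rw [div_le_iff₀ (by positivity), mul_pow] at h1
  have h2 : (1+|y|)^m ≤ (m.factorial:ℝ) * 10^m * Real.exp (0.1*(1+|y|)) := by
    have : (1+|y|)^m = 10^m * (0.1^m * (1+|y|)^m) := by rw [← mul_assoc, ← mul_pow]; norm_num
    rw [this]
    calc _ ≤ 10^m * (Real.exp (0.1*(1+|y|)) * (m.factorial:ℝ)) := by gcongr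
      _ = _ := by ring
  calc _ ≤ Real.exp (-(0.39 * |y|)) * ((m.factorial:ℝ) * 10^m * Real.exp (0.1*(1+|y|))) := by gcongr
    _ = (m.factorial:ℝ) * 10^m * (Real.exp (-(0.39 * |y|)) * Real.exp (0.1*(1+|y|))) := by ring
    _ = (m.factorial:ℝ) * 10^m * (Real.exp 0.1 * Real.exp (-(0.29 * |y|))) := by
      rw [← Real.exp_add, ← Real.exp_add]; congr 2; ring
    _ = _ := by ring

variable {ψ : ℝ → ℂ} {F : ℂ → ℂ} {D : ℝ}

lemma ln_re (c y : ℝ) : ((c:ℂ) + y * I).re = c := by simp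
lemma ln_im (c y : ℝ) : ((c:ℂ) + y * I).im = y := by simp

lemma KP.bdl (h : KP ψ F D) {c : ℝ} (h1 : -(1/2) ≤ c) (h2 : c ≤ 2) (y : ℝ) : ‖F (c + y*I)‖ ≤ D * Real.exp (-(0.39 * |y|)) := by
  have := h.bd (c + y*I) (by rwa [ln_re]) (by rwa [ln_re])
  rwa [ln_im] at this

lemma KP.D0 (h : KP ψ F D) : 0 ≤ D := by
  have := (norm_nonneg _).trans (h.bdl (c := 0) (by norm_num) (by norm_num) 0)
  simpa using this

/-- integrability of F times a polynomially bounded kernel -/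
lemma KP.int (h : KP ψ F D) {c : ℝ} (h1 : -(1/2) ≤ c) (h2 : c ≤ 2) {k : ℝ → ℂ} (hk : AEStronglyMeasurable k volume) {C : ℝ} (m : ℕ) (hb : ∀ y, ‖k y‖ ≤ C * (1+|y|)^m) :
    Integrable (fun y : ℝ => F (c + y*I) * k y) := by
  refine ((wint m).const_mul (D*C)).mono' (((h.cts c (by linarith)).aestronglyMeasurable).mul hk) (Eventually.of_forall fun y => ?_)
  rw [norm_mul]
  have := h.D0
  calc _ ≤ (D * Real.exp (-(0.39 * |y|))) * (C * (1+|y|)^m) := by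
        gcongr
        · exact h.bdl h1 h2 y
        · exact hb y
    _ = _ := by ring

lemma KP.int1 (h : KP ψ F D) {c : ℝ} (h1 : -(1/2) ≤ c) (h2 : c ≤ 2) : Integrable (fun y : ℝ => F (c + y*I)) := by
  simpa using h.int h1 h2 (k := fun _ => 1) aestronglyMeasurable_const (C := 1) 0 (by simp)

lemma KP.inv (h : KP ψ F D) {c : ℝ} (h1 : -(1/2) ≤ c) (h2 : c ≤ 2) {u : ℝ} (hu : 0 < u) :
    ∫ y : ℝ, (u:ℂ)^(-((c:ℂ) + y*I)) * F (c + y*I) = 2 * Real.pi * ψ u := by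
  have hm : ∀ y : ℝ, mellin ψ (c + y*I) = F (c + y*I) := fun y => (h.mel _ (by rw [ln_re]; linarith)).2
  have h3 := mellinInv_mellin_eq c ψ hu (h.mel c (by simp; linarith)).1 (by
    unfold Complex.VerticalIntegrable
    simp_rw [hm]
    exact h.int1 h1 h2) (h.psi.continuousAt (Ioi_mem_nhds hu))
  rw [mellinInv] at h3
  simp_rw [hm, smul_eq_mul] at h3
  rw [← h3, Complex.real_smul]
  push_cast
  have : (Real.pi:ℂ) ≠ 0 := by exact_mod_cast Real.pi_ne_zero
  rw [← mul_assoc, mul_one_div_cancel (by simpa using this), one_mul]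

lemma KP.ker (h : KP ψ F D) {c : ℝ} (h1 : -(1/2) ≤ c) (h2 : c ≤ 2) {p : ℂ} {A : Set ℝ} (hA : MeasurableSet A) (hA0 : A ⊆ Ioi 0)
    (hi : IntegrableOn (fun u : ℝ => u^(p.re - c - 1)) A) (κ : ℂ)
    (hκ : ∀ s : ℂ, s.re = c → ∫ u in A, (u:ℂ)^(p - s - 1) = κ / (s - p)) :
    κ * ∫ y : ℝ, F (c + y*I) * (1 / (c + y*I - p)) = 2 * Real.pi * ∫ u in A, (u:ℂ)^(p-1) * ψ u := by
  have e1 : ∀ y : ℝ, F (c + y*I) * (κ / (c + y*I - p)) = ∫ u in A, F (c+y*I) * (u:ℂ)^(p - (c+y*I) - 1) := fun y => by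
    rw [integral_const_mul, hκ _ (ln_re c y)]
  have e2 : κ * ∫ y : ℝ, F (c + y*I) * (1 / (c + y*I - p)) = ∫ y : ℝ, ∫ u in A, F (c+y*I) * (u:ℂ)^(p - (c+y*I) - 1) := by
    rw [← integral_const_mul]
    refine integral_congr_ae (Eventually.of_forall fun y => ?_)
    simp only
    rw [← e1]; ring
  rw [e2, integral_integral_swap, ← integral_const_mul]
  · refine setIntegral_congr_fun hA fun u hu => ?_
    have hu0 : (0:ℝ) < u := hA0 hu
    have hu1 : (u:ℂ) ≠ 0 := by exact_mod_cast hu0.ne'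
    rw [mul_left_comm, ← h.inv h1 h2 hu0, ← integral_const_mul]
    refine integral_congr_ae (Eventually.of_forall fun y => ?_)
    simp only
    rw [show p - (c+y*I) - 1 = (p-1) + (-((c:ℂ)+y*I)) by ring, cpow_add _ _ hu1]
    ring
  · have hp := (h.int1 h1 h2).norm.mul_prod hi
    refine hp.mono' ?_ ?_
    · refine Measurable.aestronglyMeasurable ?_
      have := (h.cts c (by linarith)).measurable
      unfold Function.uncurry
      refine Measurable.mul (this.comp measurable_fst) ?_
      fun_prop
    · have : ∀ᵐ q : ℝ × ℝ ∂(volume.prod (volume.restrict A)), q.2 ∈ A := by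
        have := ae_restrict_mem (μ := (volume : Measure ℝ)) hA
        exact Measure.quasiMeasurePreserving_snd.ae this
      filter_upwards [this] with q hq
      have hu0 : (0:ℝ) < q.2 := hA0 hq
      rw [Function.uncurry, norm_mul, norm_cpow_eq_rpow_re_of_pos hu0]
      simp

lemma KP.ker_right (h : KP ψ F D) {c : ℝ} (h1 : -(1/2) ≤ c) (h2 : c ≤ 2) {p : ℂ} (hp : p.re < c) :
    ∫ y : ℝ, F (c + y*I) * (1 / (c + y*I - p)) = 2 * Real.pi * ∫ u in Ioi (1:ℝ), (u:ℂ)^(p-1) * ψ u := by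
  have := h.ker h1 h2 (p := p) (A := Ioi 1) measurableSet_Ioi (Ioi_subset_Ioi zero_le_one)
    (integrableOn_Ioi_rpow_of_lt (by linarith) zero_lt_one) 1 (fun s hs => by
      rw [integral_Ioi_cpow_of_lt (by simp; linarith) zero_lt_one]
      rw [show p - s - 1 + 1 = -(s-p) by ring]
      rw [ofReal_one, one_cpow, neg_div_neg_eq])
  rwa [one_mul] at this

lemma KP.ker_left (h : KP ψ F D) {c : ℝ} (h1 : -(1/2) ≤ c) (h2 : c ≤ 2) {p : ℂ} (hp : c < p.re) :
    ∫ y : ℝ, F (c + y*I) * (1 / (c + y*I - p)) = - (2 * Real.pi * ∫ u in Ioc (0:ℝ) 1, (u:ℂ)^(p-1) * ψ u) := by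
  have := h.ker h1 h2 (p := p) (A := Ioc 0 1) measurableSet_Ioc (fun u hu => hu.1)
    ((intervalIntegrable_iff_integrableOn_Ioc_of_le zero_le_one).1 (intervalIntegral.intervalIntegrable_rpow' (by linarith))) (-1) (fun s hs => by
      rw [← intervalIntegral.integral_of_le zero_le_one, integral_cpow (Or.inl (by simp; linarith))]
      have : p - s ≠ 0 := fun h => by
        have := congrArg re h; simp at this; linarith
      rw [show p - s - 1 + 1 = p - s by ring, ofReal_one, one_cpow, ofReal_zero, zero_cpow this, sub_zero, ← neg_sub s p, div_neg, neg_div])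
  rw [← this]; ring

/-- the difference functional -/
def DV (F : ℂ → ℂ) (k : ℂ → ℂ) (v : ℂ) : Prop :=
  Integrable (fun y : ℝ => F ((2:ℝ) + y*I) * k ((2:ℝ) + y*I)) ∧ Integrable (fun y : ℝ => F ((-(1/2):ℝ) + y*I) * k ((-(1/2):ℝ) + y*I)) ∧
  (∫ y : ℝ, F ((2:ℝ) + y*I) * k ((2:ℝ) + y*I)) - (∫ y : ℝ, F ((-(1/2):ℝ) + y*I) * k ((-(1/2):ℝ) + y*I)) = v

lemma DV.add {k l : ℂ → ℂ} {v w : ℂ} (h : DV F k v) (h' : DV F l w) : DV F (fun s => k s + l s) (v + w) := by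
  obtain ⟨a1, a2, a3⟩ := h
  obtain ⟨b1, b2, b3⟩ := h'
  simp only [DV, mul_add]
  refine ⟨a1.add b1, a2.add b2, ?_⟩
  rw [integral_add a1 b1, integral_add a2 b2, ← a3, ← b3]; ring

lemma DV.smul {k : ℂ → ℂ} {v : ℂ} (h : DV F k v) (c : ℂ) : DV F (fun s => c * k s) (c * v) := by
  obtain ⟨a1, a2, a3⟩ := h
  simp only [DV, mul_left_comm _ c]
  refine ⟨a1.const_mul c, a2.const_mul c, ?_⟩
  rw [integral_const_mul, integral_const_mul, ← a3]; ring

lemma DV.sum {ι : Type*} (S : Finset ι) {k : ι → ℂ → ℂ} {v : ι → ℂ} (h : ∀ i ∈ S, DV F (k i) (v i)) : DV F (fun s => ∑ i ∈ S, k i s) (∑ i ∈ S, v i) := by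
  classical
  induction S using Finset.induction_on with
  | empty => simp [DV]
  | insert i S hi ih =>
    simp only [Finset.sum_insert hi]
    exact (h i (Finset.mem_insert_self _ _)).add (ih fun j hj => h j (Finset.mem_insert_of_mem hj))

lemma KP.const (h : KP ψ F D) (c : ℂ) : DV F (fun _ => c) 0 := by
  have h1 : DV F (fun _ => 1) 0 := by
    refine ⟨by simpa using h.int1 (c := 2) (by norm_num) (by norm_num), by simpa using h.int1 (c := -(1/2)) (by norm_num) (by norm_num), ?_⟩
    have a := h.inv (c := 2) (by norm_num) (by norm_num) zero_lt_one
    have b := h.inv (c := -(1/2)) (by norm_num) (by norm_num) zero_lt_one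
    simp only [ofReal_one, one_cpow, one_mul] at a b
    simp only [mul_one, a, b, sub_self]
  simpa using h1.smul c

lemma KP.pole_int (h : KP ψ F D) {c : ℝ} (h1 : -(1/2) ≤ c) (h2 : c ≤ 2) {p : ℂ} (hp : p.re ≠ c) : Integrable (fun y : ℝ => F (c + y*I) * (1 / (c + y*I - p))) := by
  refine h.int h1 h2 (Measurable.aestronglyMeasurable (by fun_prop)) (C := 1/|c - p.re|) 0 fun y => ?_
  rw [norm_div, norm_one, pow_zero, mul_one]
  have : |c - p.re| ≤ ‖(c:ℂ) + y*I - p‖ := by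
    have := abs_re_le_norm ((c:ℂ) + y*I - p)
    rwa [sub_re, ln_re] at this
  have h0 : 0 < |c - p.re| := abs_pos.2 (sub_ne_zero.2 hp.symm)
  gcongr

lemma KP.pole_in (h : KP ψ F D) {p : ℂ} (hp1 : -(1/2) < p.re) (hp2 : p.re < 2) : DV F (fun s => 1 / (s - p)) (2 * Real.pi * F p) := by
  refine ⟨h.pole_int (by norm_num) (by norm_num) hp2.ne, h.pole_int (by norm_num) (by norm_num) hp1.ne', ?_⟩
  rw [h.ker_right (by norm_num) (by norm_num) hp2, h.ker_left (by norm_num) (by norm_num) hp1, sub_neg_eq_add, ← mul_add]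
  obtain ⟨m1, m2⟩ := h.mel p (by linarith)
  rw [← m2, mellin, ← Ioc_union_Ioi_eq_Ioi zero_le_one]
  unfold MellinConvergent at m1
  rw [setIntegral_union (Ioc_disjoint_Ioi le_rfl) measurableSet_Ioi (m1.mono_set (fun u hu => hu.1)) (m1.mono_set (Ioi_subset_Ioi zero_le_one))]
  simp only [smul_eq_mul]
  rw [add_comm]

lemma KP.pole_out (h : KP ψ F D) {p : ℂ} (hp1 : p.re < -(1/2)) : DV F (fun s => 1 / (s - p)) 0 := by
  refine ⟨h.pole_int (by norm_num) (by norm_num) (by linarith : p.re < 2).ne, h.pole_int (by norm_num) (by norm_num) hp1.ne, ?_⟩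
  rw [h.ker_right (by norm_num) (by norm_num) (by linarith : p.re < 2), h.ker_right (by norm_num) (by norm_num) hp1, sub_self]

/-- limits -/
lemma KP.lim (h : KP ψ F D) {k : ℕ → ℂ → ℂ} {l : ℂ → ℂ} {v : ℕ → ℂ} (hk : ∀ n, DV F (k n) (v n)) (C : ℝ) (m : ℕ)
    (hm : ∀ n, Measurable (k n))
    (hb : ∀ n, ∀ s : ℂ, s.re = 2 ∨ s.re = -(1/2) → ‖k n s‖ ≤ C * (1+|s.im|)^m)
    (hl : ∀ s : ℂ, s.re = 2 ∨ s.re = -(1/2) → Tendsto (fun n => k n s) atTop (𝓝 (l s))) :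
    ∃ w, DV F l w ∧ Tendsto v atTop (𝓝 w) := by
  have key : ∀ c : ℝ, c = 2 ∨ c = -(1/2) → Integrable (fun y : ℝ => F (c + y*I) * l (c + y*I)) ∧
      Tendsto (fun n => ∫ y : ℝ, F (c + y*I) * k n (c + y*I)) atTop (𝓝 (∫ y : ℝ, F (c + y*I) * l (c + y*I))) := by
    intro c hc
    have h1 : -(1/2) ≤ c := by rcases hc with rfl | rfl <;> norm_num
    have h2 : c ≤ 2 := by rcases hc with rfl | rfl <;> norm_num
    have hms : ∀ n, AEStronglyMeasurable (fun y : ℝ => k n (c + y*I)) volume := fun n =>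
      ((hm n).comp (by fun_prop : Measurable fun y : ℝ => (c:ℂ) + y*I)).aestronglyMeasurable
    have hlim : ∀ y : ℝ, Tendsto (fun n => k n (c + y*I)) atTop (𝓝 (l (c+y*I))) := fun y => hl _ (by rwa [ln_re])
    have hbb : ∀ n, ∀ y : ℝ, ‖k n (c + y*I)‖ ≤ C * (1+|y|)^m := fun n y => by
      have := hb n (c+y*I) (by rwa [ln_re]); rwa [ln_im] at this
    have hls : AEStronglyMeasurable (fun y : ℝ => l (c + y*I)) volume := aestronglyMeasurable_of_tendsto_ae atTop hms (Eventually.of_forall hlim)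
    refine ⟨h.int h1 h2 hls m fun y => le_of_tendsto (hlim y).norm (Eventually.of_forall fun n => hbb n y), ?_⟩
    refine tendsto_integral_of_dominated_convergence (fun y => D * C * (Real.exp (-(0.39 * |y|)) * (1+|y|)^m)) (fun n => (h.int h1 h2 (hms n) m (hbb n)).1) ((wint m).const_mul _)
      (fun n => Eventually.of_forall fun y => ?_) (Eventually.of_forall fun y => (hlim y).const_mul _)
    rw [norm_mul]
    have := h.D0
    calc _ ≤ (D * Real.exp (-(0.39 * |y|))) * (C * (1+|y|)^m) := by
          gcongr
          · exact h.bdl h1 h2 y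
          · exact hbb n y
      _ = _ := by ring
  obtain ⟨a1, a2⟩ := key 2 (Or.inl rfl)
  obtain ⟨b1, b2⟩ := key (-(1/2)) (Or.inr rfl)
  exact ⟨_, ⟨a1, b1, rfl⟩, (a2.sub b2).congr fun n => (hk n).2.2⟩

end EP

open MeasureTheory Set
namespace EP
open Complex Metric Filter Topology
local notation "Λ" => ArithmeticFunction.vonMangoldt

section
variable {ψ : ℝ → ℂ} {F : ℂ → ℂ} {D : ℝ}

lemma KP.sumLL (h : KP ψ F D) : HasSum (fun n : ℕ => (Λ n : ℂ) * (2 * Real.pi * ψ n)) (∫ y : ℝ, F ((2:ℝ) + y*I) * LL ((2:ℝ) + y*I)) := by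
  have hi := h.int1 (c := 2) (by norm_num) (by norm_num)
  have hn : ∀ (n : ℕ) (y : ℝ), ‖(Λ n : ℂ) * (n:ℂ)^(-(((2:ℝ):ℂ) + y*I)) * F ((2:ℝ)+y*I)‖ = (Λ n * (n:ℝ)^(-(2:ℝ))) * ‖F ((2:ℝ)+y*I)‖ := fun n y => by
    rw [norm_mul, LL_term_norm, ln_re]
  have hs := hasSum_integral_of_summable_integral_norm (F := fun (n : ℕ) (y : ℝ) => (Λ n : ℂ) * (n:ℂ)^(-(((2:ℝ):ℂ) + y*I)) * F ((2:ℝ)+y*I)) (μ := volume)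
    (fun n => by
      refine (hi.norm.const_mul (Λ n * (n:ℝ)^(-(2:ℝ)))).mono' ?_ (Eventually.of_forall fun y => (hn n y).le)
      refine AEStronglyMeasurable.mul ?_ hi.1
      exact Measurable.aestronglyMeasurable (by fun_prop))
    (by
      simp_rw [hn, integral_const_mul]
      refine Summable.mul_right _ ?_
      have := (LL_norm_summable (s := ((2:ℝ):ℂ)) (by simp)).summable
      simpa only [ofReal_re] using this)
  convert hs using 1
  · rfl
  · funext n
    rcases Nat.eq_zero_or_pos n with rfl | hn
    · simp
    · have := h.inv (c := 2) (by norm_num) (by norm_num) (u := (n:ℝ)) (by exact_mod_cast hn)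
      rw [← this, ← integral_const_mul]
      simp only [mul_assoc, ofReal_natCast]
  · refine integral_congr_ae (Eventually.of_forall fun y => ?_)
    simp only
    rw [tsum_mul_right, (LL_hasSum (s := ((2:ℝ):ℂ) + y*I) (by rw [ln_re]; norm_num)).tsum_eq, mul_comm]

lemma norm_le_lin {s : ℂ} (hs : s.re = 2 ∨ s.re = -(1/2)) : ‖s‖ ≤ 2 + |s.im| := by
  refine (norm_le_abs_re_add_abs_im s).trans ?_
  gcongr
  rcases hs with h | h <;> rw [h] <;> norm_num [abs_le]

lemma KP.qq0 (h : KP ψ F D) : DV F qq 0 := by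
  set c0 : ℂ := -Real.eulerMascheroniConstant/2 - Real.log Real.pi/2
  set k : ℕ → ℂ → ℂ := fun n s => c0 + (1/2) * ∑ j ∈ Finset.range (n+1), (1 / ((1:ℂ) + j) - 1 / ((s/2+1) + j)) with hk
  obtain ⟨w, h1, h2⟩ := h.lim (k := k) (l := qq) (v := fun _ => 0) (fun n => by
      have e : k n = fun s => (c0 + (1/2) * ∑ j ∈ Finset.range (n+1), 1 / ((1:ℂ) + j)) + (-1) * ∑ j ∈ Finset.range (n+1), 1/(s - (-2-2*(j:ℂ))) := by
        funext s
        simp only [hk, Finset.sum_sub_distrib, mul_sub]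
        have : ∀ j : ℕ, 1 / ((s/2+1) + (j:ℂ)) = 2 * (1/(s - (-2-2*(j:ℂ)))) := fun j => by
          rw [show (s/2+1) + (j:ℂ) = (s - (-2-2*(j:ℂ)))/2 by ring, one_div_div, mul_one_div]
        simp_rw [this, ← Finset.mul_sum]
        ring
      rw [e]
      have := (h.const (c0 + (1/2) * ∑ j ∈ Finset.range (n+1), 1 / ((1:ℂ) + j))).add ((DV.sum (Finset.range (n+1)) (F := F) (k := fun j s => 1/(s - (-2-2*(j:ℂ)))) (v := fun _ => 0) (fun j _ => h.pole_out (by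
        simp
        have : (0:ℝ) ≤ j := by positivity
        linarith))).smul (-1))
      simpa using this) (‖c0‖ + 3) 1 (fun n => by
      simp only [hk]; fun_prop) (fun n s hs => by
      have a1 : 3/4 ≤ (s/2+1).re := by
        rw [add_re, one_re, show (s/2) = s/(2:ℝ) by norm_num, div_ofReal_re]
        rcases hs with h | h <;> rw [h] <;> norm_num
      have a2 := digamma_part_le a1 n
      have a3 : 6 * ‖s/2+1-1‖ / √(1 + |(s/2+1).im|) ≤ 6 * ‖s/2+1-1‖ := by
        refine div_le_self (by positivity) ?_
        rw [Real.one_le_sqrt]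
        linarith [abs_nonneg (s/2+1).im]
      have a4 : ‖s/2+1-1‖ = ‖s‖/2 := by simp
      have a5 := norm_le_lin hs
      have a6 := a2.trans a3
      refine (norm_add_le _ _).trans ?_
      rw [norm_mul, show ‖(1/2:ℂ)‖ = 1/2 by simp]
      nlinarith [norm_nonneg c0, abs_nonneg s.im]) (fun s hs => by
      have := digamma_lim' (z := s/2+1) (by
        rw [add_re, one_re, show (s/2) = s/(2:ℝ) by norm_num, div_ofReal_re]
        rcases hs with h | h <;> rw [h] <;> norm_num)
      have := (this.div_const 2).sub_const (Real.log Real.pi / 2 : ℂ)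
      rw [← qq] at this
      refine this.congr fun n => ?_
      simp only [hk, c0]
      ring)
  rwa [tendsto_nhds_unique tendsto_const_nhds h2]

lemma den_bd {z a : ℂ} (hd : 1/2 ≤ |z.re - a.re|) : 16 + a.im^2 ≤ ‖z - a‖^2 * (64 + 8*z.im^2) := by
  rw [← normSq_eq_norm_sq, normSq_apply, sub_re, sub_im]
  have : (1/2)^2 ≤ (z.re - a.re)^2 := by rw [← sq_abs (z.re - a.re)]; gcongr
  nlinarith [sq_nonneg (z.im - a.im), sq_nonneg (2*z.im - a.im), mul_nonneg (sq_nonneg (z.im - a.im)) (sq_nonneg z.im), mul_nonneg (sub_nonneg.2 this) (sq_nonneg z.im)]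

lemma KP.LX (h : KP ψ F D) : ∃ w, DV F (fun s => logDeriv Xi (s - 1/2)) w ∧
    Tendsto (fun n => ∑ a ∈ Z n, (mult a : ℂ) * (Real.pi * (F (1/2 + a) + F (1/2 - a)))) atTop (𝓝 w) := by
  refine h.lim (k := fun n s => ∑ a ∈ Z n, (mult a : ℂ) * ((1 / (s - 1/2 - a) + 1 / (s - 1/2 + a)) / 2)) (fun n => ?_) 128 3 (fun n => by fun_prop) (fun n s hs => ?_) (fun s hs => ?_)
  · refine DV.sum (Z n) fun a ha => ?_
    have ha2 := abs_lt.1 (Xi_zero (mem_Z.1 ha).1).2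
    have p1 := h.pole_in (p := 1/2 + a) (by simp; linarith) (by simp; linarith)
    have p2 := h.pole_in (p := 1/2 - a) (by simp; linarith) (by simp; linarith)
    have := (p1.add p2).smul (mult a/2)
    convert this using 1
    · funext s
      rw [sub_add_eq_sub_sub, ← sub_add, mul_div_assoc', div_mul_eq_mul_div]
    · ring
  · have hz : ‖s - 1/2‖ ≤ 2 + |s.im| := by
      refine (norm_le_abs_re_add_abs_im _).trans ?_
      simp only [sub_re, sub_im]
      norm_num
      rcases hs with h | h <;> rw [h] <;> norm_num [abs_le]
    have hS : ‖∑ a ∈ Z n, (mult a : ℂ) * ((1 / (s - 1/2 - a) + 1 / (s - 1/2 + a)) / 2)‖ ≤ ∑ a ∈ Z n, (mult a/(16+a.im^2)) * (‖s - 1/2‖ * (64+8*s.im^2)) := by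
      refine norm_sum_le_of_le _ fun a ha => ?_
      have ha2 := abs_lt.1 (Xi_zero (mem_Z.1 ha).1).2
      have him : (s - 1/2).im = s.im := by simp
      have hre : (s - 1/2).re = 3/2 ∨ (s-1/2).re = -1 := by
        rcases hs with h | h
        · left; simp [h]; norm_num
        · right; simp [h]; norm_num
      set z := s - 1/2
      have hd1 : 1/2 ≤ |z.re - a.re| := by
        rw [le_abs]; rcases hre with h | h <;> rw [h]
        · left; linarith
        · right; linarith
      have hd2 : 1/2 ≤ |z.re - (-a).re| := by
        rw [le_abs, neg_re]; rcases hre with h | h <;> rw [h]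
        · left; linarith
        · right; linarith
      have b1 := den_bd hd1
      have b2 := den_bd hd2
      rw [sub_neg_eq_add, neg_im, neg_sq] at b2
      have n1 : z - a ≠ 0 := fun h0 => by rw [← sub_re, h0] at hd1; norm_num at hd1
      have n2 : z + a ≠ 0 := fun h0 => by rw [← sub_re, sub_neg_eq_add, h0] at hd2; norm_num at hd2
      have e : (1 / (z - a) + 1 / (z + a)) / 2 = z / ((z-a)*(z+a)) := by field_simp; ring
      rw [e, norm_mul, norm_real, Real.norm_of_nonneg (mult_nonneg a), norm_div, norm_mul, ← him]
      have p1 : 0 < ‖z-a‖ := norm_pos_iff.2 n1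
      have p2 : 0 < ‖z+a‖ := norm_pos_iff.2 n2
      have b3 : 16 + a.im^2 ≤ ‖z-a‖ * ‖z+a‖ * (64+8*z.im^2) := by
        refine (sq_le_sq₀ (by positivity) (by positivity)).1 ?_
        calc (16+a.im^2)^2 = (16+a.im^2)*(16+a.im^2) := sq _
          _ ≤ (‖z - a‖^2 * (64 + 8*z.im^2)) * (‖z + a‖^2 * (64 + 8*z.im^2)) := by gcongr
          _ = _ := by ring
      have b4 : ‖z‖/(‖z-a‖*‖z+a‖) ≤ ‖z‖*(64+8*z.im^2)/(16+a.im^2) := by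
        rw [div_le_div_iff₀ (by positivity) (by positivity), mul_assoc]
        gcongr
        linarith
      calc _ ≤ mult a * (‖z‖*(64+8*z.im^2)/(16+a.im^2)) := by gcongr; exact mult_nonneg a
        _ = _ := by ring
    refine hS.trans ?_
    rw [← Finset.sum_mul]
    calc _ ≤ 1 * (‖s - 1/2‖ * (64+8*s.im^2)) := by gcongr; exact sum_four n
      _ ≤ (2+|s.im|) * (64+8*s.im^2) := by rw [one_mul]; gcongr
      _ ≤ _ := by rw [← sq_abs s.im]; nlinarith [abs_nonneg s.im, sq_nonneg |s.im|, pow_nonneg (abs_nonneg s.im) 3]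
  · refine Xi_hadamard ?_
    have : (s - 1/2).re = s.re - 1/2 := by simp
    rw [this, le_abs]
    rcases hs with h | h <;> rw [h] <;> norm_num

lemma int32 : IntegrableOn (fun t : ℝ => 1/((1+t)*√(1+t))) (Ioi 0) ∧ ∫ t in Ioi (0:ℝ), 1/((1+t)*√(1+t)) = 2 := by
  have hd : ∀ t ∈ Ici (0:ℝ), HasDerivAt (fun t : ℝ => -2/√(1+t)) (1/((1+t)*√(1+t))) t := fun t ht => by
    have ht' : (0:ℝ) ≤ t := ht
    have h1 : HasDerivAt (fun t : ℝ => 1+t) 1 t := by simpa using (hasDerivAt_id t).const_add 1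
    have h2 := (h1.sqrt (by positivity)).inv (by positivity)
    have h3 := h2.const_mul (-2)
    refine (h3.congr_deriv ?_)
    rw [Real.sq_sqrt (by positivity)]
    have : 0 < √(1+t) := by positivity
    field_simp
  have hl : Tendsto (fun t : ℝ => -2/√(1+t)) atTop (𝓝 0) := by
    refine Tendsto.div_atTop tendsto_const_nhds ?_
    exact Real.tendsto_sqrt_atTop.comp (tendsto_atTop_add_const_left _ _ tendsto_id)
  have hp : ∀ t ∈ Ioi (0:ℝ), 0 ≤ 1/((1+t)*√(1+t)) := fun t ht => by
    have ht' : (0:ℝ) < t := ht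
    positivity
  refine ⟨integrableOn_Ioi_deriv_of_nonneg' hd hp hl, ?_⟩
  rw [integral_Ioi_of_hasDerivAt_of_nonneg' hd hp hl]
  norm_num

lemma qq_norm {s : ℂ} (h1 : -(1/2) ≤ s.re) (h2 : s.re ≤ 2) : ‖qq s‖ ≤ 2 + 3*√(1+|s.im|) := by
  have e1 : (s/2+1).re = s.re/2+1 := by
    rw [add_re, one_re, show (s/2) = s/(2:ℝ) by norm_num, div_ofReal_re]
  have e2 : (s/2+1).im = s.im/2 := by
    rw [add_im, one_im, show (s/2) = s/(2:ℝ) by norm_num, div_ofReal_im, add_zero]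
  have h := digamma_bound (z := s/2+1) (by rw [e1]; linarith) (by rw [e1]; linarith)
  have h3 : √(1 + |(s/2+1).im|) ≤ √(1+|s.im|) := by
    rw [e2, abs_div]; gcongr
    exact div_le_self (abs_nonneg _) (by norm_num)
  have h4 : ‖(Real.log Real.pi / 2 : ℂ)‖ ≤ 1.1 := by
    rw [norm_div, norm_real, Real.norm_of_nonneg (by linarith [log_pi_ge])]
    have := Real.log_le_sub_one_of_pos Real.pi_pos
    have := Real.pi_lt_d2
    norm_num; linarith
  rw [qq]
  refine (norm_sub_le _ _).trans ?_
  rw [norm_div, show ‖(2:ℂ)‖ = 2 by simp]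
  linarith

lemma R_left {s : ℂ} (hs : s.re = -(1/2)) : ‖1/(s-1) + qq s - logDeriv Xi (s - 1/2)‖ ≤ 15 * √(1+|s.im|) := by
  have h1 := logDeriv_Xi (s := 1-s) (by simp [hs])
  rw [show 1 - s - 1/2 = -(s - 1/2) by ring, logDeriv_Xi_neg] at h1
  have e : 1/(s-1) + qq s - logDeriv Xi (s - 1/2) = 1/(s-1) + qq s + (1/(1-s-1) + qq (1-s) - LL (1-s)) := by rw [← h1]; ring
  rw [e]
  have hre : (1-s).re = 3/2 := by simp [hs]; norm_num
  have b1 := qq_norm (s := s) (by rw [hs]) (by rw [hs]; norm_num)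
  have b2 := qq_norm (s := 1-s) (by rw [hre]; norm_num) (by rw [hre]; norm_num)
  rw [show (1-s).im = -s.im by simp, abs_neg] at b2
  have b3 : ‖LL (1-s)‖ ≤ 2 := by
    have := LL_norm_le (s := 1-s) (σ := 3/2) (by norm_num) hre.ge
    push_cast at this
    exact this.trans LL_three_half
  have b4 : ‖1/(s-1)‖ ≤ 1 := by
    rw [norm_div, norm_one]
    have := abs_re_le_norm (s-1)
    rw [sub_re, hs] at this
    norm_num [abs_of_neg] at this
    rw [div_le_one (by linarith)]; linarith
  have b5 : ‖1/(1-s-1)‖ ≤ 2 := by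
    rw [norm_div, norm_one]
    have := abs_re_le_norm (1-s-1)
    rw [sub_re, hre] at this
    norm_num at this
    rw [show (1:ℂ)-s-1 = -s by ring, norm_neg, div_le_iff₀ (by linarith)]; linarith
  have b6 : 1 ≤ √(1+|s.im|) := by rw [Real.one_le_sqrt]; linarith [abs_nonneg s.im]
  have := norm_add_le (1/(s-1) + qq s) (1/(1-s-1) + qq (1-s) - LL (1-s))
  have := norm_add_le (1/(s-1)) (qq s)
  have := norm_sub_le (1/(1-s-1) + qq (1-s)) (LL (1-s))
  have := norm_add_le (1/(1-s-1)) (qq (1-s))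
  linarith

/-- explicit formula -/
lemma KP.explicit (h : KP ψ F D) {B : ℝ} (hB : ∀ s : ℂ, s.re = -(1/2) → ‖F s‖ ≤ B/(12.25 + s.im^2)) :
    ∃ w R : ℂ, HasSum (fun n : ℕ => (Λ n : ℂ) * ψ n) (F 1 - w + R) ∧ ‖R‖ ≤ 20 * B ∧
    Tendsto (fun n => ∑ a ∈ Z n, (mult a : ℂ) * ((F (1/2 + a) + F (1/2 - a))/2)) atTop (𝓝 w) := by
  obtain ⟨w, h1, h2⟩ := h.LX
  have h3 := ((h.pole_in (p := 1) (by norm_num) (by norm_num)).add h.qq0).add (h1.smul (-1))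
  have pi0 : (Real.pi:ℂ) ≠ 0 := by exact_mod_cast Real.pi_ne_zero
  set R0 := ∫ y : ℝ, F ((-(1/2):ℝ) + y*I) * (1/(((-(1/2):ℝ) + y*I) - 1) + qq ((-(1/2):ℝ) + y*I) + -1 * logDeriv Xi (((-(1/2):ℝ) + y*I) - 1/2)) with hR0
  have e1 : (∫ y : ℝ, F ((2:ℝ) + y*I) * LL ((2:ℝ) + y*I)) = 2 * Real.pi * F 1 - w + R0 := by
    have := h3.2.2
    rw [← hR0, sub_eq_iff_eq_add] at this
    rw [add_zero, neg_one_mul, ← sub_eq_add_neg] at this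
    rw [← this]
    refine integral_congr_ae (Eventually.of_forall fun y => ?_)
    simp only
    rw [logDeriv_Xi (by rw [ln_re]; norm_num)]
    ring
  refine ⟨w/(2*Real.pi), R0/(2*Real.pi), ?_, ?_, ?_⟩
  · have := (h.sumLL).div_const (2*Real.pi : ℂ)
    rw [e1] at this
    convert this using 1
    · rfl
    · funext n; field_simp
    · field_simp
  · have hB0 : 0 ≤ B := by
      have := (norm_nonneg _).trans (hB (-(1/2)) (by norm_num))
      by_contra hc
      have h0 : B / (12.25 + ((-(1/2):ℂ)).im^2) < 0 := div_neg_of_neg_of_pos (by linarith) (by positivity)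
      linarith
    have hval : ∫ y : ℝ, 1/((1+|y|)*√(1+|y|)) = 4 := by
      rw [integral_comp_abs (f := fun t : ℝ => 1/((1+t)*√(1+t))), int32.2]; norm_num
    have hint : Integrable (fun y : ℝ => 1/((1+|y|)*√(1+|y|))) := by
      by_contra hc
      rw [integral_undef hc] at hval
      norm_num at hval
    have : ‖R0‖ ≤ ∫ y : ℝ, 30*B * (1/((1+|y|)*√(1+|y|))) := by
      refine norm_integral_le_of_norm_le (hint.const_mul _) (Eventually.of_forall fun y => ?_)
      have a1 := hB ((-(1/2):ℝ) + y*I) (ln_re _ _)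
      have a2 := R_left (s := (-(1/2):ℝ) + y*I) (ln_re _ _)
      rw [ln_im] at a1 a2
      rw [norm_mul, neg_one_mul, ← sub_eq_add_neg]
      refine (mul_le_mul a1 a2 (norm_nonneg _) (by positivity)).trans ?_
      rw [← sq_abs y]
      set t := |y|
      have ht : 0 ≤ t := abs_nonneg y
      have hq : √(1+t) * √(1+t) = 1+t := Real.mul_self_sqrt (by linarith)
      have hq0 : 0 < √(1+t) := by positivity
      rw [mul_one_div, div_mul_eq_mul_div, div_le_div_iff₀ (by positivity) (by positivity)]
      have : B * (15 * √(1+t)) * ((1+t)*√(1+t)) = 15*B*(1+t)^2 := by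
        linear_combination (15*B*(1+t)) * hq
      rw [this]
      have : (1+t)^2 ≤ 2*(12.25+t^2) := by nlinarith [sq_nonneg (t-1)]
      nlinarith
    rw [integral_const_mul, hval] at this
    rw [norm_div, norm_mul, norm_real, Real.norm_of_nonneg Real.pi_pos.le, show ‖(2:ℂ)‖ = 2 by simp, div_le_iff₀ (by positivity)]
    nlinarith [Real.pi_gt_three]
  · refine (h2.div_const (2*Real.pi : ℂ)).congr fun n => ?_
    rw [Finset.sum_div]
    refine Finset.sum_congr rfl fun a _ => ?_
    field_simp

end

noncomputable def FF (H x : ℝ) (s : ℂ) : ℂ := (x:ℂ)^s * PH H x s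

lemma FF_norm {H x : ℝ} (hx : 0 < x) (s : ℂ) : ‖FF H x s‖ = x^s.re * ‖PH H x s‖ := by
  rw [FF, norm_mul, norm_cpow_eq_rpow_re_of_pos hx]

lemma psi_KP {H x : ℝ} (hH0 : 0 ≤ H) (hx : 1 ≤ x) : ∃ D, KP (psi H x) (FF H x) D := by
  obtain ⟨D, hD, h⟩ := PH_gen (x := x) hH0 (Real.log_nonneg hx)
  have hx0 : 0 < x := by linarith
  refine ⟨x^(2:ℝ) * D, fun s hs => psi_mellin hH0 hx0 hs, fun c hc => ?_, fun s h1 h2 => ?_, psi_cont hH0 hx0⟩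
  · have ho : IsOpen {s : ℂ | -2 < s.re} := isOpen_lt continuous_const continuous_re
    have hG : DifferentiableOn ℂ (GG H) {s : ℂ | -2 < s.re} := fun s hs => (gg_deriv hH0 hs).2.differentiableAt.differentiableWithinAt
    have hF : ContinuousOn (FF H x) {s : ℂ | -2 < s.re} := by
      unfold FF PH
      refine ContinuousOn.mul ?_ ((continuousOn_const.mul hG.continuousOn).add (hG.deriv ho).continuousOn)
      refine Continuous.continuousOn ?_
      exact continuous_const.cpow continuous_id (fun s => Or.inl (by simpa using hx0))
    exact hF.comp_continuous (by fun_prop) fun y => by simpa using hc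
  · rw [FF_norm hx0, mul_assoc]
    gcongr
    exact h s h1 (by linarith)

end EP

open MeasureTheory Set
namespace EP
open Complex Metric Filter Topology
local notation "Λ" => ArithmeticFunction.vonMangoldt

noncomputable def tl (V T θ : ℝ) : ℝ := 5.6e-4 * V^(7/4:ℝ) * Real.exp (-(Real.pi/4*V)) * Real.exp (-(θ/Real.log T))

lemma hi_term {H x T θ : ℝ} (hH : 50 ≤ H) (hx : (10:ℝ)^8 ≤ x) (hV : 50 ≤ T - 2*H) (hθ : 0 ≤ θ) (hθ1 : 35*θ ≤ Real.log x) (hθ2 : 35*θ ≤ T)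
    {a : ℂ} (ha : Xi a = 0) (hT : T < |a.im|) : ‖FF H x (1/2 + a)‖ ≤ x * Real.log x * tl (T-2*H) T θ / (4 + (|a.im|-T)^2) := by
  have hx0 : 0 < x := lt_of_lt_of_le (by norm_num) hx
  have hL := log_x_ge hx
  have hzf := zero_free ha (by linarith)
  have hre := abs_lt.1 (Xi_zero ha).2
  have e1 : (1/2 + a).re = 1/2 + a.re := by simp
  have e2 : (1/2 + a).im = a.im := by simp
  set V := T - 2*H with hVd
  set w := |a.im| - T with hw
  have hw0 : 0 < w := by linarith
  have hP := PH_high hH hL (s := 1/2 + a) (by rw [e1]; linarith) (by rw [e1]; linarith) (v := V + w) (by linarith) (by rw [e2]; linarith)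
  have hlT : 5 ≤ Real.log T := log_ge_five (by linarith)
  have hlg : Real.log T ≤ Real.log |a.im| := Real.log_le_log (by linarith) hT.le
  have hT0 : 0 < T := by linarith
  have hlg2 : Real.log |a.im| ≤ Real.log T + w/T := by
    have h1 : |a.im| = T * (1 + w/T) := by field_simp; linarith
    rw [h1, Real.log_mul hT0.ne' (by positivity)]
    have := Real.log_le_sub_one_of_pos (show 0 < 1 + w/T by positivity)
    linarith
  have e3 : θ/Real.log T - 0.002*w ≤ θ/Real.log |a.im| := by
    rw [le_div_iff₀ (by linarith)]
    have h1 : θ/Real.log T * Real.log T = θ := div_mul_cancel₀ _ (by linarith)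
    have h2 : θ/Real.log T * (w/T) ≤ 0.002*w*5 := by
      rw [div_mul_div_comm, div_le_iff₀ (by positivity)]
      have : 5*T ≤ Real.log T * T := by gcongr
      nlinarith [mul_le_mul_of_nonneg_right hθ2 hw0.le]
    have h3 : θ/Real.log T * Real.log |a.im| ≤ θ/Real.log T * (Real.log T + w/T) := mul_le_mul_of_nonneg_left hlg2 (by positivity)
    nlinarith
  have e4 : x^((1/2+a).re) ≤ x * Real.exp (-(θ/Real.log T) + 0.002*w) := by
    rw [Real.rpow_def_of_pos hx0, e1]
    nth_rewrite 2 [← Real.exp_log hx0]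
    rw [← Real.exp_add]
    gcongr
    have h1 : Real.log x * (1/2 + a.re) ≤ Real.log x * (1 - 1/(35*Real.log |a.im|)) := by gcongr; linarith
    have h2 : θ/Real.log |a.im| ≤ Real.log x * (1/(35*Real.log |a.im|)) := by
      rw [mul_one_div, div_le_div_iff₀ (by linarith) (by linarith)]
      nlinarith
    linarith
  have e5 : (V+w)^(7/4:ℝ) ≤ V^(7/4:ℝ) * Real.exp (0.035*w) := by
    have hV0 : 0 < V := by linarith
    have h1 : V + w ≤ V * Real.exp (0.02*w) := by
      have := Real.add_one_le_exp (0.02*w)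
      nlinarith
    calc (V+w)^(7/4:ℝ) ≤ (V * Real.exp (0.02*w))^(7/4:ℝ) := by gcongr
      _ = _ := by rw [Real.mul_rpow hV0.le (Real.exp_pos _).le, ← Real.exp_mul]; congr 2; ring
  have e6 : 4 + w^2 ≤ 4 * Real.exp (0.72*w) := by
    have := Real.quadratic_le_exp_of_nonneg (x := 0.72*w) (by positivity)
    nlinarith
  rw [FF_norm hx0, le_div_iff₀ (by positivity)]
  have hexp : Real.exp (-(θ/Real.log T) + 0.002*w) * (Real.exp (0.035*w) * Real.exp (-(Real.pi/4*(V+w))) * Real.exp (0.72*w)) ≤ Real.exp (-(Real.pi/4*V)) * Real.exp (-(θ/Real.log T)) := by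
    simp only [← Real.exp_add]
    rw [Real.exp_le_exp]
    nlinarith [Real.pi_gt_d2]
  have hL0 : 0 ≤ Real.log x := by linarith
  have hV0 : 0 ≤ V := by linarith
  calc x^((1/2+a).re) * ‖PH H x (1/2+a)‖ * (4+w^2) ≤ (x * Real.exp (-(θ/Real.log T) + 0.002*w)) * (1.4e-4 * (V^(7/4:ℝ) * Real.exp (0.035*w)) * Real.exp (-(Real.pi/4*(V+w))) * Real.log x) * (4 * Real.exp (0.72*w)) := by
        gcongr
        refine hP.trans ?_
        gcongr
    _ = (x * Real.log x * (5.6e-4 * V^(7/4:ℝ))) * (Real.exp (-(θ/Real.log T) + 0.002*w) * (Real.exp (0.035*w) * Real.exp (-(Real.pi/4*(V+w))) * Real.exp (0.72*w))) := by ring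
    _ ≤ (x * Real.log x * (5.6e-4 * V^(7/4:ℝ))) * (Real.exp (-(Real.pi/4*V)) * Real.exp (-(θ/Real.log T))) := by gcongr
    _ = _ := by rw [tl]; ring

lemma zero_sum {H x T θ : ℝ} (hH : 50 ≤ H) (hx : (10:ℝ)^8 ≤ x) (hV : 50 ≤ T - 2*H) (hθ : 0 ≤ θ) (hθ1 : 35*θ ≤ Real.log x) (hθ2 : 35*θ ≤ T)
    (hRH : ∀ ρ : ℂ, riemannZeta ρ = 0 → 0 < ρ.re → ρ.re < 1 → |ρ.im| ≤ T → ρ.re = 1/2) (n : ℕ) :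
    ‖∑ a ∈ Z n, (mult a : ℂ) * ((FF H x (1/2 + a) + FF H x (1/2 - a))/2)‖ ≤ 78.82 * (x^(1/2:ℝ) * Real.log x) + x * Real.log x * tl (T-2*H) T θ * Real.log T := by
  have hx0 : 0 < x := lt_of_lt_of_le (by norm_num) hx
  have hL := log_x_ge hx
  have hterm : ∀ a : ℂ, ∀ B : ℝ, ‖FF H x (1/2 + a)‖ ≤ B → ‖FF H x (1/2 + -a)‖ ≤ B → ‖(mult a : ℂ) * ((FF H x (1/2 + a) + FF H x (1/2 - a))/2)‖ ≤ mult a * B := fun a B h1 h2 => by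
    rw [norm_mul, norm_real, Real.norm_of_nonneg (mult_nonneg a), norm_div, show ‖(2:ℂ)‖ = 2 by simp, sub_eq_add_neg]
    have := norm_add_le (FF H x (1/2 + a)) (FF H x (1/2 + -a))
    refine mul_le_mul_of_nonneg_left ?_ (mult_nonneg a)
    linarith
  rw [← Finset.sum_filter_add_sum_filter_not (Z n) (fun a => |a.im| ≤ T)]
  refine (norm_add_le _ _).trans (add_le_add ?_ ?_)
  · have hon : ∀ a ∈ (Z n).filter (fun a => |a.im| ≤ T), a.re = 0 := fun a ha => by
      rw [Finset.mem_filter, mem_Z] at ha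
      obtain ⟨h1, h2⟩ := Xi_zero ha.1.1
      have h2 := abs_lt.1 h2
      have := hRH (1/2 + a) h1 (by simp; linarith) (by simp; linarith) (by simpa using ha.2)
      simpa using this
    have hsub : (Z n).filter (fun a => |a.im| ≤ T) ⊆ (Z n).filter (fun a => a.re = 0) := fun a ha => by
      have := hon a ha
      rw [Finset.mem_filter] at ha ⊢
      exact ⟨ha.1, this⟩
    have hb : ∀ a : ℂ, a.re = 0 → ‖FF H x (1/2 + a)‖ ≤ x^(1/2:ℝ) * (1251 * Real.log x / (12.25 + a.im^2)) := fun a ha => by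
      have hr : (1/2 + a).re = 1/2 := by simp [ha]
      have := PH_half (x := x) (by linarith : 0 ≤ H) hL hr
      rw [FF_norm hx0, hr]
      rw [show (1/2 + a).im = a.im by simp] at this
      gcongr
    calc _ ≤ ∑ a ∈ (Z n).filter (fun a => |a.im| ≤ T), mult a * (x^(1/2:ℝ) * (1251 * Real.log x / (12.25 + a.im^2))) := by
          refine norm_sum_le_of_le _ fun a ha => hterm a _ (hb a (hon a ha)) ?_
          have := hb (-a) (by simp [hon a ha])
          simpa using this
      _ ≤ ∑ a ∈ (Z n).filter (fun a => a.re = 0), mult a * (x^(1/2:ℝ) * (1251 * Real.log x / (12.25 + a.im^2))) := by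
          refine Finset.sum_le_sum_of_subset_of_nonneg hsub fun a _ _ => ?_
          have := mult_nonneg a
          have : 0 ≤ Real.log x := by linarith
          positivity
      _ = (1251 * (x^(1/2:ℝ) * Real.log x)) * ∑ a ∈ (Z n).filter (fun a => a.re = 0), mult a/(12.25 + a.im^2) := by
          rw [Finset.mul_sum]
          refine Finset.sum_congr rfl fun a _ => by ring
      _ ≤ (1251 * (x^(1/2:ℝ) * Real.log x)) * 0.063 := by
          have : 0 ≤ Real.log x := by linarith
          gcongr
          exact sum_online n
      _ ≤ _ := by
          have : 0 ≤ x^(1/2:ℝ) * Real.log x := mul_nonneg (by positivity) (by linarith)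
          nlinarith
  · have htl : 0 ≤ x * Real.log x * tl (T-2*H) T θ := by
      have : 0 ≤ Real.log x := by linarith
      have : 0 ≤ T - 2*H := by linarith
      unfold tl; positivity
    calc _ ≤ ∑ a ∈ (Z n).filter (fun a => ¬ |a.im| ≤ T), mult a * (x * Real.log x * tl (T-2*H) T θ / (4 + (|a.im|-T)^2)) := by
          refine norm_sum_le_of_le _ fun a ha => ?_
          rw [Finset.mem_filter, mem_Z, not_le] at ha
          refine hterm a _ (hi_term hH hx hV hθ hθ1 hθ2 ha.1.1 ha.2) ?_
          have := hi_term hH hx hV hθ hθ1 hθ2 (a := -a) (by rw [Xi_even]; exact ha.1.1) (by simpa using ha.2)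
          simpa using this
      _ ≤ ∑ a ∈ Z n, mult a * (x * Real.log x * tl (T-2*H) T θ / (4 + (|a.im|-T)^2)) := by
          refine Finset.sum_le_sum_of_subset_of_nonneg (Finset.filter_subset _ _) fun a _ _ => ?_
          have := mult_nonneg a
          positivity
      _ = (x * Real.log x * tl (T-2*H) T θ) * ∑ a ∈ Z n, mult a/(4 + (|a.im|-T)^2) := by
          rw [Finset.mul_sum]
          refine Finset.sum_congr rfl fun a _ => by ring
      _ ≤ _ := by gcongr; exact sum_near (by linarith) n

lemma pow54 {V : ℝ} (hV : 0 ≤ V) : V^(7/4:ℝ) = V^(5/4:ℝ) * √V := by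
  rw [Real.sqrt_eq_rpow, ← Real.rpow_add_of_nonneg hV (by norm_num) (by norm_num)]
  norm_num

lemma tl_le {V T θ : ℝ} (hV : 50 ≤ V) (hVT : V ≤ T) (h : V^(5/4:ℝ) * Real.exp (-(θ/Real.log T)) ≤ 2160) :
    tl V T θ ≤ 1.21 * √T * Real.exp (-(Real.pi/4*V)) := by
  rw [tl, pow54 (by linarith)]
  have h1 : √V ≤ √T := Real.sqrt_le_sqrt hVT
  calc _ = 5.6e-4 * (V^(5/4:ℝ) * Real.exp (-(θ/Real.log T))) * √V * Real.exp (-(Real.pi/4*V)) := by ring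
    _ ≤ 5.6e-4 * 2160 * √T * Real.exp (-(Real.pi/4*V)) := by gcongr
    _ ≤ _ := by gcongr; norm_num

lemma case_iii {V T : ℝ} (hV : 343 ≤ V) (hVT : V ≤ T) (hT : T ≤ 9*V) : V^(5/4:ℝ) * Real.exp (-(V/35/Real.log T)) ≤ 2160 := by
  set W := V^(1/3:ℝ) with hW
  have hV0 : 0 < V := by linarith
  have hW3 : W^3 = V := by rw [hW, ← Real.rpow_natCast, ← Real.rpow_mul hV0.le]; norm_num
  have hW7 : 7 ≤ W := by
    have : (7:ℝ)^3 ≤ W^3 := by rw [hW3]; norm_num; exact hV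
    exact le_of_pow_le_pow_left₀ (by norm_num) (by positivity) this
  have hlog : Real.log T ≤ 1.2*W := by
    have h1 : Real.log T ≤ Real.log (4096 * (W/7)^3) := by
      refine Real.log_le_log (by linarith) ?_
      rw [div_pow, hW3]; linarith
    rw [Real.log_mul (by norm_num) (by positivity), Real.log_pow] at h1
    have h2 : Real.log 4096 = 12 * Real.log 2 := by rw [show (4096:ℝ) = 2^12 by norm_num, Real.log_pow]; norm_num
    have h3 := Real.log_le_sub_one_of_pos (show 0 < W/7 by positivity)
    have := Real.log_two_lt_d9
    push_cast at h1
    linarith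
  have hlog0 : 0 < Real.log T := Real.log_pos (by linarith)
  set z := V/35/Real.log T with hz
  have hz1 : W^2/42 ≤ z := by
    rw [hz, le_div_iff₀ hlog0]
    have : W^2/42 * Real.log T ≤ W^2/42 * (1.2*W) := by gcongr
    refine this.trans (le_of_eq ?_)
    rw [← hW3]; ring
  have hz0 : 0 < W^2/42 := by positivity
  have h1 : 1.35 * z ≤ Real.exp (z/2) := by
    have := Real.add_one_le_exp (z/2 - 1)
    have e : Real.exp (z/2) = Real.exp (z/2-1) * Real.exp 1 := by rw [← Real.exp_add]; congr 1; ring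
    rw [e]
    have := Real.exp_one_gt_d9
    nlinarith
  have h2 : 1.82 * z^2 ≤ Real.exp z := by
    have e : Real.exp z = Real.exp (z/2)^2 := by rw [← Real.exp_nat_mul]; congr 1; push_cast; ring
    rw [e]
    have : (1.35*z)^2 ≤ Real.exp (z/2)^2 := by gcongr
    nlinarith
  have h3 : V^(5/4:ℝ) ≤ W^4 := by
    rw [hW, ← Real.rpow_natCast, ← Real.rpow_mul hV0.le]
    exact Real.rpow_le_rpow_of_exponent_le (by linarith) (by norm_num)
  rw [Real.exp_neg, ← div_eq_mul_inv, div_le_iff₀ (Real.exp_pos _)]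
  have h4 : (W^2/42)^2 ≤ z^2 := by gcongr
  nlinarith

lemma case_i {V : ℝ} (hV0 : 0 ≤ V) (hV : V ≤ 343) : V^(5/4:ℝ) ≤ 2160 := by
  calc V^(5/4:ℝ) ≤ (4.4^(4:ℕ))^(5/4:ℝ) := by gcongr; norm_num; linarith
    _ = 4.4^(5:ℕ) := by rw [← Real.rpow_natCast, ← Real.rpow_mul (by norm_num), ← Real.rpow_natCast]; norm_num
    _ ≤ 2160 := by norm_num

lemma case_ii {V T x : ℝ} (hV : 343 ≤ V) (hVT : V ≤ T) (hx : 0 < x) (hL : Real.log x ≤ V) : tl V T 0 ≤ 1.4 * √T * x^(-(1:ℝ)/2) := by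
  have h1 : Real.exp (-(V/2)) ≤ x^(-(1:ℝ)/2) := by
    rw [Real.rpow_def_of_pos hx]; gcongr; linarith
  have h2 : √V ≤ √T := Real.sqrt_le_sqrt hVT
  have h3 : V^(5/4:ℝ) ≤ V^2 := by
    rw [← Real.rpow_natCast]; exact Real.rpow_le_rpow_of_exponent_le (by linarith) (by norm_num)
  have h4 : Real.exp (-(Real.pi/4*V)) = Real.exp (-(Real.pi/4-1/2)*V) * Real.exp (-(V/2)) := by rw [← Real.exp_add]; congr 1; ring
  have h5 : 0.04*V^2 * Real.exp (-(Real.pi/4-1/2)*V) ≤ 1 := by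
    have := Real.quadratic_le_exp_of_nonneg (x := (Real.pi/4-1/2)*V) (by nlinarith [Real.pi_gt_d2])
    rw [neg_mul, Real.exp_neg, ← div_eq_mul_inv, div_le_one (Real.exp_pos _)]
    have h6 : 0.285*V ≤ (Real.pi/4-1/2)*V := by gcongr; linarith [Real.pi_gt_d2]
    have : (0.285*V)^2 ≤ ((Real.pi/4-1/2)*V)^2 := by gcongr
    nlinarith
  rw [tl, pow54 (by linarith), zero_div, neg_zero, Real.exp_zero, mul_one, h4]
  calc 5.6e-4 * (V^(5/4:ℝ) * √V) * (Real.exp (-(Real.pi/4-1/2)*V) * Real.exp (-(V/2)))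
      ≤ 5.6e-4 * (V^2 * √T) * (Real.exp (-(Real.pi/4-1/2)*V) * x^(-(1:ℝ)/2)) := by gcongr
    _ = 0.014 * (0.04*V^2 * Real.exp (-(Real.pi/4-1/2)*V)) * (√T * x^(-(1:ℝ)/2)) := by ring
    _ ≤ 0.014 * 1 * (√T * x^(-(1:ℝ)/2)) := by gcongr
    _ ≤ _ := by
      have : 0 ≤ √T * x^(-(1:ℝ)/2) := by positivity
      nlinarith

lemma F_one {H x : ℝ} (hH0 : 0 ≤ H) (hx : 0 < x) : FF H x 1 = ((x * ∫ t in Ioi (0:ℝ), (etaPlus H t)^2 * Real.log (x*t) : ℝ) : ℂ) := by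
  have h := (psi_mellin (s := 1) hH0 hx (by norm_num)).2
  rw [FF, ← h, mellin]
  have h1 := integral_comp_mul_left_Ioi (fun u : ℝ => psi H x u) 0 hx
  rw [mul_zero] at h1
  have h2 : ∫ t in Ioi (0:ℝ), (t:ℂ)^((1:ℂ)-1) • psi H x t = ∫ t in Ioi (0:ℝ), psi H x t := by
    refine setIntegral_congr_fun measurableSet_Ioi fun t ht => ?_
    simp
  have h3 : ∫ t in Ioi (0:ℝ), psi H x (x*t) = ((∫ t in Ioi (0:ℝ), (etaPlus H t)^2 * Real.log (x*t) : ℝ) : ℂ) := by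
    rw [← integral_complex_ofReal]
    refine setIntegral_congr_fun measurableSet_Ioi fun t ht => ?_
    have ht' : 0 < t := ht
    rw [psi_eq hx (by positivity), mul_div_cancel_left₀ _ hx.ne', mul_comm]
  rw [h2, ofReal_mul, ← h3, h1, Complex.real_smul, ofReal_inv, mul_inv_cancel_left₀ (by exact_mod_cast hx.ne')]

lemma main_bound {H x T θ : ℝ} (hH : 50 ≤ H) (hx : (10:ℝ)^8 ≤ x) (hV : 50 ≤ T - 2*H) (hθ : 0 ≤ θ) (hθ1 : 35*θ ≤ Real.log x) (hθ2 : 35*θ ≤ T)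
    (hRH : ∀ ρ : ℂ, riemannZeta ρ = 0 → 0 < ρ.re → ρ.re < 1 → |ρ.im| ≤ T → ρ.re = 1/2) :
    |(∑' n : ℕ, Λ n * Real.log n * (etaPlus H (n / x))^2) - x * ∫ t in Ioi (0:ℝ), (etaPlus H t)^2 * Real.log (x*t)|
      ≤ (78.83 * x^(-(1:ℝ)/2) + tl (T-2*H) T θ * Real.log T) * (x * Real.log x) := by
  have hx0 : 0 < x := lt_of_lt_of_le (by norm_num) hx
  have hL := log_x_ge hx
  have hH0 : 0 ≤ H := by linarith
  obtain ⟨D, hK⟩ := psi_KP hH0 (le_trans (by norm_num) hx : 1 ≤ x)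
  obtain ⟨w, R, h1, h2, h3⟩ := hK.explicit (B := 2220 * Real.log x * x^(-(1:ℝ)/2)) (fun s hs => by
    rw [FF_norm hx0, hs]
    have := PH_left (x := x) hH0 hL (s := s) (by rw [hs]; norm_num)
    calc _ ≤ x^(-(1/2):ℝ) * (2220 * Real.log x / (12.25 + s.im^2)) := by gcongr
      _ = _ := by rw [show (-(1/2):ℝ) = -(1:ℝ)/2 by norm_num]; ring)
  have h4 := le_of_tendsto h3.norm (Eventually.of_forall fun n => zero_sum hH hx hV hθ hθ1 hθ2 hRH n)
  have h5 : (∑' n : ℕ, ((Λ n * Real.log n * (etaPlus H (n / x))^2 : ℝ):ℂ)) = FF H x 1 - w + R := by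
    rw [← h1.tsum_eq]
    refine tsum_congr fun n => ?_
    rcases Nat.eq_zero_or_pos n with rfl | hn
    · simp
    · rw [psi_eq hx0 (by exact_mod_cast hn), ← ofReal_mul, mul_assoc]
  rw [← ofReal_tsum, F_one hH0 hx0] at h5
  have h6 : (((∑' n : ℕ, Λ n * Real.log n * (etaPlus H (n / x))^2) - x * ∫ t in Ioi (0:ℝ), (etaPlus H t)^2 * Real.log (x*t) : ℝ) : ℂ) = R - w := by
    rw [ofReal_sub, h5]; ring
  rw [← Real.norm_eq_abs, ← norm_real, h6]
  refine (norm_sub_le _ _).trans ((add_le_add h2 h4).trans ?_)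
  have e1 : x^(1/2:ℝ) = x^(-(1:ℝ)/2) * x := by
    nth_rewrite 3 [← Real.rpow_one x]
    rw [← Real.rpow_add hx0]; norm_num
  rw [e1]
  have h7 : 0 ≤ x^(-(1:ℝ)/2) * Real.log x := mul_nonneg (by positivity) (by linarith)
  have h8 : 44400 * (x^(-(1:ℝ)/2) * Real.log x) ≤ 0.01 * x * (x^(-(1:ℝ)/2) * Real.log x) := by
    gcongr; norm_num at hx; linarith
  linarith

end EP

theorem etaPlus_sq_log_sum_conditional
    (H : ℝ) (hH50 : 50 ≤ H)
    (x : ℝ) (hx : (10:ℝ)^8 ≤ x)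
    (T₀ : ℝ) (hT₀ : 2 * H + max (H / 4) 50 ≤ T₀)
    (hRH : ∀ ρ : ℂ, riemannZeta ρ = 0 → 0 < ρ.re → ρ.re < 1 → |ρ.im| ≤ T₀ →
      ρ.re = 1/2) :
    ∃ E : ℝ,
      (∑' n : ℕ, ArithmeticFunction.vonMangoldt n * Real.log n * (etaPlus H (n / x))^2)
        = x * (∫ t in Set.Ioi (0:ℝ), (etaPlus H t)^2 * Real.log (x * t))
          + E * (x * Real.log x) ∧
      |E| ≤ (0.607 * (Real.log T₀)^2 / Real.log x + 1.21 * Real.log T₀)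
              * Real.sqrt T₀ * Real.exp (-(Real.pi * (T₀ - 2 * H)) / 4)
            + (2.06 * Real.sqrt T₀ * Real.log T₀ + 43.87) * x ^ (-(1:ℝ)/2) := by
  have hx0 : 0 < x := lt_of_lt_of_le (by norm_num) hx
  have hL := EP.log_x_ge hx
  have hm1 := le_max_left (H/4) 50
  have hm2 := le_max_right (H/4) 50
  have hV : 50 ≤ T₀ - 2*H := by linarith
  have hlT : 5 ≤ Real.log T₀ := EP.log_ge_five (by linarith)
  have hsT : 12 ≤ √T₀ := by
    rw [Real.le_sqrt (by norm_num) (by linarith)]; linarith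
  set X := x ^ (-(1:ℝ)/2) with hX
  have hX0 : 0 < X := by positivity
  have hst : 60 ≤ √T₀ * Real.log T₀ := by nlinarith
  have hexp : Real.exp (-(Real.pi * (T₀ - 2 * H)) / 4) = Real.exp (-(Real.pi/4*(T₀ - 2*H))) := by congr 1; ring
  have hE0 : 0 ≤ 0.607 * (Real.log T₀)^2 / Real.log x * √T₀ * Real.exp (-(Real.pi/4*(T₀ - 2*H))) := by
    have : 0 ≤ Real.log x := by linarith
    positivity
  have hE1 : 0 ≤ 1.21 * √T₀ * Real.exp (-(Real.pi/4*(T₀ - 2*H))) * Real.log T₀ := by positivity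
  have fin : ∀ θ : ℝ, 0 ≤ θ → 35*θ ≤ Real.log x → 35*θ ≤ T₀ →
      EP.tl (T₀-2*H) T₀ θ ≤ 1.21 * √T₀ * Real.exp (-(Real.pi/4*(T₀ - 2*H))) + 1.4 * √T₀ * X →
      ∃ E : ℝ,
      (∑' n : ℕ, ArithmeticFunction.vonMangoldt n * Real.log n * (etaPlus H (n / x))^2)
        = x * (∫ t in Set.Ioi (0:ℝ), (etaPlus H t)^2 * Real.log (x * t))
          + E * (x * Real.log x) ∧
      |E| ≤ (0.607 * (Real.log T₀)^2 / Real.log x + 1.21 * Real.log T₀)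
              * Real.sqrt T₀ * Real.exp (-(Real.pi * (T₀ - 2 * H)) / 4)
            + (2.06 * Real.sqrt T₀ * Real.log T₀ + 43.87) * X := by
    intro θ h1 h2 h3 h4
    have hb := EP.main_bound hH50 hx hV h1 h2 h3 hRH
    have hxl : 0 < x * Real.log x := mul_pos hx0 (by linarith)
    refine ⟨((∑' n : ℕ, ArithmeticFunction.vonMangoldt n * Real.log n * (etaPlus H (n / x))^2) - x * (∫ t in Set.Ioi (0:ℝ), (etaPlus H t)^2 * Real.log (x * t))) / (x * Real.log x), ?_, ?_⟩
    · rw [div_mul_cancel₀ _ hxl.ne']; ring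
    · rw [abs_div, abs_of_pos hxl, div_le_iff₀ hxl]
      refine hb.trans (mul_le_mul_of_nonneg_right ?_ hxl.le)
      rw [hexp]
      have h5 := mul_le_mul_of_nonneg_right h4 (by linarith : 0 ≤ Real.log T₀)
      have h6 : 60 * X ≤ √T₀ * Real.log T₀ * X := by gcongr
      linarith
  by_cases c1 : T₀ - 2*H ≤ 343
  · refine fin 0 le_rfl (by linarith) (by linarith) ?_
    have := EP.tl_le (θ := 0) hV (by linarith : T₀ - 2*H ≤ T₀) (by simpa using EP.case_i (by linarith) c1)
    have h0 : 0 ≤ 1.4 * √T₀ * X := by positivity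
    linarith
  · push Not at c1
    have hVT : T₀ - 2*H ≤ T₀ := by linarith
    by_cases c2 : Real.log x ≤ T₀ - 2*H
    · refine fin 0 le_rfl (by linarith) (by linarith) ?_
      have := EP.case_ii c1.le hVT hx0 c2
      rw [← hX] at this
      have h0 : 0 ≤ 1.21 * √T₀ * Real.exp (-(Real.pi/4*(T₀ - 2*H))) := by positivity
      linarith
    · push Not at c2
      refine fin ((T₀ - 2*H)/35) (by linarith) (by linarith) (by linarith) ?_
      have := EP.tl_le hV hVT (EP.case_iii c1.le hVT (by linarith))
      have h0 : 0 ≤ 1.4 * √T₀ * X := by positivity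
      linarith
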